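/- For sufficiently small constants T_s > 0 and T_H > 0 and a sufficiently large integer N > 0 there exist a locally Lipschitz function C of class K∞ and a constant σ > 0 with the following property: for every partition {τ_i}_{i=0}^∞ of [0,∞) with sup_{i≥0}(τ_{i+1} − τ_i) ≤ T_s and all initial data z_0 ∈ ℝ^n, x_0 ∈ C^0([−r,0]; ℝ^n), u_0 ∈ L^∞([−r−τ,0); U), the closed-loop system consisting of the plant ẋ(t) = f(x(t), u(t−τ)), the observer ż(t) = f(z(t), u(t−r−τ)) + k̂(z(t), w(t), u(t−r−τ)) for t ≥ 0 a.e., the inter-sample predictor ẇ(t) = ∇h(z(t)) f(z(t), u(t−r−τ)) on each [τ_i, τ_{i+1}) a.e. with resets w(τ_i) = h(x(τ_i − r)), and the control u(t) = k(Φ_N(z(jT_H), ũ_{jT_H})) for t ∈ [jT_H, (j+1)T_H) and every integer j ≥ 0, with initial conditions z(0) = z_0, x(θ) = x_0(θ) for θ ∈ [−r,0], u(θ) = u_0(θ) for θ ∈ [−r−τ,0), has a unique solution defined for all t ≥ 0would, and this solution satisfies ‖x_t‖ + |z(t)| + ‖ũ_t‖ ≤ exp(−σ t) · C(‖x_0‖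 + |z_0| + ‖ũ_0‖) for all t ≥ 0. -/

import Mathlib

open MeasureTheory Set Filter
open scoped RealInnerProductSpace Topology

/-- Euler iterates for the approximate predictor: `x_{i+1} = x_i + ∫_{i h}^{(i+1) h} f(x_i, u(s−r−τ)) ds`
with step `h = (τ+r)/N`. -/
noncomputable def eulerIter {E F : Type*} [NormedAddCommGroup E] [NormedSpace ℝ E]
    (f : E → F → E) (r τ : ℝ) (N : ℕ) (x0 : E) (v : ℝ → F) : ℕ → E
  | 0 => x0
  | (i + 1) =>
      eulerIter f r τ N x0 v i +
        ∫ s in ((i : ℝ) * ((τ + r) / N))..(((i : ℝ) + 1) * ((τ + r) / N)),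
          f (eulerIter f r τ N x0 v i) (v (s - r - τ))

/-- The approximate predictor mapping `Φ_N(x₀, u) = x_N`. -/
noncomputable def PhiN {E F : Type*} [NormedAddCommGroup E] [NormedSpace ℝ E]
    (f : E → F → E) (r τ : ℝ) (N : ℕ) (x0 : E) (v : ℝ → F) : E :=
  eulerIter f r τ N x0 v N

/-- `(x, z, w, u)` is a (Carathéodory) solution of the ISP-O-P-DFC closed loop
(1.1), (1.2), (2.10), (2.11), (2.12), (2.13) with initial data `(z₀, x₀, u₀)`:
plant `ẋ(t) = f(x(t), u(t−τ))`; observer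
`ż(t) = f(z(t), u(t−r−τ)) + k̂(z(t), w(t), u(t−r−τ))`; inter-sample predictor
`ẇ(t) = ∇h(z(t))f(z(t), u(t−r−τ))` on `[τ_i, τ_{i+1})` with resets
`w(τ_i) = h(x(τ_i − r))`; control `u(t) = k(Φ_N(z(jT_H), ũ_{jT_H}))` on
`[jT_H, (j+1)T_H)`. -/
def IsClosedLoopSol {n m k' : ℕ}
    (f : EuclideanSpace ℝ (Fin n) → EuclideanSpace ℝ (Fin m) → EuclideanSpace ℝ (Fin n))
    (h : EuclideanSpace ℝ (Fin n) → EuclideanSpace ℝ (Fin k'))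
    (khat : EuclideanSpace ℝ (Fin n) → EuclideanSpace ℝ (Fin k') → EuclideanSpace ℝ (Fin m) →
      EuclideanSpace ℝ (Fin n))
    (kctrl : EuclideanSpace ℝ (Fin n) → EuclideanSpace ℝ (Fin m))
    (r τ TH : ℝ) (N : ℕ) (π : ℕ → ℝ)
    (z₀ : EuclideanSpace ℝ (Fin n)) (x₀ : ℝ → EuclideanSpace ℝ (Fin n))
    (u₀ : ℝ → EuclideanSpace ℝ (Fin m))
    (x z : ℝ → EuclideanSpace ℝ (Fin n)) (w : ℝ → EuclideanSpace ℝ (Fin k'))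
    (u : ℝ → EuclideanSpace ℝ (Fin m)) : Prop :=
  ContinuousOn x (Ici (-r)) ∧
  (∀ θ ∈ Icc (-r) (0:ℝ), x θ = x₀ θ) ∧
  (∀ t, 0 ≤ t → x t = x 0 + ∫ s in (0:ℝ)..t, f (x s) (u (s - τ))) ∧
  ContinuousOn z (Ici 0) ∧ z 0 = z₀ ∧
  (∀ t, 0 ≤ t → z t = z₀ +
    ∫ s in (0:ℝ)..t, (f (z s) (u (s - r - τ)) + khat (z s) (w s) (u (s - r - τ)))) ∧
  (∀ i : ℕ, ∀ t ∈ Ico (π i) (π (i + 1)),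
    w t = h (x (π i - r)) +
      ∫ s in (π i)..t, fderiv ℝ h (z s) (f (z s) (u (s - r - τ)))) ∧
  (∀ θ ∈ Ico (-(r + τ)) (0:ℝ), u θ = u₀ θ) ∧
  (∀ j : ℕ, ∀ t ∈ Ico ((j : ℝ) * TH) (((j : ℝ) + 1) * TH),
    u t = kctrl (PhiN f r τ N (z ((j : ℝ) * TH)) (fun θ => u ((j : ℝ) * TH + θ))))

/-- If every admissible bound `D` for `g / ω` can be improved to `A + D / 2`, then `2 * A` is a
bound. -/
theorem le_two_mul_of_halving {ι : Type*} {g ω : ι → ℝ} {A : ℝ} (hA : 0 ≤ A) (hω : ∀ i, 0 ≤ ω i)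
    (h0 : ∃ D : ℝ, 0 ≤ D ∧ ∀ i, g i ≤ D * ω i)
    (hstep : ∀ D : ℝ, 0 ≤ D → (∀ i, g i ≤ D * ω i) → ∀ i, g i ≤ (A + D / 2) * ω i) (i : ι) :
    g i ≤ 2 * A * ω i := by
  obtain ⟨D, hD, hb⟩ := h0
  have key : ∀ n : ℕ, ∃ D' : ℝ, D' ≤ 2 * A + D * (1 / 2) ^ n ∧ 0 ≤ D' ∧ ∀ i, g i ≤ D' * ω i := by
    intro n
    induction n with
    | zero => exact ⟨D, by simp; linarith, hD, hb⟩
    | succ n ih =>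
      obtain ⟨D', h1, h2, h3⟩ := ih
      refine ⟨A + D' / 2, ?_, by positivity, hstep D' h2 h3⟩
      rw [pow_succ]; linarith
  choose D' h1 h2 h3 using key
  have hlim : Tendsto (fun n : ℕ => (2 * A + D * (1 / 2 : ℝ) ^ n) * ω i) atTop
      (𝓝 ((2 * A + D * 0) * ω i)) :=
    ((tendsto_const_nhds.add (tendsto_const_nhds.mul
      (tendsto_pow_atTop_nhds_zero_of_lt_one (by norm_num) (by norm_num)))).mul_const _)
  rw [mul_zero, add_zero] at hlim
  exact ge_of_tendsto' hlim fun n => (h3 n i).trans (mul_le_mul_of_nonneg_right (h1 n) (hω i))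

/-- `y` is, on `[a, b]`, a primitive of the bounded integrable function `g`. -/
structure IsPrimitiveOn {E : Type*} [NormedAddCommGroup E] [NormedSpace ℝ E]
    (y g : ℝ → E) (a b : ℝ) : Prop where
  le : a ≤ b
  integrable : IntervalIntegrable g volume a b
  bounded : ∃ B, ∀ s ∈ Icc a b, ‖g s‖ ≤ B
  eq_integral : ∀ t ∈ Icc a b, y t = y a + ∫ s in a..t, g s

namespace IsPrimitiveOn

variable {E F : Type*} [NormedAddCommGroup E] [NormedSpace ℝ E] [NormedAddCommGroup F]
  [NormedSpace ℝ F] {y g : ℝ → E} {z k : ℝ → F} {a b c d : ℝ}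

theorem integrable_sub (h : IsPrimitiveOn y g a b) {s t : ℝ} (hs : s ∈ Icc a b)
    (ht : t ∈ Icc a b) : IntervalIntegrable g volume s t :=
  h.integrable.mono_set (by
    rw [uIcc_of_le (hs.1.trans hs.2)]; exact (convex_Icc a b).ordConnected.uIcc_subset hs ht)

theorem sub_eq (h : IsPrimitiveOn y g a b) {s t : ℝ} (hs : s ∈ Icc a b) (ht : t ∈ Icc a b) :
    y t - y s = ∫ x in s..t, g x := by
  have ha : a ∈ Icc a b := ⟨le_rfl, hs.1.trans hs.2⟩
  rw [h.eq_integral t ht, h.eq_integral s hs, add_sub_add_left_eq_sub,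
    intervalIntegral.integral_interval_sub_left (h.integrable_sub ha ht) (h.integrable_sub ha hs)]

theorem mono (h : IsPrimitiveOn y g a b) (hc : c ∈ Icc a b) (hd : d ∈ Icc a b) (hcd : c ≤ d) :
    IsPrimitiveOn y g c d where
  le := hcd
  integrable := h.integrable_sub hc hd
  bounded := h.bounded.imp fun _ hB s hs => hB s ⟨hc.1.trans hs.1, hs.2.trans hd.2⟩
  eq_integral t ht := by
    rw [← h.sub_eq hc ⟨hc.1.trans ht.1, ht.2.trans hd.2⟩]; abel

theorem congr (h : IsPrimitiveOn y g a b) {y' g' : ℝ → E} (hy : ∀ t ∈ Icc a b, y t = y' t)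
    (hg : ∀ t ∈ Icc a b, g t = g' t) : IsPrimitiveOn y' g' a b := by
  have hab := h.le
  refine ⟨hab, h.integrable.congr ?_, h.bounded.imp fun _ hB s hs => hg s hs ▸ hB s hs,
    fun t ht => ?_⟩
  · intro s hs
    rw [uIoc_of_le hab] at hs
    exact hg s ⟨hs.1.le, hs.2⟩
  · rw [← hy t ht, ← hy a ⟨le_rfl, hab⟩, h.eq_integral t ht]
    congr 1
    refine intervalIntegral.integral_congr fun s hs => ?_
    rw [uIcc_of_le ht.1] at hs
    exact hg s ⟨hs.1, hs.2.trans ht.2⟩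

theorem norm_sub_le (h : IsPrimitiveOn y g a b) {B s t : ℝ} (hB : ∀ s ∈ Icc a b, ‖g s‖ ≤ B)
    (hs : s ∈ Icc a b) (ht : t ∈ Icc a b) : ‖y t - y s‖ ≤ B * |t - s| := by
  rw [h.sub_eq hs ht]
  refine intervalIntegral.norm_integral_le_of_norm_le_const fun x hx => hB x ?_
  exact (convex_Icc a b).ordConnected.uIcc_subset hs ht (uIoc_subset_uIcc hx)

theorem continuousOn (h : IsPrimitiveOn y g a b) : ContinuousOn y (Icc a b) := by
  obtain ⟨B, hB⟩ := h.bounded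
  have : LipschitzOnWith (Real.toNNReal B) y (Icc a b) := by
    refine LipschitzOnWith.of_dist_le_mul fun s hs t ht => ?_
    rw [dist_eq_norm, Real.dist_eq]
    exact (h.norm_sub_le hB ht hs).trans
      (mul_le_mul_of_nonneg_right (Real.le_coe_toNNReal B) (abs_nonneg _))
  exact this.continuousOn

theorem prodMk [CompleteSpace E] [CompleteSpace F] (h : IsPrimitiveOn y g a b) (h' : IsPrimitiveOn z k a b) :
    IsPrimitiveOn (fun t => (y t, z t)) (fun t => (g t, k t)) a b where
  le := h.le
  integrable := by
    exact ⟨Integrable.prodMk h.integrable.1 h'.integrable.1,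
      Integrable.prodMk h.integrable.2 h'.integrable.2⟩
  bounded := by
    obtain ⟨B, hB⟩ := h.bounded
    obtain ⟨B', hB'⟩ := h'.bounded
    exact ⟨max B B', fun s hs => max_le_max (hB s hs) (hB' s hs)⟩
  eq_integral t ht := by
    have ha : a ∈ Icc a b := ⟨le_rfl, ht.1.trans ht.2⟩
    have h1 := h.integrable_sub ha ht
    have h2 := h'.integrable_sub ha ht
    rw [intervalIntegral.integral_of_le ht.1]
    rw [integral_pair h1.1 h2.1, ← intervalIntegral.integral_of_le ht.1,
      ← intervalIntegral.integral_of_le ht.1, h.eq_integral t ht, h'.eq_integral t ht]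
    rfl

theorem sub (h : IsPrimitiveOn y g a b) {y' g' : ℝ → E} (h' : IsPrimitiveOn y' g' a b) :
    IsPrimitiveOn (fun t => y t - y' t) (fun t => g t - g' t) a b where
  le := h.le
  integrable := h.integrable.sub h'.integrable
  bounded := by
    obtain ⟨B, hB⟩ := h.bounded
    obtain ⟨B', hB'⟩ := h'.bounded
    exact ⟨B + B', fun s hs => (_root_.norm_sub_le _ _).trans (add_le_add (hB s hs) (hB' s hs))⟩
  eq_integral t ht := by
    have ha : a ∈ Icc a b := ⟨le_rfl, ht.1.trans ht.2⟩
    rw [intervalIntegral.integral_sub (h.integrable_sub ha ht) (h'.integrable_sub ha ht),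
      h.eq_integral t ht, h'.eq_integral t ht]
    abel

theorem id_one (hab : a ≤ b) : IsPrimitiveOn (fun t : ℝ => t) (fun _ => (1 : ℝ)) a b where
  le := hab
  integrable := intervalIntegrable_const
  bounded := ⟨1, fun _ _ => by simp⟩
  eq_integral t _ := by simp

theorem comp_add_right (h : IsPrimitiveOn y g a b) (c : ℝ) :
    IsPrimitiveOn (fun t => y (t + c)) (fun t => g (t + c)) (a - c) (b - c) where
  le := by linarith [h.le]
  integrable := by simpa using h.integrable.comp_add_right c
  bounded := h.bounded.imp fun _ hB s hs => hB _ ⟨by linarith [hs.1], by linarith [hs.2]⟩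
  eq_integral t ht := by
    rw [intervalIntegral.integral_comp_add_right (fun t => g t)]
    rw [sub_add_cancel, ← h.eq_integral _ ⟨by linarith [ht.1], by linarith [ht.2]⟩]

theorem comp_sub_right (h : IsPrimitiveOn y g a b) (c : ℝ) :
    IsPrimitiveOn (fun t => y (t - c)) (fun t => g (t - c)) (a + c) (b + c) := by
  simpa [sub_eq_add_neg] using h.comp_add_right (-c)

/-- Chain rule in integral form. -/
theorem comp_hasFDerivAt [CompleteSpace E] [CompleteSpace F] (h : IsPrimitiveOn y g a b) {Φ : E → F} {Φ' : E → E →L[ℝ] F}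
    (hΦ : ∀ x, HasFDerivAt Φ (Φ' x) x) (hΦ' : Continuous Φ') :
    IsPrimitiveOn (fun t => Φ (y t)) (fun t => Φ' (y t) (g t)) a b := by
  have hab := h.le
  obtain ⟨B, hB⟩ := h.bounded
  have hcont : ContinuousOn (fun t => Φ' (y t)) (Icc a b) :=
    hΦ'.comp_continuousOn h.continuousOn
  have hbdd : ∃ B, ∀ s ∈ Icc a b, ‖Φ' (y s) (g s)‖ ≤ B := by
    obtain ⟨B', hB'⟩ := isCompact_Icc.exists_bound_of_continuousOn hcont
    refine ⟨B' * B, fun s hs => (ContinuousLinearMap.le_opNorm _ _).trans ?_⟩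
    exact mul_le_mul (hB' s hs) (hB s hs) (norm_nonneg _) ((norm_nonneg _).trans (hB' s hs))
  have hInt : IntervalIntegrable (fun t => Φ' (y t) (g t)) volume a b := by
    rw [intervalIntegrable_iff_integrableOn_Icc_of_le hab]
    obtain ⟨B', hB'⟩ := hbdd
    refine IntegrableOn.of_bound measure_Icc_lt_top ?_ B'
      ((ae_restrict_mem measurableSet_Icc).mono hB')
    have h1 := hcont.aestronglyMeasurable_of_isCompact (μ := volume) isCompact_Icc
      measurableSet_Icc
    have h2 := ((intervalIntegrable_iff_integrableOn_Icc_of_le hab).1 h.integrable).1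
    exact (ContinuousLinearMap.id ℝ (E →L[ℝ] F)).aestronglyMeasurable_comp₂ h1 h2
  have hInt' : ∀ s ∈ Icc a b, ∀ t ∈ Icc a b,
      IntervalIntegrable (fun t => Φ' (y t) (g t)) volume s t := fun s hs t ht =>
    hInt.mono_set (by
      rw [uIcc_of_le hab]; exact (convex_Icc a b).ordConnected.uIcc_subset hs ht)
  refine ⟨hab, hInt, hbdd, ?_⟩
  have ha : a ∈ Icc a b := ⟨le_rfl, hab⟩
  have hΦc : Continuous Φ := continuous_iff_continuousAt.2 fun x => (hΦ x).continuousAt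
  set D : ℝ → F := fun t => Φ (y t) - ∫ s in a..t, Φ' (y s) (g s) with hD
  have hDc : ContinuousOn D (Icc a b) := by
    refine (hΦc.comp_continuousOn h.continuousOn).sub ?_
    have := intervalIntegral.continuousOn_primitive_interval (μ := volume) (a := a) (b := b)
      (f := fun s => Φ' (y s) (g s)) (by
        rw [uIcc_of_le hab]
        exact (intervalIntegrable_iff_integrableOn_Icc_of_le hab).1 hInt)
    rwa [uIcc_of_le hab] at this
  suffices H : ∀ t ∈ Icc a b, D t = D a by
    intro t ht
    have := H t ht
    simp only [hD, intervalIntegral.integral_same, sub_zero] at this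
    rw [← this]; abel
  refine constant_of_has_deriv_right_zero hDc fun t ht => ?_
  have htI : t ∈ Icc a b := ⟨ht.1, ht.2.le⟩
  rw [hasDerivWithinAt_iff_isLittleO, Asymptotics.isLittleO_iff]
  intro ε hε
  have hB0 : 0 ≤ B := (norm_nonneg _).trans (hB t htI)
  set η : ℝ := ε / (2 * (B + 1)) with hη
  have hηpos : 0 < η := by positivity
  have hle : 𝓝[Ici t] t ≤ 𝓝[Icc a b] t := by
    rw [← nhdsWithin_Icc_eq_nhdsGE ht.2]
    exact nhdsWithin_mono _ (Icc_subset_Icc_left ht.1)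
  have hy : Tendsto y (𝓝[Ici t] t) (𝓝 (y t)) := (h.continuousOn t htI).mono_left hle
  have e1 := hy.eventually (((hΦ (y t)).isLittleO).def hηpos)
  have e2 : ∀ᶠ s in 𝓝[Ici t] t, ‖Φ' (y s) - Φ' (y t)‖ < η := by
    have := (hcont t htI).mono_left hle
    have := (tendsto_iff_norm_sub_tendsto_zero.1 this).eventually (gt_mem_nhds hηpos)
    exact this
  obtain ⟨δ, hδ, hδ'⟩ := Metric.mem_nhdsWithin_iff.1 e2
  have e3 : ∀ᶠ s in 𝓝[Ici t] t, s ∈ Ico t (min b (t + δ)) :=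
    Ico_mem_nhdsGE (lt_min ht.2 (by linarith))
  filter_upwards [e1, e3] with s hs1 hs3
  have hts : t ≤ s := hs3.1
  have hsb : s < b := hs3.2.trans_le (min_le_left _ _)
  have hsδ : s < t + δ := hs3.2.trans_le (min_le_right _ _)
  have hsI : s ∈ Icc a b := ⟨ht.1.trans hts, hsb.le⟩
  have hgint := h.integrable_sub htI hsI
  have eq1 : D s - D t - (s - t) • (0 : F) = (Φ (y s) - Φ (y t) - Φ' (y t) (y s - y t))
      - ∫ x in t..s, (Φ' (y x) (g x) - Φ' (y t) (g x)) := by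
    rw [intervalIntegral.integral_sub (hInt' t htI s hsI)
      ⟨(Φ' (y t)).integrable_comp hgint.1, (Φ' (y t)).integrable_comp hgint.2⟩, h.sub_eq htI hsI,
      ContinuousLinearMap.intervalIntegral_comp_comm _ hgint,
      ← intervalIntegral.integral_interval_sub_left (hInt' a ha s hsI) (hInt' a ha t htI)]
    simp only [hD, smul_zero]
    abel
  rw [eq1, Real.norm_of_nonneg (sub_nonneg.2 hts)]
  have b1 : ‖y s - y t‖ ≤ B * (s - t) := by
    simpa [abs_of_nonneg (sub_nonneg.2 hts)] using h.norm_sub_le hB htI hsI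
  have b2 : ‖∫ x in t..s, (Φ' (y x) (g x) - Φ' (y t) (g x))‖ ≤ η * B * |s - t| := by
    refine intervalIntegral.norm_integral_le_of_norm_le_const fun x hx => ?_
    rw [uIoc_of_le hts] at hx
    have hx1 : ‖Φ' (y x) - Φ' (y t)‖ < η := hδ' ⟨by
      rw [Metric.mem_ball, Real.dist_eq, abs_of_pos (by linarith [hx.1])]; linarith [hx.2],
      hx.1.le⟩
    rw [← _root_.sub_apply]
    exact (ContinuousLinearMap.le_opNorm _ _).trans (mul_le_mul hx1.le
      (hB x ⟨ht.1.trans hx.1.le, hx.2.trans hsb.le⟩) (norm_nonneg _) hηpos.le)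
  rw [abs_of_nonneg (sub_nonneg.2 hts)] at b2
  have b3 : η * B + η * B ≤ ε := by
    have : η * (2 * (B + 1)) = ε := by rw [hη]; field_simp
    nlinarith
  calc _ ≤ ‖Φ (y s) - Φ (y t) - Φ' (y t) (y s - y t)‖
        + ‖∫ x in t..s, (Φ' (y x) (g x) - Φ' (y t) (g x))‖ := _root_.norm_sub_le _ _
    _ ≤ η * (B * (s - t)) + η * B * (s - t) :=
        add_le_add (hs1.trans (mul_le_mul_of_nonneg_left b1 hηpos.le)) b2
    _ = (η * B + η * B) * (s - t) := by ring
    _ ≤ ε * (s - t) := mul_le_mul_of_nonneg_right b3 (sub_nonneg.2 hts)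

theorem comp_contDiff [CompleteSpace E] [CompleteSpace F] (h : IsPrimitiveOn y g a b)
    {Φ : E → F} (hΦ : ContDiff ℝ 1 Φ) :
    IsPrimitiveOn (fun t => Φ (y t)) (fun t => fderiv ℝ Φ (y t) (g t)) a b :=
  h.comp_hasFDerivAt (fun x => (hΦ.differentiable one_ne_zero x).hasFDerivAt)
    (hΦ.continuous_fderiv one_ne_zero)

section Real

variable {v q : ℝ → ℝ}

/-- If `v` decreases whenever it lies above `c`, then the sublevel set `{v ≤ c}` is invariant. -/
theorem le_of_barrier (h : IsPrimitiveOn v q a b) (ha : v a ≤ c)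
    (hq : ∀ s ∈ Icc a b, c ≤ v s → q s ≤ 0) {t : ℝ} (ht : t ∈ Icc a b) : v t ≤ c := by
  by_contra! hcon
  set S : Set ℝ := Icc a t ∩ v ⁻¹' Iic c with hS
  have hsub : Icc a t ⊆ Icc a b := Icc_subset_Icc_right ht.2
  have hSc : IsCompact S := by
    refine isCompact_Icc.of_isClosed_subset ?_ inter_subset_left
    exact (h.continuousOn.mono hsub).preimage_isClosed_of_isClosed isClosed_Icc isClosed_Iic
  have hSn : S.Nonempty := ⟨a, ⟨le_rfl, ht.1⟩, ha⟩
  obtain ⟨s, ⟨hs1, hs2⟩, hs3⟩ := hSc.exists_isGreatest hSn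
  have hst : s < t := lt_of_le_of_ne hs1.2 (by rintro rfl; exact absurd hs2 (not_le.2 hcon))
  have hlt : ∀ x ∈ Ioc s t, c < v x := fun x hx => by
    by_contra! hx'
    exact absurd (hs3 ⟨⟨hs1.1.trans hx.1.le, hx.2⟩, hx'⟩) (not_le.2 hx.1)
  have h1 : v t - v s ≤ 0 := by
    rw [h.sub_eq (hsub hs1) ht, intervalIntegral.integral_of_le hst.le]
    refine setIntegral_nonpos measurableSet_Ioc fun x hx => ?_
    exact hq x ⟨hs1.1.trans hx.1.le, hx.2.trans ht.2⟩ (hlt x hx).le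
  have h2 : v s ≤ c := hs2
  linarith

/-- A nonnegative function decreasing at rate `η` above the level `c` reaches `{v ≤ c}` in finite
time. -/
theorem le_of_decrease (h : IsPrimitiveOn v q a b) {η : ℝ} (hc : 0 ≤ c)
    (hq : ∀ s ∈ Icc a b, c < v s → q s ≤ -η) (hq' : ∀ s ∈ Icc a b, c ≤ v s → q s ≤ 0)
    (hlong : v a ≤ η * (b - a)) : v b ≤ c := by
  have hab := h.le
  by_cases hex : ∃ s ∈ Icc a b, v s ≤ c
  · obtain ⟨s, hs, hsc⟩ := hex
    refine (h.mono hs ⟨hab, le_rfl⟩ hs.2).le_of_barrier hsc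
      (fun x hx => hq' x ⟨hs.1.trans hx.1, hx.2⟩) ⟨hs.2, le_rfl⟩
  · push Not at hex
    have h1 := (h.sub_eq ⟨le_rfl, hab⟩ ⟨hab, le_rfl⟩)
    have h2 : ∫ s in a..b, q s ≤ ∫ _ in a..b, -η :=
      intervalIntegral.integral_mono_on hab h.integrable intervalIntegrable_const
        fun s hs => hq s hs (hex s hs)
    rw [intervalIntegral.integral_const, smul_eq_mul] at h2
    linarith

theorem le_of_nonpos (h : IsPrimitiveOn v q a b) (hq : ∀ s ∈ Icc a b, q s ≤ 0) {t : ℝ}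
    (ht : t ∈ Icc a b) : v t ≤ v a :=
  h.le_of_barrier le_rfl (fun s hs _ => hq s hs) ht

/-- Exponential comparison with an exponentially decaying forcing term. -/
theorem le_exp_of_decay (h : IsPrimitiveOn v q a b) {l κ d : ℝ} (hκ : κ < l) (hd : 0 ≤ d)
    (hq : ∀ s ∈ Icc a b, q s ≤ -l * v s + d * Real.exp (-κ * s)) {t : ℝ} (ht : t ∈ Icc a b) :
    v t ≤ Real.exp (-l * (t - a)) * v a + d / (l - κ) * Real.exp (-κ * t) := by
  set m : ℝ := d / (l - κ) with hm
  have hlκ : 0 < l - κ := sub_pos.2 hκ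
  have hmd : m * (l - κ) = d := by rw [hm]; field_simp
  have hpair := h.prodMk (id_one h.le)
  have hΦ : ∀ p : ℝ × ℝ, HasFDerivAt
      (fun p : ℝ × ℝ => Real.exp (l * p.2) * p.1 - m * Real.exp ((l - κ) * p.2))
      ((Real.exp (l * p.2) • ContinuousLinearMap.fst ℝ ℝ ℝ +
        p.1 • (Real.exp (l * p.2) • (l • ContinuousLinearMap.snd ℝ ℝ ℝ))) -
        m • (Real.exp ((l - κ) * p.2) • ((l - κ) • ContinuousLinearMap.snd ℝ ℝ ℝ))) p := by
    intro p
    have h2 : HasFDerivAt (fun p : ℝ × ℝ => p.2) (ContinuousLinearMap.snd ℝ ℝ ℝ) p :=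
      hasFDerivAt_snd
    have h1 : HasFDerivAt (fun p : ℝ × ℝ => p.1) (ContinuousLinearMap.fst ℝ ℝ ℝ) p :=
      hasFDerivAt_fst
    exact (((h2.const_mul l).exp).mul h1).sub (((h2.const_mul (l - κ)).exp).const_mul m)
  have hw := hpair.comp_hasFDerivAt hΦ (by fun_prop)
  have hle := hw.le_of_nonpos (fun s hs => ?_) ht
  · simp only at hle
    have hva : Real.exp (l * t) * v t ≤
        Real.exp (l * a) * v a + m * Real.exp ((l - κ) * t) := by
      have : 0 ≤ m * Real.exp ((l - κ) * a) := by positivity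
      linarith
    have e1 : Real.exp (-l * t) * Real.exp (l * t) = 1 := by
      rw [← Real.exp_add]; simp
    have e2 : Real.exp (-l * t) * Real.exp (l * a) = Real.exp (-l * (t - a)) := by
      rw [← Real.exp_add]; ring_nf
    have e3 : Real.exp (-l * t) * Real.exp ((l - κ) * t) = Real.exp (-κ * t) := by
      rw [← Real.exp_add]; ring_nf
    calc v t = Real.exp (-l * t) * (Real.exp (l * t) * v t) := by
          rw [← mul_assoc, e1, one_mul]
      _ ≤ Real.exp (-l * t) * (Real.exp (l * a) * v a + m * Real.exp ((l - κ) * t)) :=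
          mul_le_mul_of_nonneg_left hva (Real.exp_pos _).le
      _ = _ := by rw [← e2, ← e3]; ring
  · have hqs := hq s hs
    have e4 : Real.exp (l * s) * Real.exp (-κ * s) = Real.exp ((l - κ) * s) := by
      rw [← Real.exp_add]; ring_nf
    simp only [_root_.sub_apply, _root_.add_apply, _root_.smul_apply,
      ContinuousLinearMap.coe_fst', ContinuousLinearMap.coe_snd', smul_eq_mul, mul_one]
    have : Real.exp (l * s) * q s ≤
        Real.exp (l * s) * (-l * v s + d * Real.exp (-κ * s)) :=
      mul_le_mul_of_nonneg_left hqs (Real.exp_pos _).le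
    have e5 : Real.exp (l * s) * (-l * v s + d * Real.exp (-κ * s)) =
      -(v s * (Real.exp (l * s) * l)) + m * (Real.exp ((l - κ) * s) * (l - κ)) := by
      rw [← e4, ← hmd]; ring
    linarith

end Real

end IsPrimitiveOn

theorem norm_integral_le_exp {E : Type*} [NormedAddCommGroup E] [NormedSpace ℝ E] {g : ℝ → E}
    {a t κ D : ℝ} (hD : 0 ≤ D) (hat : a ≤ t)
    (hg : ∀ s ∈ Ico a t, ‖g s‖ ≤ κ * (D * Real.exp (2 * κ * s))) :
    ‖∫ s in a..t, g s‖ ≤ D / 2 * Real.exp (2 * κ * t) := by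
  have hInt : IntervalIntegrable (fun s => κ * (D * Real.exp (2 * κ * s))) volume a t :=
    Continuous.intervalIntegrable (by fun_prop) _ _
  have hae : ∀ᵐ s, s ∈ Ioc a t → ‖g s‖ ≤ κ * (D * Real.exp (2 * κ * s)) := by
    filter_upwards [compl_mem_ae_iff.2 (measure_singleton t)] with s hst hs
    exact hg s ⟨hs.1.le, lt_of_le_of_ne hs.2 hst⟩
  refine (intervalIntegral.norm_integral_le_of_norm_le hat hae hInt).trans ?_
  have hderiv : ∀ s ∈ uIcc a t, HasDerivAt (fun s => D / 2 * Real.exp (2 * κ * s))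
      (κ * (D * Real.exp (2 * κ * s))) s := by
    intro s _
    refine ((((hasDerivAt_id s).const_mul (2 * κ)).exp).const_mul (D / 2)).congr_deriv ?_
    simp only [id]; ring
  rw [intervalIntegral.integral_eq_sub_of_hasDerivAt hderiv hInt]
  have : 0 ≤ D / 2 * Real.exp (2 * κ * a) := by positivity
  linarith

/-- Grönwall's inequality for causal functional differential inequalities. -/
theorem IsPrimitiveOn.norm_le_of_causal {E : Type*} [NormedAddCommGroup E] [NormedSpace ℝ E]
    {y g : ℝ → E} {K A T : ℝ} (hy : IsPrimitiveOn y g 0 T) (hK : 0 ≤ K) (hA : 0 ≤ A)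
    (hg : ∀ s ∈ Ico 0 T, ∀ D : ℝ, 0 ≤ D → (∀ s' ∈ Icc 0 s, ‖y s'‖ ≤ D) → ‖g s‖ ≤ K * (D + A))
    {t : ℝ} (ht : t ∈ Icc 0 T) : ‖y t‖ ≤ (2 * ‖y 0‖ + A) * Real.exp (2 * K * t) := by
  have hexp : ∀ s : ℝ, 0 ≤ s → 1 ≤ Real.exp (2 * K * s) := fun s hs =>
    Real.one_le_exp (by positivity)
  have key := le_two_mul_of_halving (ι := Icc (0:ℝ) T) (g := fun s => ‖y s‖)
    (ω := fun s => Real.exp (2 * K * s)) (A := ‖y 0‖ + A / 2) (by positivity)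
    (fun _ => (Real.exp_pos _).le) ?_ ?_ ⟨t, ht⟩
  · exact key.trans_eq (by ring)
  · obtain ⟨B, hB⟩ := isCompact_Icc.exists_bound_of_continuousOn hy.continuousOn
    have hB0 : 0 ≤ B := (norm_nonneg _).trans (hB 0 ⟨le_rfl, hy.le⟩)
    exact ⟨B, hB0, fun s => (hB s s.2).trans (le_mul_of_one_le_right hB0 (hexp _ s.2.1))⟩
  · intro D hD hbd s
    have h1 : ‖∫ s in (0:ℝ)..s, g s‖ ≤ (D + A) / 2 * Real.exp (2 * K * s) := by
      refine norm_integral_le_exp (by positivity) s.2.1 fun s' hs' => ?_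
      refine (hg s' ⟨hs'.1, hs'.2.trans_le s.2.2⟩ (D * Real.exp (2 * K * s')) (by positivity)
        fun s'' hs'' => ?_).trans (mul_le_mul_of_nonneg_left ?_ hK)
      · refine (hbd ⟨s'', hs''.1, hs''.2.trans (hs'.2.le.trans s.2.2)⟩).trans ?_
        refine mul_le_mul_of_nonneg_left (Real.exp_le_exp.2 ?_) hD
        nlinarith [hs''.2]
      · nlinarith [hexp s' hs'.1]
    have h2 := hy.eq_integral s s.2
    rw [h2]
    refine (norm_add_le _ _).trans ?_
    nlinarith [hexp s s.2.1, norm_nonneg (y 0)]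

/-- Picard's theorem for causal functional differential equations with a bounded right-hand side,
measurable in time and globally Lipschitz with respect to the past of the trajectory. -/
theorem exists_solution_of_causal_lipschitz {E : Type*} [NormedAddCommGroup E] [NormedSpace ℝ E]
    [CompleteSpace E] (F : (ℝ → E) → ℝ → E) {K B : ℝ} (ξ₀ : E)
    (hmeas : ∀ ξ, Continuous ξ → AEStronglyMeasurable (F ξ) volume)
    (hbound : ∀ ξ, Continuous ξ → ∀ s, ‖F ξ s‖ ≤ B)
    (hlip : ∀ ξ η, Continuous ξ → Continuous η → ∀ s, 0 ≤ s → ∀ D : ℝ, 0 ≤ D →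
      (∀ s' ∈ Icc 0 s, ‖ξ s' - η s'‖ ≤ D) → ‖F ξ s - F η s‖ ≤ K * D) :
    ∃ ξ : ℝ → E, Continuous ξ ∧ ξ 0 = ξ₀ ∧ ∀ t, 0 ≤ t → ξ t = ξ₀ + ∫ s in (0:ℝ)..t, F ξ s := by
  set κ : ℝ := max K 1 with hκdef
  have hκ1 : 1 ≤ κ := le_max_right _ _
  have hκ : 0 < κ := by linarith
  have hB : 0 ≤ B := (norm_nonneg _).trans (hbound (fun _ => 0) continuous_const 0)
  have hInt : ∀ ξ, Continuous ξ → ∀ a b, IntervalIntegrable (F ξ) volume a b := by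
    intro ξ hξ a b
    exact ⟨IntegrableOn.of_bound measure_Ioc_lt_top (hmeas ξ hξ).restrict B
      (ae_of_all _ (hbound ξ hξ)), IntegrableOn.of_bound measure_Ioc_lt_top
        (hmeas ξ hξ).restrict B (ae_of_all _ (hbound ξ hξ))⟩
  let step : (ℝ → E) → ℝ → E := fun ξ t => ξ₀ + ∫ s in (0:ℝ)..(max t 0), F ξ s
  have hstepLip : ∀ ξ, Continuous ξ → LipschitzWith (Real.toNNReal B) (step ξ) := by
    intro ξ hξ
    refine LipschitzWith.of_dist_le_mul fun t s => ?_
    rw [Real.coe_toNNReal B hB, dist_eq_norm, Real.dist_eq]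
    simp only [step]
    rw [add_sub_add_left_eq_sub, intervalIntegral.integral_interval_sub_left (hInt ξ hξ _ _)
      (hInt ξ hξ _ _)]
    refine (intervalIntegral.norm_integral_le_of_norm_le_const fun x _ => hbound ξ hξ x).trans ?_
    refine mul_le_mul_of_nonneg_left ?_ hB
    have := abs_max_sub_max_le_max t 0 s 0
    simpa using this
  let seq : ℕ → ℝ → E := fun n => step^[n] (fun _ => ξ₀)
  have hseq0 : seq 0 = fun _ => ξ₀ := rfl
  have hseqS : ∀ n, seq (n + 1) = step (seq n) := fun n => Function.iterate_succ_apply' _ _ _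
  have hlipn : ∀ n, LipschitzWith (Real.toNNReal B) (seq n) := by
    intro n
    induction n with
    | zero => rw [hseq0]; exact LipschitzWith.const' _
    | succ n ih => rw [hseqS]; exact hstepLip _ ih.continuous
  have hcn : ∀ n, Continuous (seq n) := fun n => (hlipn n).continuous
  have hmono : ∀ {s t : ℝ}, s ≤ t → Real.exp (2 * κ * s) ≤ Real.exp (2 * κ * t) := fun hst =>
    Real.exp_le_exp.2 (by nlinarith)
  have hgeo : ∀ n t, ‖seq (n + 1) t - seq n t‖ ≤
      B * (1 / 2) ^ n * Real.exp (2 * κ * max t 0) := by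
    intro n
    induction n with
    | zero =>
      intro t
      have ht0 : 0 ≤ max t 0 := le_max_right _ _
      rw [hseqS, hseq0]
      simp only [step, add_sub_cancel_left, pow_zero, mul_one]
      refine (intervalIntegral.norm_integral_le_of_norm_le_const
        fun x _ => hbound _ continuous_const x).trans (mul_le_mul_of_nonneg_left ?_ hB)
      rw [sub_zero, abs_of_nonneg ht0]
      nlinarith [Real.add_one_le_exp (2 * κ * max t 0)]
    | succ n ih =>
      intro t
      have ht0 : 0 ≤ max t 0 := le_max_right _ _
      rw [show seq (n + 1 + 1) t = ξ₀ + ∫ s in (0:ℝ)..(max t 0), F (seq (n + 1)) s from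
          congrFun (hseqS (n + 1)) t,
        show seq (n + 1) t = ξ₀ + ∫ s in (0:ℝ)..(max t 0), F (seq n) s from congrFun (hseqS n) t]
      rw [add_sub_add_left_eq_sub, ← intervalIntegral.integral_sub]
      rotate_left
      · exact hInt _ (hcn _) _ _
      · exact hInt _ (hcn _) _ _
      rw [pow_succ, ← mul_assoc, mul_one_div]
      refine norm_integral_le_exp (by positivity) ht0 fun s hs => ?_
      refine (hlip _ _ (hcn (n + 1)) (hcn n) s hs.1 (B * (1 / 2) ^ n * Real.exp (2 * κ * s))
        (by positivity) fun s' hs' => ?_).trans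
        (mul_le_mul_of_nonneg_right (le_max_left _ _) (by positivity))
      refine (ih s').trans (mul_le_mul_of_nonneg_left (hmono ?_) (by positivity))
      rw [max_eq_left hs'.1]; exact hs'.2
  have hdist : ∀ t n, dist (seq n t) (seq (n + 1) t) ≤
      B * Real.exp (2 * κ * max t 0) * (1 / 2) ^ n := by
    intro t n
    rw [dist_comm, dist_eq_norm]
    exact (hgeo n t).trans_eq (by ring)
  have hex : ∀ t, ∃ l, Tendsto (fun n => seq n t) atTop (𝓝 l) := fun t =>
    cauchySeq_tendsto_of_complete (cauchySeq_of_le_geometric _ _ (by norm_num) (hdist t))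
  choose ξ hξ using hex
  have herr : ∀ n t, ‖seq n t - ξ t‖ ≤ 2 * B * (1 / 2) ^ n * Real.exp (2 * κ * max t 0) := by
    intro n t
    rw [← dist_eq_norm]
    refine (dist_le_of_le_geometric_of_tendsto _ _ (by norm_num) (hdist t) (hξ t) n).trans_eq ?_
    ring
  have hξlip : LipschitzWith (Real.toNNReal B) ξ := by
    refine LipschitzWith.of_dist_le_mul fun t s => ?_
    exact le_of_tendsto ((hξ t).dist (hξ s)) (Eventually.of_forall fun n =>
      (hlipn n).dist_le_mul t s)
  have hfix : ∀ t, 0 ≤ t → ξ t = ξ₀ + ∫ s in (0:ℝ)..t, F ξ s := by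
    intro t ht
    refine tendsto_nhds_unique ((tendsto_add_atTop_iff_nat 1).2 (hξ t)) ?_
    have hpow : Tendsto (fun n : ℕ => B * (1 / 2 : ℝ) ^ n * Real.exp (2 * κ * t)) atTop
        (𝓝 (B * 0 * Real.exp (2 * κ * t))) :=
      (tendsto_const_nhds.mul (tendsto_pow_atTop_nhds_zero_of_lt_one (by norm_num)
        (by norm_num))).mul_const _
    rw [mul_zero, zero_mul] at hpow
    refine tendsto_iff_norm_sub_tendsto_zero.2 (squeeze_zero (fun _ => norm_nonneg _) (fun n => ?_)
      hpow)
    rw [hseqS]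
    simp only [step, max_eq_left ht]
    rw [add_sub_add_left_eq_sub, ← intervalIntegral.integral_sub (hInt _ (hcn _) _ _)
      (hInt _ hξlip.continuous _ _)]
    have := norm_integral_le_exp (g := fun s => F (seq n) s - F ξ s) (a := 0) (t := t)
      (κ := κ) (D := 2 * B * (1 / 2) ^ n) (by positivity) ht fun s hs => ?_
    · refine this.trans_eq (by ring)
    refine (hlip _ _ (hcn n) hξlip.continuous s hs.1 (2 * B * (1 / 2) ^ n * Real.exp (2 * κ * s))
      (by positivity) fun s' hs' => ?_).trans
      (mul_le_mul_of_nonneg_right (le_max_left _ _) (by positivity))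
    refine (herr n s').trans (mul_le_mul_of_nonneg_left (hmono ?_) (by positivity))
    rw [max_eq_left hs'.1]; exact hs'.2
  refine ⟨ξ, hξlip.continuous, ?_, hfix⟩
  simpa using hfix 0 le_rfl

theorem LocallyLipschitz.comp_at {α β γ : Type*} [PseudoEMetricSpace α] [PseudoEMetricSpace β]
    [PseudoEMetricSpace γ] {g : β → γ} {f : α → β} {x : α} (hg : LocallyLipschitz g)
    (hf : ∃ K, ∃ t ∈ 𝓝 x, LipschitzOnWith K f t) :
    ∃ K, ∃ t ∈ 𝓝 x, LipschitzOnWith K (fun a => g (f a)) t := by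
  obtain ⟨K, t, ht, hK⟩ := hf
  obtain ⟨K', t', ht', hK'⟩ := hg (f x)
  have hc : ContinuousAt f x := hK.continuousOn.continuousAt ht
  exact ⟨K' * K, t ∩ f ⁻¹' t', inter_mem ht (hc ht'),
    hK'.comp (hK.mono inter_subset_left) fun _ ha => ha.2⟩

theorem exists_lipschitzOnWith_prodMk {α β γ : Type*} [PseudoEMetricSpace α]
    [PseudoEMetricSpace β] [PseudoEMetricSpace γ] {g : α → γ} {f : α → β} {x : α}
    (hf : ∃ K, ∃ t ∈ 𝓝 x, LipschitzOnWith K f t) (hg : ∃ K, ∃ t ∈ 𝓝 x, LipschitzOnWith K g t) :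
    ∃ K, ∃ t ∈ 𝓝 x, LipschitzOnWith K (fun a => (f a, g a)) t := by
  obtain ⟨K, t, ht, hK⟩ := hf
  obtain ⟨K', t', ht', hK'⟩ := hg
  exact ⟨max K K', t ∩ t', inter_mem ht ht',
    (hK.mono inter_subset_left).prodMk (hK'.mono inter_subset_right)⟩

section ObserverCorrection

set_option linter.unusedSectionVars false

variable {E G Y : Type*} [NormedAddCommGroup E] [InnerProductSpace ℝ E] [FiniteDimensional ℝ E]
  [NormedAddCommGroup G] [NormedSpace ℝ G] [FiniteDimensional ℝ G]
  [NormedAddCommGroup Y] [NormedSpace ℝ Y] [FiniteDimensional ℝ Y]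

/-- The scalar gain of the observer correction, truncated so that it is defined for all inputs and
vanishes wherever `p ∘ V` does. -/
noncomputable def correctionGain (V W : E → ℝ) (p : ℝ → ℝ) (f : E → G → E) (h : E → Y)
    (L : Y →L[ℝ] E) (z : E) (y : Y) (u : G) : ℝ :=
  max 0 (min (⟪gradient V z, f z u⟫ + W z) 0 + p (V z) * ⟪gradient V z, L (h z - y)⟫)

/-- A locally Lipschitz extension, to all input values, of the observer correction. -/
noncomputable def observerCorrection (V W : E → ℝ) (p : ℝ → ℝ) (f : E → G → E) (h : E → Y)
    (L : Y →L[ℝ] E) (z : E) (y : Y) (u : G) : E :=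
  L (h z - y) -
    (correctionGain V W p f h L z y u / ‖gradient V z‖ ^ 2) • gradient V z

variable {V W : E → ℝ} {p : ℝ → ℝ} {f : E → G → E} {h : E → Y} {L : Y →L[ℝ] E} {R a b : ℝ}
  {U : Set G}

theorem contDiff_gradient {n m : WithTop ℕ∞} (hV : ContDiff ℝ m V) (hnm : n + 1 ≤ m) :
    ContDiff ℝ n (gradient V) :=
  (InnerProductSpace.toDual ℝ E).symm.contDiff.comp (hV.fderiv_right hnm)

theorem correctionGain_eq_zero {z : E} (hp : p (V z) = 0) (y : Y) (u : G) :
    correctionGain V W p f h L z y u = 0 := by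
  simp [correctionGain, hp]

theorem observerCorrection_of_eq_zero {z : E} (hp : p (V z) = 0) (y : Y) (u : G) :
    observerCorrection V W p f h L z y u = L (h z - y) := by
  simp [observerCorrection, correctionGain_eq_zero hp]

theorem observerCorrection_eq {z : E} {y : Y} {u : G} (hA : ⟪gradient V z, f z u⟫ ≤ -W z) :
    observerCorrection V W p f h L z y u = L (h z - y) -
      (max 0 (⟪gradient V z, f z u⟫ + W z + p (V z) * ⟪gradient V z, L (h z - y)⟫) /
        ‖gradient V z‖ ^ 2) • gradient V z := by
  rw [observerCorrection, correctionGain, min_eq_left (by linarith)]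

theorem locallyLipschitz_observerCorrection (hV : ContDiff ℝ 2 V) (hW : ContDiff ℝ 1 W)
    (hp : LocallyLipschitz p) (hf : ContDiff ℝ 1 fun q : E × G => f q.1 q.2)
    (hh : ContDiff ℝ 1 h)
    (hdeg : ∀ z, gradient V z = 0 → ∀ᶠ z' in 𝓝 z, p (V z') = 0) :
    LocallyLipschitz fun q : E × Y × G => observerCorrection V W p f h L q.1 q.2.1 q.2.2 := by
  have hgrad : ContDiff ℝ 1 (gradient V) := contDiff_gradient hV (by norm_num)
  have hgrad' : ContDiff ℝ 1 fun q : E × Y × G => gradient V q.1 := hgrad.comp contDiff_fst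
  have hf' : ContDiff ℝ 1 fun q : E × Y × G => f q.1 q.2.2 :=
    hf.comp (contDiff_fst.prodMk (contDiff_snd.comp contDiff_snd))
  have hh' : ContDiff ℝ 1 fun q : E × Y × G => L (h q.1 - q.2.1) :=
    L.contDiff.comp ((hh.comp contDiff_fst).sub (contDiff_fst.comp contDiff_snd))
  have hV' : ContDiff ℝ 1 fun q : E × Y × G => V q.1 :=
    (hV.of_le (by norm_num)).comp contDiff_fst
  have hW' : ContDiff ℝ 1 fun q : E × Y × G => W q.1 := hW.comp contDiff_fst
  have hadd : LocallyLipschitz fun q : ℝ × ℝ => q.1 + q.2 :=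
    (contDiff_fst.add contDiff_snd).locallyLipschitz (𝕂 := ℝ)
  have hmul : LocallyLipschitz fun q : ℝ × ℝ => q.1 * q.2 :=
    (contDiff_fst.mul contDiff_snd).locallyLipschitz (𝕂 := ℝ)
  have hsub : LocallyLipschitz fun q : E × E => q.1 - q.2 :=
    (contDiff_fst.sub contDiff_snd).locallyLipschitz (𝕂 := ℝ)
  have hsmul : LocallyLipschitz fun q : ℝ × E => q.1 • q.2 :=
    (contDiff_fst.smul contDiff_snd).locallyLipschitz (𝕂 := ℝ)
  have hgain : LocallyLipschitz fun q : E × Y × G =>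
      correctionGain V W p f h L q.1 q.2.1 q.2.2 := by
    have h1 : LocallyLipschitz fun q : E × Y × G =>
        min (⟪gradient V q.1, f q.1 q.2.2⟫ + W q.1) 0 :=
      ((hgrad'.inner ℝ hf').add hW').locallyLipschitz.min_const 0
    have h2 : LocallyLipschitz fun q : E × Y × G =>
        p (V q.1) * ⟪gradient V q.1, L (h q.1 - q.2.1)⟫ :=
      hmul.comp ((hp.comp hV'.locallyLipschitz).prodMk (hgrad'.inner ℝ hh').locallyLipschitz)
    exact (hadd.comp (h1.prodMk h2)).const_max 0
  intro q
  have hlin : ∃ K, ∃ t ∈ 𝓝 q, LipschitzOnWith K (fun q : E × Y × G => L (h q.1 - q.2.1)) t :=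
    hh'.locallyLipschitz q
  by_cases hq : gradient V q.1 = 0
  · obtain ⟨K, t, ht, hK⟩ := hlin
    have hev : ∀ᶠ q' : E × Y × G in 𝓝 q, p (V q'.1) = 0 :=
      (continuous_fst.tendsto q).eventually (hdeg _ hq)
    refine ⟨K, t ∩ {q' | p (V q'.1) = 0}, inter_mem ht hev, ?_⟩
    intro q₁ h₁ q₂ h₂
    simp only [observerCorrection_of_eq_zero h₁.2, observerCorrection_of_eq_zero h₂.2]
    exact hK h₁.1 h₂.1
  · have hN : ContDiffAt ℝ 1 (fun q : E × Y × G =>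
        (‖gradient V q.1‖ ^ 2)⁻¹ • gradient V q.1) q :=
      ((hgrad'.norm_sq ℝ).contDiffAt.inv (by simpa using hq)).smul hgrad'.contDiffAt
    have h2 := hsmul.comp_at (exists_lipschitzOnWith_prodMk (hgain q) hN.exists_lipschitzOnWith)
    have h3 := hsub.comp_at (exists_lipschitzOnWith_prodMk hlin h2)
    refine h3.imp fun K hK => hK.imp fun t ht => ⟨ht.1, ?_⟩
    convert ht.2 using 3 with q'
    rw [observerCorrection, smul_smul, div_eq_mul_inv]

theorem inner_gradient_observerCorrection_le {z : E} {y : Y} {u : G}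
    (hg : gradient V z ≠ 0) (hA : ⟪gradient V z, f z u⟫ ≤ -W z) (hp : p (V z) = 1) :
    ⟪gradient V z, f z u + observerCorrection V W p f h L z y u⟫ ≤ -W z := by
  have hn : ‖gradient V z‖ ^ 2 ≠ 0 := by simpa using hg
  rw [observerCorrection_eq hA, inner_add_right, inner_sub_right, inner_smul_right,
    real_inner_self_eq_norm_sq, div_mul_cancel₀ _ hn, hp, one_mul]
  linarith [le_max_right 0 (⟪gradient V z, f z u⟫ + W z + ⟪gradient V z, L (h z - y)⟫)]

theorem norm_observerCorrection_sub_le {z : E} (hp : p (V z) ∈ Icc (0:ℝ) 1) (y y' : Y) (u : G) :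
    ‖observerCorrection V W p f h L z y u - observerCorrection V W p f h L z y' u‖ ≤
      2 * ‖L‖ * ‖y - y'‖ := by
  set g := gradient V z with hg
  have hL : ‖L (h z - y) - L (h z - y')‖ ≤ ‖L‖ * ‖y - y'‖ := by
    rw [← map_sub, sub_sub_sub_cancel_left, norm_sub_rev y y']
    exact L.le_opNorm _
  have hgain : |correctionGain V W p f h L z y u - correctionGain V W p f h L z y' u| ≤
      ‖g‖ * (‖L‖ * ‖y - y'‖) := by
    have h1 : |correctionGain V W p f h L z y u - correctionGain V W p f h L z y' u| ≤
        |p (V z) * ⟪g, L (h z - y)⟫ - p (V z) * ⟪g, L (h z - y')⟫| := by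
      refine (abs_max_sub_max_le_max _ _ _ _).trans ?_
      simp [hg]
    refine h1.trans ?_
    rw [← mul_sub, ← inner_sub_right, abs_mul, abs_of_nonneg hp.1]
    refine (mul_le_of_le_one_left (abs_nonneg _) hp.2).trans ?_
    exact (abs_real_inner_le_norm _ _).trans (mul_le_mul_of_nonneg_left hL (norm_nonneg _))
  have heq : observerCorrection V W p f h L z y u - observerCorrection V W p f h L z y' u =
      (L (h z - y) - L (h z - y')) -
        ((correctionGain V W p f h L z y u - correctionGain V W p f h L z y' u) / ‖g‖ ^ 2) • g := by
    rw [observerCorrection, observerCorrection, sub_div, sub_smul]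
    abel
  rw [heq]
  refine (norm_sub_le _ _).trans ?_
  have h2 : ‖((correctionGain V W p f h L z y u - correctionGain V W p f h L z y' u) /
      ‖g‖ ^ 2) • g‖ ≤ ‖L‖ * ‖y - y'‖ := by
    rcases eq_or_ne g 0 with h0 | h0
    · rw [h0, smul_zero, norm_zero]; positivity
    · have hpos : 0 < ‖g‖ := norm_pos_iff.2 h0
      rw [norm_smul, norm_div, Real.norm_eq_abs, norm_pow, norm_norm, div_mul_eq_mul_div,
        div_le_iff₀ (by positivity)]
      calc _ ≤ ‖g‖ * (‖L‖ * ‖y - y'‖) * ‖g‖ := mul_le_mul_of_nonneg_right hgain hpos.le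
        _ = _ := by ring
  linarith

/-- With exact output measurement the corrected observer is contracting towards the plant. -/
theorem inner_observerCorrection_le {Q : E →L[ℝ] E} (hQ : ∀ v w : E, ⟪Q v, w⟫ = ⟪v, Q w⟫)
    {c ω : ℝ} (hc : c ∈ Ioo (0:ℝ) 1) (hp01 : ∀ s, p s ∈ Icc (0:ℝ) 1) (hpa : ∀ s, s ≤ a → p s = 0)
    {z x : E} {u : G}
    (hA : a < V z → ⟪gradient V z, f z u⟫ ≤ -W z) (hg : a < V z → gradient V z ≠ 0)
    (hω : 0 ≤ ω)
    (hH3 : ⟪z - x, Q (f z u + L (h z - h x) - f x u)⟫ ≤ -ω * ‖z - x‖ ^ 2)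
    (hH4 : a < V z → ⟪gradient V z, Q (z - x)⟫ < 0 →
      ⟪gradient V z, f z u + L (h z - h x)⟫ ≤ -W z +
        (1 - c) * ‖gradient V z‖ ^ 2 *
          ⟪z - x, Q (f z u + L (h z - h x) - f x u)⟫ / ⟪gradient V z, Q (z - x)⟫) :
    ⟪z - x, Q (f z u + observerCorrection V W p f h L z (h x) u - f x u)⟫ ≤
      -(c * ω) * ‖z - x‖ ^ 2 := by
  set A := ⟪z - x, Q (f z u + L (h z - h x) - f x u)⟫ with hAdef
  have hcω : -ω * ‖z - x‖ ^ 2 ≤ -(c * ω) * ‖z - x‖ ^ 2 := by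
    have : c * ω ≤ ω := mul_le_of_le_one_left hω hc.2.le
    nlinarith [sq_nonneg ‖z - x‖]
  have hA0 : A ≤ 0 := hH3.trans (by nlinarith [sq_nonneg ‖z - x‖])
  rcases le_or_gt (V z) a with hVa | hVa
  · rw [observerCorrection_of_eq_zero (hpa _ hVa)]
    exact hH3.trans hcω
  set g := gradient V z with hgdef
  set B := ⟪g, Q (z - x)⟫ with hB
  set φ := max 0 (⟪g, f z u⟫ + W z + p (V z) * ⟪g, L (h z - h x)⟫) with hφ
  have hn : 0 < ‖g‖ ^ 2 := by have := norm_pos_iff.2 (hg hVa); positivity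
  have heq : ⟪z - x, Q (f z u + observerCorrection V W p f h L z (h x) u - f x u)⟫ =
      A - φ / ‖g‖ ^ 2 * B := by
    rw [observerCorrection_eq (hA hVa)]
    have : f z u + (L (h z - h x) - (φ / ‖g‖ ^ 2) • g) - f x u =
      (f z u + L (h z - h x) - f x u) - (φ / ‖g‖ ^ 2) • g := by abel
    rw [this, map_sub, inner_sub_right, map_smul, inner_smul_right, hB, ← hQ (z - x) g,
      real_inner_comm (Q (z - x)) g]
  rw [heq]
  have hφ0 : 0 ≤ φ := le_max_left _ _
  rcases le_or_gt 0 B with hB0 | hB0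
  · have : 0 ≤ φ / ‖g‖ ^ 2 * B := by positivity
    linarith
  · have h4 := hH4 hVa hB0
    rw [inner_add_right] at h4
    have hAB : 0 ≤ A / B := div_nonneg_of_nonpos hA0 hB0.le
    have hφle : φ ≤ (1 - c) * ‖g‖ ^ 2 * (A / B) := by
      have hr : 0 ≤ (1 - c) * ‖g‖ ^ 2 * (A / B) :=
        mul_nonneg (mul_nonneg (by linarith [hc.2]) hn.le) hAB
      refine max_le hr ?_
      rw [mul_div_assoc] at h4
      have hAz := hA hVa
      rcases le_or_gt 0 ⟪g, L (h z - h x)⟫ with hl | hl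
      · have := mul_le_of_le_one_left hl (hp01 (V z)).2
        linarith
      · have := mul_nonpos_of_nonneg_of_nonpos (hp01 (V z)).1 hl.le
        linarith
    have h5 : φ / ‖g‖ ^ 2 ≤ (1 - c) * (A / B) := by
      rw [div_le_iff₀ hn]; linarith
    have h6 : (1 - c) * (A / B) * B ≤ φ / ‖g‖ ^ 2 * B := mul_le_mul_of_nonpos_right h5 hB0.le
    have h7 : (1 - c) * (A / B) * B = (1 - c) * A := by
      rw [mul_assoc, div_mul_cancel₀ _ hB0.ne]
    have h8 : c * A ≤ c * (-ω * ‖z - x‖ ^ 2) := mul_le_mul_of_nonneg_left hH3 hc.1.le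
    linarith

end ObserverCorrection

theorem LocallyLipschitz.exists_norm_sub_le {X Z : Type*} [NormedAddCommGroup X] [ProperSpace X]
    [NormedAddCommGroup Z] {g : X → Z} (hg : LocallyLipschitz g) (M : ℝ) :
    ∃ K : ℝ, 0 ≤ K ∧ ∀ x y, ‖x‖ ≤ M → ‖y‖ ≤ M → ‖g x - g y‖ ≤ K * ‖x - y‖ := by
  obtain ⟨K, hK⟩ := hg.locallyLipschitzOn.exists_lipschitzOnWith_of_compact
    (isCompact_closedBall (0 : X) M)
  exact ⟨K, K.2, fun x y hx hy => hK.norm_sub_le (by simpa using hx) (by simpa using hy)⟩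

theorem LocallyLipschitz.exists_norm_le {X Z : Type*} [NormedAddCommGroup X] [ProperSpace X]
    [NormedAddCommGroup Z] {g : X → Z} (hg : LocallyLipschitz g) (M : ℝ) :
    ∃ B : ℝ, 0 ≤ B ∧ ∀ x, ‖x‖ ≤ M → ‖g x‖ ≤ B := by
  obtain ⟨B, hB⟩ := (isCompact_closedBall (0 : X) M).exists_bound_of_continuousOn
    hg.continuous.continuousOn
  exact ⟨max B 0, le_max_right _ _, fun x hx => (hB x (by simpa using hx)).trans (le_max_left _ _)⟩

section OpenLoop

set_option linter.unusedSectionVars false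

variable {E G Y : Type*} [NormedAddCommGroup E] [NormedSpace ℝ E] [FiniteDimensional ℝ E]
  [NormedAddCommGroup G] [NormedSpace ℝ G] [FiniteDimensional ℝ G] [MeasurableSpace G]
  [BorelSpace G] [NormedAddCommGroup Y] [NormedSpace ℝ Y] [FiniteDimensional ℝ Y]

/-- A plant `f` with output `h`, an observer correction `κ` and Lyapunov functions certifying that
all trajectories with inputs in the compact set `U` are bounded. -/
structure ObserverSetup (f : E → G → E) (h : E → Y) (κ : E → Y → G → E) (U : Set G) (V W : E → ℝ)
    (R b : ℝ) : Prop where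
  lipschitz_f : LocallyLipschitz fun q : E × G => f q.1 q.2
  f_zero : f 0 0 = 0
  lipschitz_h : LocallyLipschitz h
  h_zero : h 0 = 0
  contDiff_h : ContDiff ℝ 1 h
  lipschitz_hdot : LocallyLipschitz fun q : E × G => fderiv ℝ h q.1 (f q.1 q.2)
  lipschitz_κ : LocallyLipschitz fun q : E × Y × G => κ q.1 q.2.1 q.2.2
  κ_zero : κ 0 0 0 = 0
  isCompact_U : IsCompact U
  zero_mem : 0 ∈ U
  contDiff_V : ContDiff ℝ 1 V
  V_nonneg : ∀ x, 0 ≤ V x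
  V_bounded : ∀ M, Bornology.IsBounded {x | V x ≤ M}
  W_nonneg : ∀ x, 0 ≤ W x
  W_pos : ∀ M, ∃ η : ℝ, 0 < η ∧ ∀ z, R < V z → V z ≤ M → η ≤ W z
  lt : R < b
  decay : ∀ x u, u ∈ U → R ≤ V x → fderiv ℝ V x (f x u) ≤ -W x
  κ_decay : ∀ z y u, u ∈ U → b ≤ V z → fderiv ℝ V z (f z u + κ z y u) ≤ -W z

/-- An admissible control signal. -/
structure IsControl (U : Set G) (u : ℝ → G) : Prop where
  measurable : Measurable u
  mem : ∀ t, u t ∈ U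

/-- `ℓ t` is the last sampling time before `t`, for sampling intervals of length at most `Ts`. -/
structure IsLastSample (Ts : ℝ) (ℓ : ℝ → ℝ) : Prop where
  measurable : Measurable ℓ
  nonneg : ∀ t, 0 ≤ t → 0 ≤ ℓ t
  le : ∀ t, 0 ≤ t → ℓ t ≤ t
  sub_le : ∀ t, 0 ≤ t → t - ℓ t ≤ Ts

/-- The output of the inter-sample predictor. -/
noncomputable def predictedOutput (f : E → G → E) (h : E → Y) (r τ : ℝ) (ℓ : ℝ → ℝ) (x z : ℝ → E)
    (u : ℝ → G) (t : ℝ) : Y :=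
  h (x (ℓ t - r)) + ∫ s in (ℓ t)..t, fderiv ℝ h (z s) (f (z s) (u (s - r - τ)))

/-- Plant and observer trajectories for a prescribed control signal. -/
structure IsOpenLoopSol (f : E → G → E) (h : E → Y) (κ : E → Y → G → E) (r τ : ℝ) (ℓ : ℝ → ℝ)
    (x z : ℝ → E) (u : ℝ → G) : Prop where
  continuous_x : Continuous x
  continuous_z : Continuous z
  x_eq : ∀ t, 0 ≤ t → x t = x 0 + ∫ s in (0:ℝ)..t, f (x s) (u (s - τ))
  z_eq : ∀ t, 0 ≤ t → z t = z 0 + ∫ s in (0:ℝ)..t,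
    (f (z s) (u (s - r - τ)) + κ (z s) (predictedOutput f h r τ ℓ x z u s) (u (s - r - τ)))

variable {f : E → G → E} {h : E → Y} {κ : E → Y → G → E} {U : Set G} {V W : E → ℝ} {R b : ℝ}
  {r τ Ts T : ℝ} {ℓ : ℝ → ℝ} {x z x' z' : ℝ → E} {u u' : ℝ → G}

theorem IsCompact.exists_norm_le (hU : IsCompact U) : ∃ B : ℝ, 0 ≤ B ∧ ∀ u ∈ U, ‖u‖ ≤ B := by
  obtain ⟨B, hB⟩ := hU.exists_bound_of_continuousOn (f := id) continuousOn_id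
  exact ⟨max B 0, le_max_right _ _, fun x hx => (hB x hx).trans (le_max_left _ _)⟩

/-- A locally Lipschitz function is Lipschitz on bounded sets of states, uniformly over
compact sets of inputs. -/
theorem LocallyLipschitz.exists_uniform {Z : Type*} [NormedAddCommGroup Z] {g : E × G → Z}
    (hg : LocallyLipschitz g) (hU : IsCompact U) (M : ℝ) :
    ∃ K : ℝ, 0 ≤ K ∧ (∀ x y u v, ‖x‖ ≤ M → ‖y‖ ≤ M → u ∈ U → v ∈ U →
      ‖g (x, u) - g (y, v)‖ ≤ K * (‖x - y‖ + ‖u - v‖)) ∧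
      ∀ x u, ‖x‖ ≤ M → u ∈ U → ‖g (x, u)‖ ≤ K := by
  obtain ⟨B, hB0, hB⟩ := hU.exists_norm_le
  obtain ⟨K, hK0, hK⟩ := hg.exists_norm_sub_le (max M B)
  obtain ⟨K', hK0', hK'⟩ := hg.exists_norm_le (max M B)
  have hmem : ∀ (x : E) (u : G), ‖x‖ ≤ M → u ∈ U → ‖(x, u)‖ ≤ max M B := fun x u hx hu =>
    (Prod.norm_mk x u).trans_le (max_le_max hx (hB u hu))
  refine ⟨max K K', le_max_of_le_left hK0, fun x y u v hx hy hu hv => ?_, fun x u hx hu => ?_⟩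
  · refine (hK _ _ (hmem x u hx hu) (hmem y v hy hv)).trans
      (mul_le_mul (le_max_left _ _) ?_ (norm_nonneg _) (le_max_of_le_left hK0))
    exact max_le_add_of_nonneg (norm_nonneg _) (norm_nonneg _)
  · exact (hK' _ (hmem x u hx hu)).trans (le_max_right _ _)

theorem IsControl.intervalIntegrable {Z : Type*} [NormedAddCommGroup Z] {g : E × G → Z}
    (hu : IsControl U u) (hU : IsCompact U) (hg : LocallyLipschitz g) (hz : Continuous z) (c a b : ℝ) :
    IntervalIntegrable (fun s => g (z s, u (s - c))) volume a b := by
  obtain ⟨M, hM⟩ := (isCompact_uIcc (a := a) (b := b)).exists_bound_of_continuousOn hz.continuousOn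
  obtain ⟨K, -, -, hK⟩ := hg.exists_uniform (E := E) hU M
  have hmeas : StronglyMeasurable fun s => g (z s, u (s - c)) :=
    hg.continuous.comp_stronglyMeasurable (hz.stronglyMeasurable.prodMk
      (hu.measurable.comp (measurable_id.sub_const c)).stronglyMeasurable)
  rw [intervalIntegrable_iff]
  refine IntegrableOn.of_bound (by simp) hmeas.aestronglyMeasurable K ?_
  filter_upwards [ae_restrict_mem measurableSet_uIoc] with s hs
  exact hK _ _ (hM s (uIoc_subset_uIcc hs)) (hu.mem _)

theorem exists_bound_Icc (hx : Continuous x) (a T : ℝ) :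
    ∃ M : ℝ, 0 ≤ M ∧ ∀ s ∈ Icc a T, ‖x s‖ ≤ M := by
  obtain ⟨M, hM⟩ := isCompact_Icc.exists_bound_of_continuousOn (hx.continuousOn (s := Icc a T))
  exact ⟨max M 0, le_max_right _ _, fun s hs => (hM s hs).trans (le_max_left _ _)⟩

namespace ObserverSetup

variable (H : ObserverSetup f h κ U V W R b)
include H

theorem hdot_intervalIntegrable (hu : IsControl U u) (hz : Continuous z) (a b : ℝ) :
    IntervalIntegrable (fun s => fderiv ℝ h (z s) (f (z s) (u (s - r - τ)))) volume a b := by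
  simpa only [sub_sub] using hu.intervalIntegrable H.isCompact_U H.lipschitz_hdot hz (r + τ) a b

theorem stronglyMeasurable_predictedOutput (hℓ : Measurable ℓ) (hu : IsControl U u)
    (hx : Continuous x) (hz : Continuous z) :
    StronglyMeasurable (predictedOutput f h r τ ℓ x z u) := by
  have hInt := H.hdot_intervalIntegrable (r := r) (τ := τ) hu hz
  have hI : Continuous fun t => ∫ s in (0:ℝ)..t, fderiv ℝ h (z s) (f (z s) (u (s - r - τ))) :=
    intervalIntegral.continuous_primitive hInt 0
  have h1 : StronglyMeasurable fun t => h (x (ℓ t - r)) :=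
    (H.contDiff_h.continuous.comp hx).stronglyMeasurable.comp_measurable (hℓ.sub_const r)
  have h2 : predictedOutput f h r τ ℓ x z u = (fun t => h (x (ℓ t - r))) +
      ((fun t => ∫ s in (0:ℝ)..t, fderiv ℝ h (z s) (f (z s) (u (s - r - τ)))) -
        (fun t => ∫ s in (0:ℝ)..t, fderiv ℝ h (z s) (f (z s) (u (s - r - τ)))) ∘ ℓ) := by
    funext t
    simp only [predictedOutput, Pi.add_apply, Pi.sub_apply, Function.comp_apply]
    rw [intervalIntegral.integral_interval_sub_left (hInt _ _) (hInt _ _)]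
  rw [h2]
  exact h1.add (hI.stronglyMeasurable.sub (hI.stronglyMeasurable.comp_measurable hℓ))

theorem exists_predictedOutput_bound (hℓ : IsLastSample Ts ℓ) (hr : 0 ≤ r) (M : ℝ) :
    ∃ B : ℝ, ∀ (x z : ℝ → E) (u : ℝ → G) (T : ℝ), IsControl U u → (∀ s ∈ Icc (-r) T, ‖x s‖ ≤ M) →
      (∀ s ∈ Icc 0 T, ‖z s‖ ≤ M) → ∀ t ∈ Icc 0 T, ‖predictedOutput f h r τ ℓ x z u t‖ ≤ B := by
  obtain ⟨B₁, hB₁, hb₁⟩ := H.lipschitz_h.exists_norm_le M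
  obtain ⟨B₂, hB₂, -, hb₂⟩ := H.lipschitz_hdot.exists_uniform H.isCompact_U M
  refine ⟨B₁ + B₂ * Ts, fun x z u T hu hx hz t ht => ?_⟩
  have h0 := hℓ.nonneg t ht.1
  have h1 := hℓ.le t ht.1
  refine (norm_add_le _ _).trans (add_le_add (hb₁ _ (hx _ ⟨by linarith, by linarith [ht.2]⟩)) ?_)
  refine (intervalIntegral.norm_integral_le_of_norm_le_const (C := B₂) fun s hs => ?_).trans ?_
  · rw [uIoc_of_le h1] at hs
    exact hb₂ _ _ (hz s ⟨h0.trans hs.1.le, hs.2.trans ht.2⟩) (hu.mem _)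
  · rw [abs_of_nonneg (by linarith)]
    exact mul_le_mul_of_nonneg_left (hℓ.sub_le t ht.1) hB₂

theorem isPrimitiveOn_x (hu : IsControl U u) (hs : IsOpenLoopSol f h κ r τ ℓ x z u) (hT : 0 ≤ T) :
    IsPrimitiveOn x (fun s => f (x s) (u (s - τ))) 0 T := by
  obtain ⟨M, -, hM⟩ := exists_bound_Icc hs.continuous_x 0 T
  obtain ⟨B, -, -, hB⟩ := H.lipschitz_f.exists_uniform H.isCompact_U M
  exact ⟨hT, hu.intervalIntegrable H.isCompact_U H.lipschitz_f hs.continuous_x τ 0 T,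
    ⟨B, fun s hs => hB _ _ (hM s hs) (hu.mem _)⟩, fun t ht => hs.x_eq t ht.1⟩

theorem isPrimitiveOn_z (hr : 0 ≤ r) (hℓ : IsLastSample Ts ℓ) (hu : IsControl U u)
    (hs : IsOpenLoopSol f h κ r τ ℓ x z u) (hT : 0 ≤ T) :
    IsPrimitiveOn z (fun s => f (z s) (u (s - r - τ)) +
      κ (z s) (predictedOutput f h r τ ℓ x z u s) (u (s - r - τ))) 0 T := by
  obtain ⟨M, -, hM⟩ := exists_bound_Icc hs.continuous_x (-r) T
  obtain ⟨M', -, hM'⟩ := exists_bound_Icc hs.continuous_z 0 T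
  obtain ⟨B, -, -, hB⟩ := H.lipschitz_f.exists_uniform H.isCompact_U M'
  obtain ⟨Bu, -, hBu⟩ := H.isCompact_U.exists_norm_le
  obtain ⟨Bw, hBw⟩ := H.exists_predictedOutput_bound (τ := τ) hℓ hr (max M M')
  replace hBw := hBw x z u T hu (fun s hs => (hM s hs).trans (le_max_left _ _))
    (fun s hs => (hM' s hs).trans (le_max_right _ _))
  obtain ⟨Bκ, -, hBκ⟩ := H.lipschitz_κ.exists_norm_le (max M' (max Bw Bu))
  have hbd : ∀ s ∈ Icc 0 T, ‖f (z s) (u (s - r - τ)) +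
      κ (z s) (predictedOutput f h r τ ℓ x z u s) (u (s - r - τ))‖ ≤ B + Bκ := fun s hs =>
    (norm_add_le _ _).trans (add_le_add (hB _ _ (hM' s hs) (hu.mem _))
      (hBκ (_, _, _) (max_le_max (hM' s hs) (max_le_max (hBw s hs) (hBu _ (hu.mem _))))))
  refine ⟨hT, ?_, ⟨_, hbd⟩, fun t ht => hs.z_eq t ht.1⟩
  have hum : StronglyMeasurable fun s => u (s - r - τ) :=
    (hu.measurable.comp ((measurable_id.sub_const r).sub_const τ)).stronglyMeasurable
  have hzm := hs.continuous_z.stronglyMeasurable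
  have hmeas : StronglyMeasurable fun s => f (z s) (u (s - r - τ)) +
      κ (z s) (predictedOutput f h r τ ℓ x z u s) (u (s - r - τ)) :=
    (H.lipschitz_f.continuous.comp_stronglyMeasurable (hzm.prodMk hum)).add
      (H.lipschitz_κ.continuous.comp_stronglyMeasurable (hzm.prodMk
        ((H.stronglyMeasurable_predictedOutput hℓ.measurable hu hs.continuous_x
          hs.continuous_z).prodMk hum)))
  rw [intervalIntegrable_iff, uIoc_of_le hT]
  refine IntegrableOn.of_bound (by simp) hmeas.aestronglyMeasurable (B + Bκ) ?_
  filter_upwards [ae_restrict_mem measurableSet_Ioc] with s hs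
  exact hbd s (Ioc_subset_Icc_self hs)

/-- Sublevel sets of `V` at levels where it decreases along a curve are invariant. -/
theorem V_le {y g : ℝ → E} {c : ℝ} (hy : IsPrimitiveOn y g 0 T)
    (hg : ∀ s ∈ Icc 0 T, c ≤ V (y s) → fderiv ℝ V (y s) (g s) ≤ 0) {t : ℝ} (ht : t ∈ Icc 0 T) :
    V (y t) ≤ max (V (y 0)) c :=
  (hy.comp_contDiff H.contDiff_V).le_of_barrier (le_max_left _ _)
    (fun s hs hc => hg s hs ((le_max_right _ _).trans hc)) ht

theorem V_x_le (hu : IsControl U u) (hs : IsOpenLoopSol f h κ r τ ℓ x z u) {t : ℝ} (ht : 0 ≤ t) :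
    V (x t) ≤ max (V (x 0)) R :=
  H.V_le (H.isPrimitiveOn_x hu hs ht) (fun _ _ hR =>
    (H.decay _ _ (hu.mem _) hR).trans (neg_nonpos.2 (H.W_nonneg _))) ⟨ht, le_rfl⟩

theorem V_z_le (hr : 0 ≤ r) (hℓ : IsLastSample Ts ℓ) (hu : IsControl U u)
    (hs : IsOpenLoopSol f h κ r τ ℓ x z u) {t : ℝ} (ht : 0 ≤ t) :
    V (z t) ≤ max (V (z 0)) b :=
  H.V_le (H.isPrimitiveOn_z hr hℓ hu hs ht) (fun _ _ hR =>
    (H.κ_decay _ _ _ (hu.mem _) hR).trans (neg_nonpos.2 (H.W_nonneg _))) ⟨ht, le_rfl⟩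

end ObserverSetup

end OpenLoop

section Cutoff

variable {E F : Type*} [NormedAddCommGroup E] [NormedAddCommGroup F] [NormedSpace ℝ F]

/-- A Lipschitz cutoff function, equal to one on the ball of radius `M` and vanishing outside the
ball of radius `M + 1`. -/
noncomputable def cutoff (M : ℝ) (ξ : E) : ℝ := max 0 (min 1 (M + 1 - ‖ξ‖))

variable {M : ℝ} {ξ η : E}

theorem cutoff_nonneg : 0 ≤ cutoff M ξ := le_max_left _ _

theorem cutoff_le_one : cutoff M ξ ≤ 1 := max_le zero_le_one (min_le_left _ _)

theorem cutoff_eq_one (h : ‖ξ‖ ≤ M) : cutoff M ξ = 1 := by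
  rw [cutoff, min_eq_left (by linarith), max_eq_right zero_le_one]

theorem cutoff_eq_zero (h : M + 1 ≤ ‖ξ‖) : cutoff M ξ = 0 :=
  max_eq_left ((min_le_right _ _).trans (by linarith))

theorem continuous_cutoff : Continuous (cutoff M : E → ℝ) := by
  unfold cutoff; fun_prop

theorem abs_cutoff_sub_le : |cutoff M ξ - cutoff M η| ≤ ‖ξ - η‖ := by
  have h1 := abs_max_sub_max_le_max 0 (min 1 (M + 1 - ‖ξ‖)) 0 (min 1 (M + 1 - ‖η‖))
  have h2 := abs_min_sub_min_le_max 1 (M + 1 - ‖ξ‖) 1 (M + 1 - ‖η‖)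
  simp only [sub_self, abs_zero, sub_sub_sub_cancel_left] at h1 h2
  refine (h1.trans_eq (max_eq_right (abs_nonneg _))).trans
    ((h2.trans_eq (max_eq_right (abs_nonneg _))).trans ?_)
  rw [norm_sub_rev]
  exact abs_norm_sub_norm_le _ _

theorem norm_cutoff_smul_le {v : F} {B : ℝ} (hB : 0 ≤ B) (hv : ‖ξ‖ ≤ M + 1 → ‖v‖ ≤ B) :
    ‖cutoff M ξ • v‖ ≤ B := by
  rcases le_total ‖ξ‖ (M + 1) with h | h
  · rw [norm_smul, Real.norm_of_nonneg cutoff_nonneg]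
    exact (mul_le_of_le_one_left (norm_nonneg _) cutoff_le_one).trans (hv h)
  · rw [cutoff_eq_zero h, zero_smul, norm_zero]; exact hB

theorem norm_cutoff_smul_sub_le {v w : F} {B K D : ℝ} (hB : 0 ≤ B) (hK : 0 ≤ K)
    (hv : ‖ξ‖ ≤ M + 1 → ‖v‖ ≤ B) (hw : ‖η‖ ≤ M + 1 → ‖w‖ ≤ B) (hD : ‖ξ - η‖ ≤ D)
    (hvw : ‖ξ‖ ≤ M + 1 → ‖η‖ ≤ M + 1 → ‖v - w‖ ≤ K * D) :
    ‖cutoff M ξ • v - cutoff M η • w‖ ≤ (B + K) * D := by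
  have hD0 : 0 ≤ D := (norm_nonneg _).trans hD
  have hc : |cutoff M ξ - cutoff M η| ≤ D := abs_cutoff_sub_le.trans hD
  have hKD : 0 ≤ K * D := mul_nonneg hK hD0
  rcases le_total ‖ξ‖ (M + 1) with h | h
  · rcases le_total ‖η‖ (M + 1) with h' | h'
    · have : cutoff M ξ • v - cutoff M η • w =
        (cutoff M ξ - cutoff M η) • v + cutoff M η • (v - w) := by
        rw [sub_smul, smul_sub]; abel
      rw [this]
      refine (norm_add_le _ _).trans ?_
      rw [norm_smul, norm_smul, Real.norm_of_nonneg (cutoff_nonneg (ξ := η)), Real.norm_eq_abs]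
      have h1 : |cutoff M ξ - cutoff M η| * ‖v‖ ≤ D * B :=
        mul_le_mul hc (hv h) (norm_nonneg _) hD0
      have h2 : cutoff M η * ‖v - w‖ ≤ K * D :=
        (mul_le_of_le_one_left (norm_nonneg _) cutoff_le_one).trans (hvw h h')
      linarith
    · rw [cutoff_eq_zero h'] at hc ⊢
      rw [zero_smul, sub_zero, norm_smul, Real.norm_eq_abs]
      rw [sub_zero] at hc
      have h1 : |cutoff M ξ| * ‖v‖ ≤ D * B := mul_le_mul hc (hv h) (norm_nonneg _) hD0
      linarith
  · rw [cutoff_eq_zero h] at hc ⊢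
    rcases le_total ‖η‖ (M + 1) with h' | h'
    · rw [zero_smul, zero_sub, norm_neg, norm_smul, Real.norm_eq_abs]
      rw [zero_sub, abs_neg] at hc
      have h1 : |cutoff M η| * ‖w‖ ≤ D * B := mul_le_mul hc (hw h') (norm_nonneg _) hD0
      linarith
    · rw [cutoff_eq_zero h', zero_smul, zero_smul, sub_zero, norm_zero]
      positivity

end Cutoff

section OpenLoop

set_option linter.unusedSectionVars false

variable {E G Y : Type*} [NormedAddCommGroup E] [NormedSpace ℝ E] [FiniteDimensional ℝ E]
  [NormedAddCommGroup G] [NormedSpace ℝ G] [FiniteDimensional ℝ G] [MeasurableSpace G]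
  [BorelSpace G] [NormedAddCommGroup Y] [NormedSpace ℝ Y] [FiniteDimensional ℝ Y]
  {f : E → G → E} {h : E → Y} {κ : E → Y → G → E} {U : Set G} {V W : E → ℝ} {R b : ℝ}
  {r τ Ts T : ℝ} {ℓ : ℝ → ℝ} {x z x' z' : ℝ → E} {u u' : ℝ → G}

/-- Global solutions of causal equations for which a sublevel set of `V` is invariant. -/
theorem exists_solution_of_invariant (hV : ContDiff ℝ 1 V) {Φ : (ℝ → E) → ℝ → E} {M B K c : ℝ}
    {ξ₀ : E} (hB : 0 ≤ B) (hK : 0 ≤ K) (hM : ∀ y, V y ≤ max (V ξ₀) c → ‖y‖ ≤ M)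
    (hmeas : ∀ ξ, Continuous ξ → StronglyMeasurable (Φ ξ))
    (hbound : ∀ ξ, Continuous ξ → ∀ s, 0 ≤ s → ‖ξ s‖ ≤ M + 1 → ‖Φ ξ s‖ ≤ B)
    (hlip : ∀ ξ η, Continuous ξ → Continuous η → ∀ s, 0 ≤ s → ∀ D : ℝ, 0 ≤ D →
      (∀ s' ∈ Icc 0 s, ‖ξ s' - η s'‖ ≤ D) → ‖ξ s‖ ≤ M + 1 → ‖η s‖ ≤ M + 1 →
      ‖Φ ξ s - Φ η s‖ ≤ K * D)
    (hdecay : ∀ ξ s, 0 ≤ s → c ≤ V (ξ s) → fderiv ℝ V (ξ s) (Φ ξ s) ≤ 0) :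
    ∃ ξ : ℝ → E, Continuous ξ ∧ ξ 0 = ξ₀ ∧
      ∀ t, 0 ≤ t → ‖ξ t‖ ≤ M ∧ ξ t = ξ₀ + ∫ s in (0:ℝ)..t, Φ ξ s := by
  set F : (ℝ → E) → ℝ → E := fun ξ => (Ici 0).indicator fun s => cutoff M (ξ s) • Φ ξ s with hF
  have hFs : ∀ ξ s, 0 ≤ s → F ξ s = cutoff M (ξ s) • Φ ξ s := fun ξ s hs =>
    indicator_of_mem (mem_Ici.2 hs) _
  have hFmeas : ∀ ξ, Continuous ξ → AEStronglyMeasurable (F ξ) volume := fun ξ hξ =>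
    (((continuous_cutoff.comp hξ).stronglyMeasurable.smul (hmeas ξ hξ)).indicator
      measurableSet_Ici).aestronglyMeasurable
  have hFb : ∀ ξ, Continuous ξ → ∀ s, ‖F ξ s‖ ≤ B := by
    intro ξ hξ s
    rcases le_or_gt 0 s with hs | hs
    · rw [hFs ξ s hs]
      exact norm_cutoff_smul_le hB fun h => hbound ξ hξ s hs h
    · rw [hF]
      simp only
      rw [indicator_of_notMem (by simpa using hs), norm_zero]; exact hB
  obtain ⟨ξ, hξ, hξ0, hsol⟩ := exists_solution_of_causal_lipschitz F (K := B + K) (B := B) ξ₀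
    hFmeas hFb (fun ξ η hξ hη s hs D hD hd => by
      rw [hFs ξ s hs, hFs η s hs]
      exact norm_cutoff_smul_sub_le hB hK (fun h => hbound ξ hξ s hs h)
        (fun h => hbound η hη s hs h) (hd s ⟨hs, le_rfl⟩)
        (fun h h' => hlip ξ η hξ hη s hs D hD hd h h'))
  have hprim : ∀ t, 0 ≤ t → IsPrimitiveOn ξ (F ξ) 0 t := by
    intro t ht
    refine ⟨ht, ?_, ⟨B, fun s _ => hFb ξ hξ s⟩, fun s hs => by rw [hξ0]; exact hsol s hs.1⟩
    rw [intervalIntegrable_iff]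
    exact IntegrableOn.of_bound (by simp) (hFmeas ξ hξ).restrict B (ae_of_all _ (hFb ξ hξ))
  have hbd : ∀ t, 0 ≤ t → ‖ξ t‖ ≤ M := by
    intro t ht
    refine hM _ ?_
    rw [← hξ0]
    refine ((hprim t ht).comp_contDiff hV).le_of_barrier (le_max_left _ _) (fun s hs hc => ?_)
      ⟨ht, le_rfl⟩
    rw [hFs ξ s hs.1, map_smul, smul_eq_mul]
    exact mul_nonpos_of_nonneg_of_nonpos cutoff_nonneg
      (hdecay ξ s hs.1 ((le_max_right _ _).trans hc))
  refine ⟨ξ, hξ, hξ0, fun t ht => ⟨hbd t ht, ?_⟩⟩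
  rw [hsol t ht]
  congr 1
  refine intervalIntegral.integral_congr fun s hs => ?_
  rw [uIcc_of_le ht] at hs
  rw [hFs ξ s hs.1, cutoff_eq_one (hbd s hs.1), one_smul]

namespace ObserverSetup

variable (H : ObserverSetup f h κ U V W R b)
include H

theorem exists_plant_solution (hu : IsControl U u) (ξ₀ : E) :
    ∃ ξ : ℝ → E, Continuous ξ ∧ ξ 0 = ξ₀ ∧ ∃ M, ∀ t, 0 ≤ t → ‖ξ t‖ ≤ M ∧
      ξ t = ξ₀ + ∫ s in (0:ℝ)..t, f (ξ s) (u (s - τ)) := by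
  obtain ⟨M, hM⟩ := (H.V_bounded (max (V ξ₀) R)).exists_norm_le
  obtain ⟨K, hK0, hK, hB⟩ := H.lipschitz_f.exists_uniform H.isCompact_U (M + 1)
  have hum : StronglyMeasurable fun s => u (s - τ) :=
    (hu.measurable.comp (measurable_id.sub_const τ)).stronglyMeasurable
  obtain ⟨ξ, hξ, hξ0, hsol⟩ := exists_solution_of_invariant H.contDiff_V
    (Φ := fun ξ s => f (ξ s) (u (s - τ))) (c := R) hK0 hK0 hM
    (fun ξ hξ => H.lipschitz_f.continuous.comp_stronglyMeasurable
      (hξ.stronglyMeasurable.prodMk hum))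
    (fun ξ _ s _ hs => hB _ _ hs (hu.mem _))
    (fun ξ η _ _ s hs D _ hd h1 h2 => (hK _ _ _ _ h1 h2 (hu.mem _) (hu.mem _)).trans
      (mul_le_mul_of_nonneg_left (by simpa using hd s ⟨hs, le_rfl⟩) hK0))
    (fun ξ s _ hc => (H.decay _ _ (hu.mem _) hc).trans (neg_nonpos.2 (H.W_nonneg _)))
  exact ⟨ξ, hξ, hξ0, M, hsol⟩

theorem exists_observer_solution (hTs : 0 ≤ Ts) (hℓ : IsLastSample Ts ℓ)
    (hu : IsControl U u) (hx : Continuous x) {Mx : ℝ} (hMx : ∀ t, -r ≤ t → ‖x t‖ ≤ Mx) (ζ₀ : E) :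
    ∃ ζ : ℝ → E, Continuous ζ ∧ ζ 0 = ζ₀ ∧ ∀ t, 0 ≤ t → ζ t = ζ₀ + ∫ s in (0:ℝ)..t,
      (f (ζ s) (u (s - r - τ)) + κ (ζ s) (predictedOutput f h r τ ℓ x ζ u s) (u (s - r - τ))) := by
  obtain ⟨M, hM⟩ := (H.V_bounded (max (V ζ₀) b)).exists_norm_le
  obtain ⟨K₁, hK₁, hK₁', hB₁⟩ := H.lipschitz_f.exists_uniform H.isCompact_U (M + 1)
  obtain ⟨K₂, hK₂, hK₂', hB₂⟩ := H.lipschitz_hdot.exists_uniform H.isCompact_U (M + 1)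
  obtain ⟨B₃, hB₃0, hB₃⟩ := H.lipschitz_h.exists_norm_le Mx
  obtain ⟨Bu, -, hBu⟩ := H.isCompact_U.exists_norm_le
  set Mw : ℝ := max (M + 1) (max (B₃ + K₂ * Ts) Bu)
  obtain ⟨K₄, hK₄0, hK₄⟩ := H.lipschitz_κ.exists_norm_sub_le Mw
  obtain ⟨B₄, hB₄0, hB₄⟩ := H.lipschitz_κ.exists_norm_le Mw
  have hum : StronglyMeasurable fun s => u (s - r - τ) :=
    (hu.measurable.comp ((measurable_id.sub_const r).sub_const τ)).stronglyMeasurable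
  let q : (ℝ → E) → ℝ → Y := fun ξ s =>
    cutoff M (ξ s) • fderiv ℝ h (ξ s) (f (ξ s) (u (s - r - τ)))
  let w : (ℝ → E) → ℝ → Y := fun ξ t => h (x (ℓ t - r)) + ∫ s in (ℓ t)..t, q ξ s
  have hqb : ∀ ξ s, ‖q ξ s‖ ≤ K₂ := fun ξ s =>
    norm_cutoff_smul_le hK₂ fun hs => hB₂ _ _ hs (hu.mem _)
  have hqm : ∀ ξ, Continuous ξ → StronglyMeasurable (q ξ) := fun ξ hξ =>
    (continuous_cutoff.comp hξ).stronglyMeasurable.smul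
      (H.lipschitz_hdot.continuous.comp_stronglyMeasurable (hξ.stronglyMeasurable.prodMk hum))
  have hqi : ∀ ξ, Continuous ξ → ∀ a b, IntervalIntegrable (q ξ) volume a b := by
    intro ξ hξ a b
    rw [intervalIntegrable_iff]
    exact IntegrableOn.of_bound (by simp) (hqm ξ hξ).aestronglyMeasurable K₂
      (ae_of_all _ (hqb ξ))
  have hwm : ∀ ξ, Continuous ξ → StronglyMeasurable (w ξ) := by
    intro ξ hξ
    have hI : Continuous fun t => ∫ s in (0:ℝ)..t, q ξ s :=
      intervalIntegral.continuous_primitive (hqi ξ hξ) 0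
    have h1 : StronglyMeasurable fun t => h (x (ℓ t - r)) :=
      (H.contDiff_h.continuous.comp hx).stronglyMeasurable.comp_measurable
        (hℓ.measurable.sub_const r)
    have h2 : w ξ = (fun t => h (x (ℓ t - r))) + ((fun t => ∫ s in (0:ℝ)..t, q ξ s) -
        (fun t => ∫ s in (0:ℝ)..t, q ξ s) ∘ ℓ) := by
      funext t
      simp only [w, Pi.add_apply, Pi.sub_apply, Function.comp_apply]
      rw [intervalIntegral.integral_interval_sub_left (hqi ξ hξ _ _) (hqi ξ hξ _ _)]
    rw [h2]
    exact h1.add (hI.stronglyMeasurable.sub (hI.stronglyMeasurable.comp_measurable hℓ.measurable))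
  have hwb : ∀ ξ s, 0 ≤ s → ‖w ξ s‖ ≤ B₃ + K₂ * Ts := by
    intro ξ s hs
    refine (norm_add_le _ _).trans (add_le_add
      (hB₃ _ (hMx _ (by linarith [hℓ.nonneg s hs]))) ?_)
    refine (intervalIntegral.norm_integral_le_of_norm_le_const (C := K₂)
      fun s hs => hqb ξ s).trans ?_
    rw [abs_of_nonneg (by linarith [hℓ.le s hs])]
    exact mul_le_mul_of_nonneg_left (hℓ.sub_le s hs) hK₂
  have hwd : ∀ ξ η, Continuous ξ → Continuous η → ∀ s, 0 ≤ s → ∀ D : ℝ, 0 ≤ D →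
      (∀ s' ∈ Icc 0 s, ‖ξ s' - η s'‖ ≤ D) → ‖w ξ s - w η s‖ ≤ (K₂ + K₂) * D * Ts := by
    intro ξ η hξ hη s hs D hD hd
    simp only [w]
    rw [add_sub_add_left_eq_sub, ← intervalIntegral.integral_sub (hqi ξ hξ _ _) (hqi η hη _ _)]
    refine (intervalIntegral.norm_integral_le_of_norm_le_const (C := (K₂ + K₂) * D)
      fun s' hs' => ?_).trans ?_
    · rw [uIoc_of_le (hℓ.le s hs)] at hs'
      have hd' := hd s' ⟨(hℓ.nonneg s hs).trans hs'.1.le, hs'.2⟩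
      refine norm_cutoff_smul_sub_le hK₂ hK₂ (fun hs => hB₂ _ _ hs (hu.mem _))
        (fun hs => hB₂ _ _ hs (hu.mem _)) hd' fun h1 h2 => ?_
      exact (hK₂' _ _ _ _ h1 h2 (hu.mem _) (hu.mem _)).trans
        (mul_le_mul_of_nonneg_left (by simpa using hd') hK₂)
    · rw [abs_of_nonneg (by linarith [hℓ.le s hs])]
      exact mul_le_mul_of_nonneg_left (hℓ.sub_le s hs) (by positivity)
  have hmem : ∀ ξ : ℝ → E, ∀ s, 0 ≤ s → ‖ξ s‖ ≤ M + 1 → ‖(ξ s, w ξ s, u (s - r - τ))‖ ≤ Mw :=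
    fun ξ s hs hξs => max_le_max hξs (max_le_max (hwb ξ s hs) (hBu _ (hu.mem _)))
  have hlip : ∀ ξ η, Continuous ξ → Continuous η → ∀ s, 0 ≤ s → ∀ D : ℝ, 0 ≤ D →
      (∀ s' ∈ Icc 0 s, ‖ξ s' - η s'‖ ≤ D) → ‖ξ s‖ ≤ M + 1 → ‖η s‖ ≤ M + 1 →
      ‖(f (ξ s) (u (s - r - τ)) + κ (ξ s) (w ξ s) (u (s - r - τ))) -
        (f (η s) (u (s - r - τ)) + κ (η s) (w η s) (u (s - r - τ)))‖ ≤
        (K₁ + K₄ * (1 + (K₂ + K₂) * Ts)) * D := by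
    intro ξ η hξ hη s hs D hD hd h1 h2
    have hd0 := hd s ⟨hs, le_rfl⟩
    rw [add_sub_add_comm, add_mul]
    refine (norm_add_le _ _).trans (add_le_add ?_ ?_)
    · exact (hK₁' _ _ _ _ h1 h2 (hu.mem _) (hu.mem _)).trans
        (mul_le_mul_of_nonneg_left (by simpa using hd0) hK₁)
    · refine (hK₄ _ _ (hmem ξ s hs h1) (hmem η s hs h2)).trans ?_
      rw [mul_assoc]
      refine mul_le_mul_of_nonneg_left ?_ hK₄0
      have hwd' := hwd ξ η hξ hη s hs D hD hd
      have h3 : 0 ≤ (K₂ + K₂) * D * Ts := by positivity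
      rw [Prod.mk_sub_mk, Prod.mk_sub_mk, sub_self, Prod.norm_mk, Prod.norm_mk, norm_zero]
      exact max_le (by nlinarith) (max_le (by nlinarith) (by nlinarith))
  obtain ⟨ζ, hζ, hζ0, hsol⟩ := exists_solution_of_invariant H.contDiff_V
    (Φ := fun ξ s => f (ξ s) (u (s - r - τ)) + κ (ξ s) (w ξ s) (u (s - r - τ))) (c := b)
    (B := K₁ + B₄) (K := K₁ + K₄ * (1 + (K₂ + K₂) * Ts)) (by positivity) (by positivity) hM
    (fun ξ hξ => (H.lipschitz_f.continuous.comp_stronglyMeasurable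
      (hξ.stronglyMeasurable.prodMk hum)).add
      (H.lipschitz_κ.continuous.comp_stronglyMeasurable (hξ.stronglyMeasurable.prodMk
        ((hwm ξ hξ).prodMk hum))))
    (fun ξ _ s hs hξs => (norm_add_le _ _).trans (add_le_add (hB₁ _ _ hξs (hu.mem _))
      (hB₄ _ (hmem ξ s hs hξs))))
    hlip
    (fun ξ s _ hc => (H.κ_decay _ _ _ (hu.mem _) hc).trans (neg_nonpos.2 (H.W_nonneg _)))
  refine ⟨ζ, hζ, hζ0, fun t ht => (hsol t ht).2.trans ?_⟩
  congr 1
  refine intervalIntegral.integral_congr fun s hs => ?_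
  rw [uIcc_of_le ht] at hs
  have : w ζ s = predictedOutput f h r τ ℓ x ζ u s := by
    simp only [w, predictedOutput]
    congr 1
    refine intervalIntegral.integral_congr fun s' hs' => ?_
    rw [uIcc_of_le (hℓ.le s hs.1)] at hs'
    simp only [q]
    rw [cutoff_eq_one (hsol s' ((hℓ.nonneg s hs.1).trans hs'.1)).1, one_smul]
  simp only [this]

theorem exists_openLoopSol (hr : 0 ≤ r) (hTs : 0 ≤ Ts) (hℓ : IsLastSample Ts ℓ)
    (hu : IsControl U u) {x₀ : ℝ → E} (hx₀ : Continuous x₀) (z₀ : E) :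
    ∃ x z, IsOpenLoopSol f h κ r τ ℓ x z u ∧ (∀ t ≤ 0, x t = x₀ t) ∧ z 0 = z₀ := by
  obtain ⟨ξ, hξ, hξ0, Mξ, hsol⟩ := H.exists_plant_solution (τ := τ) hu (x₀ 0)
  obtain ⟨M₀, -, hM₀⟩ := exists_bound_Icc hx₀ (-r) 0
  set x : ℝ → E := fun t => if t ≤ 0 then x₀ t else ξ t with hxdef
  have hx : Continuous x := hx₀.if_le hξ continuous_id continuous_const (by
    rintro t rfl; exact hξ0.symm)
  have hxn : ∀ t ≤ 0, x t = x₀ t := fun t ht => if_pos ht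
  have hxp : ∀ t, 0 ≤ t → x t = ξ t := by
    intro t ht
    rcases ht.eq_or_lt with rfl | ht
    · rw [hxn _ le_rfl, hξ0]
    · exact if_neg (not_le.2 ht)
  have hxb : ∀ t, -r ≤ t → ‖x t‖ ≤ max M₀ Mξ := by
    intro t ht
    rcases le_total t 0 with h0 | h0
    · rw [hxn t h0]; exact (hM₀ t ⟨ht, h0⟩).trans (le_max_left _ _)
    · rw [hxp t h0]; exact (hsol t h0).1.trans (le_max_right _ _)
  obtain ⟨z, hz, hz0, hzsol⟩ := H.exists_observer_solution (τ := τ) hTs hℓ hu hx hxb z₀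
  refine ⟨x, z, ⟨hx, hz, fun t ht => ?_, fun t ht => by rw [hz0]; exact hzsol t ht⟩, hxn, hz0⟩
  rw [hxp t ht, hxn 0 le_rfl, (hsol t ht).2]
  congr 1
  refine intervalIntegral.integral_congr fun s hs => ?_
  rw [uIcc_of_le ht] at hs
  rw [hxp s hs.1]

/-- Open-loop trajectories depend causally on the control. -/
theorem openLoopSol_unique (hr : 0 ≤ r) (hτ : 0 ≤ τ) (hℓ : IsLastSample Ts ℓ) (hu : IsControl U u)
    (hu' : IsControl U u') (hs : IsOpenLoopSol f h κ r τ ℓ x z u)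
    (hs' : IsOpenLoopSol f h κ r τ ℓ x' z' u') (hx : ∀ t ∈ Icc (-r) 0, x t = x' t)
    (hz : z 0 = z' 0) (hT : 0 ≤ T) (huu : ∀ t ∈ Ico (-(r + τ)) T, u t = u' t) :
    (∀ t ∈ Icc (-r) T, x t = x' t) ∧ ∀ t ∈ Icc 0 T, z t = z' t := by
  obtain ⟨M₁, hM₁0, hM₁⟩ := exists_bound_Icc hs.continuous_x (-r) T
  obtain ⟨M₂, hM₂0, hM₂⟩ := exists_bound_Icc hs'.continuous_x (-r) T
  obtain ⟨M₃, hM₃0, hM₃⟩ := exists_bound_Icc hs.continuous_z 0 T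
  obtain ⟨M₄, hM₄0, hM₄⟩ := exists_bound_Icc hs'.continuous_z 0 T
  set M := M₁ + M₂ + M₃ + M₄ with hM
  obtain ⟨K₁, hK₁0, hK₁, -⟩ := H.lipschitz_f.exists_uniform H.isCompact_U M
  obtain ⟨K₂, hK₂0, hK₂, -⟩ := H.lipschitz_hdot.exists_uniform H.isCompact_U M
  have hxM : ∀ s ∈ Icc (-r) T, ‖x s‖ ≤ M := fun s hs => by linarith [hM₁ s hs]
  have hxM' : ∀ s ∈ Icc (-r) T, ‖x' s‖ ≤ M := fun s hs => by linarith [hM₂ s hs]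
  have hzM : ∀ s ∈ Icc 0 T, ‖z s‖ ≤ M := fun s hs => by linarith [hM₃ s hs]
  have hzM' : ∀ s ∈ Icc 0 T, ‖z' s‖ ≤ M := fun s hs => by linarith [hM₄ s hs]
  have hxx : ∀ t ∈ Icc (-r) T, x t = x' t := by
    intro t ht
    rcases le_total t 0 with ht0 | ht0
    · exact hx t ⟨ht.1, ht0⟩
    have := ((H.isPrimitiveOn_x hu hs hT).sub (H.isPrimitiveOn_x hu' hs' hT)).norm_le_of_causal
      hK₁0 le_rfl (fun s hsT D hD hd => ?_) ⟨ht0, ht.2⟩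
    · rw [hx 0 ⟨by linarith, le_rfl⟩, sub_self, norm_zero, mul_zero, add_zero, zero_mul] at this
      exact sub_eq_zero.1 (norm_le_zero_iff.1 this)
    · have hmem : s ∈ Icc (-r) T := ⟨by linarith [hsT.1], hsT.2.le⟩
      have hus := huu (s - τ) ⟨by linarith [hsT.1], by linarith [hsT.2]⟩
      refine (hK₁ _ _ _ _ (hxM s hmem) (hxM' s hmem) (hu.mem _) (hu'.mem _)).trans
        (mul_le_mul_of_nonneg_left ?_ hK₁0)
      rw [hus, sub_self, norm_zero]
      exact add_le_add_left (hd s ⟨hsT.1, le_rfl⟩) 0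
  refine ⟨hxx, fun t ht => ?_⟩
  obtain ⟨Bw, hBw⟩ := H.exists_predictedOutput_bound (τ := τ) hℓ hr M
  obtain ⟨Bu, -, hBu⟩ := H.isCompact_U.exists_norm_le
  obtain ⟨K₃, hK₃0, hK₃⟩ := H.lipschitz_κ.exists_norm_sub_le (max M (max Bw Bu))
  have hTs : 0 ≤ Ts := by linarith [hℓ.sub_le 0 le_rfl, hℓ.le 0 le_rfl]
  have := ((H.isPrimitiveOn_z hr hℓ hu hs hT).sub
    (H.isPrimitiveOn_z hr hℓ hu' hs' hT)).norm_le_of_causal (K := K₁ + K₃ * (1 + K₂ * Ts))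
    (by positivity) le_rfl (fun s hsT D hD hd => ?_) ht
  · rw [hz, sub_self, norm_zero, mul_zero, add_zero, zero_mul] at this
    exact sub_eq_zero.1 (norm_le_zero_iff.1 this)
  have hmem : s ∈ Icc 0 T := ⟨hsT.1, hsT.2.le⟩
  have hus : ∀ s' ∈ Icc 0 s, u (s' - r - τ) = u' (s' - r - τ) := fun s' hs' =>
    huu _ ⟨by linarith [hs'.1], by linarith [hs'.2, hsT.2]⟩
  have hds := hd s ⟨hsT.1, le_rfl⟩
  have hℓs := hℓ.le s hsT.1
  have hℓ0 := hℓ.nonneg s hsT.1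
  have hw : ‖predictedOutput f h r τ ℓ x z u s - predictedOutput f h r τ ℓ x' z' u' s‖ ≤
      K₂ * D * Ts := by
    rw [predictedOutput, predictedOutput, hxx _ ⟨by linarith, by linarith [hsT.2]⟩,
      add_sub_add_left_eq_sub, ← intervalIntegral.integral_sub
        (H.hdot_intervalIntegrable hu hs.continuous_z _ _)
        (H.hdot_intervalIntegrable hu' hs'.continuous_z _ _)]
    refine (intervalIntegral.norm_integral_le_of_norm_le_const (C := K₂ * D)
      fun s' hs' => ?_).trans ?_
    · rw [uIoc_of_le hℓs] at hs'
      have h1 : s' ∈ Icc 0 s := ⟨hℓ0.trans hs'.1.le, hs'.2⟩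
      have h2 : s' ∈ Icc 0 T := ⟨h1.1, h1.2.trans hsT.2.le⟩
      refine (hK₂ _ _ _ _ (hzM s' h2) (hzM' s' h2) (hu.mem _) (hu'.mem _)).trans
        (mul_le_mul_of_nonneg_left ?_ hK₂0)
      rw [hus s' h1, sub_self, norm_zero, add_zero]
      exact hd s' h1
    · rw [abs_of_nonneg (by linarith)]
      exact mul_le_mul_of_nonneg_left (hℓ.sub_le s hsT.1) (by positivity)
  rw [add_sub_add_comm, add_mul, add_zero]
  have h0 := hus s ⟨hsT.1, le_rfl⟩
  refine (norm_add_le _ _).trans (add_le_add ?_ ?_)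
  · refine (hK₁ _ _ _ _ (hzM s hmem) (hzM' s hmem) (hu.mem _) (hu'.mem _)).trans
      (mul_le_mul_of_nonneg_left ?_ hK₁0)
    rw [h0, sub_self, norm_zero, add_zero]
    exact hds
  · refine (hK₃ (_, _, _) (_, _, _)
      (max_le_max (hzM s hmem) (max_le_max (hBw x z u T hu hxM hzM s hmem) (hBu _ (hu.mem _))))
      (max_le_max (hzM' s hmem)
        (max_le_max (hBw x' z' u' T hu' hxM' hzM' s hmem) (hBu _ (hu'.mem _))))).trans ?_
    rw [mul_assoc]
    refine mul_le_mul_of_nonneg_left ?_ hK₃0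
    have h3 : 0 ≤ K₂ * D * Ts := by positivity
    rw [Prod.mk_sub_mk, Prod.mk_sub_mk, h0, sub_self, Prod.norm_mk, Prod.norm_mk, norm_zero]
    exact max_le (by nlinarith) (max_le (hw.trans (by nlinarith)) (by nlinarith))

end ObserverSetup

end OpenLoop

theorem exists_eq_of_causal {α : Type*} [Nonempty α] (T : ℕ → (ℕ → α) → α)
    (hT : ∀ j c c', (∀ i < j, c i = c' i) → T j c = T j c') : ∃ c, ∀ j, c j = T j c := by
  classical
  let d : α := Classical.arbitrary α
  let c : ℕ → α := fun n =>
    WellFounded.fix Nat.lt_wfRel.wf (C := fun _ => α)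
      (fun j ih => T j fun i => if hi : i < j then ih i hi else d) n
  refine ⟨c, fun j => ?_⟩
  have : c j = T j fun i => if i < j then c i else d := by
    simp only [c]
    rw [WellFounded.fix_eq]
    rfl
  rw [this]
  exact hT _ _ _ fun i hi => if_pos hi

section Euler

variable {E G : Type*} [NormedAddCommGroup E] [NormedSpace ℝ E] {f : E → G → E} {r τ : ℝ} {N : ℕ}
  {ξ : E} {v v' : ℝ → G}

theorem eulerIter_succ_eq (hδ : 0 ≤ τ + r) (i : ℕ) :
    eulerIter f r τ N ξ v (i + 1) = eulerIter f r τ N ξ v i +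
      ∫ s in Ioo ((i : ℝ) * ((τ + r) / N)) (((i : ℝ) + 1) * ((τ + r) / N)),
        f (eulerIter f r τ N ξ v i) (v (s - r - τ)) := by
  rw [eulerIter, intervalIntegral.integral_of_le, integral_Ioc_eq_integral_Ioo]
  gcongr
  linarith

theorem sub_mem_Ico_of_mem_step {i : ℕ} (hδ : 0 ≤ τ + r) (hi : i < N) {s : ℝ}
    (hs : s ∈ Ioo ((i : ℝ) * ((τ + r) / N)) (((i : ℝ) + 1) * ((τ + r) / N))) :
    s - r - τ ∈ Ico (-(r + τ)) 0 := by
  have hN : (0 : ℝ) < N := by exact_mod_cast (Nat.zero_le i).trans_lt hi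
  have h1 : 0 ≤ (i : ℝ) * ((τ + r) / N) := by positivity
  have h2 : ((i : ℝ) + 1) * ((τ + r) / N) ≤ τ + r := by
    have : (i : ℝ) + 1 ≤ N := by exact_mod_cast hi
    calc ((i : ℝ) + 1) * ((τ + r) / N) ≤ N * ((τ + r) / N) := by gcongr
      _ = τ + r := by field_simp
  exact ⟨by linarith [hs.1], by linarith [hs.2]⟩

theorem eulerIter_congr (hδ : 0 ≤ τ + r) (hv : ∀ θ ∈ Ico (-(r + τ)) 0, v θ = v' θ) {i : ℕ}
    (hi : i ≤ N) : eulerIter f r τ N ξ v i = eulerIter f r τ N ξ v' i := by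
  induction i with
  | zero => rfl
  | succ i ih =>
    rw [eulerIter_succ_eq hδ, eulerIter_succ_eq hδ, ih (by omega)]
    congr 1
    exact setIntegral_congr_fun measurableSet_Ioo fun s hs => by
      simp only [hv _ (sub_mem_Ico_of_mem_step hδ (by omega) hs)]

theorem PhiN_congr (hδ : 0 ≤ τ + r) (hv : ∀ θ ∈ Ico (-(r + τ)) 0, v θ = v' θ) :
    PhiN f r τ N ξ v = PhiN f r τ N ξ v' :=
  eulerIter_congr hδ hv le_rfl

end Euler

section ClosedLoop

set_option linter.unusedSectionVars false

variable {E G Y : Type*} [NormedAddCommGroup E] [NormedSpace ℝ E] [FiniteDimensional ℝ E]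
  [NormedAddCommGroup G] [NormedSpace ℝ G] [FiniteDimensional ℝ G] [MeasurableSpace G]
  [BorelSpace G] [NormedAddCommGroup Y] [NormedSpace ℝ Y] [FiniteDimensional ℝ Y]
  {f : E → G → E} {h : E → Y} {κ : E → Y → G → E} {U : Set G} {V W : E → ℝ} {R b : ℝ}
  {r τ Ts TH T : ℝ} {N : ℕ} {ℓ : ℝ → ℝ} {x z x' z' : ℝ → E} {u u' : ℝ → G} {ψ : E → G}

/-- Closed-loop trajectories under the sampled-data predictor feedback `ψ`. -/
structure IsFeedbackSol (f : E → G → E) (h : E → Y) (κ : E → Y → G → E) (ψ : E → G) (r τ TH : ℝ)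
    (N : ℕ) (ℓ : ℝ → ℝ) (x z : ℝ → E) (u : ℝ → G) : Prop
    extends IsOpenLoopSol f h κ r τ ℓ x z u where
  feedback : ∀ j : ℕ, ∀ t ∈ Ico ((j : ℝ) * TH) (((j : ℝ) + 1) * TH),
    u t = ψ (PhiN f r τ N (z ((j : ℝ) * TH)) fun θ => u ((j : ℝ) * TH + θ))

/-- The control equal to `u₀` for negative times and held at `c j` between `j * TH` and
`(j + 1) * TH`. -/
noncomputable def heldControl (TH : ℝ) (u₀ : ℝ → G) (c : ℕ → G) (t : ℝ) : G :=
  if t < 0 then u₀ t else c ⌊t / TH⌋₊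

theorem isControl_heldControl {u₀ : ℝ → G} {c : ℕ → G} (hu₀ : IsControl U u₀) (hc : ∀ j, c j ∈ U) :
    IsControl U (heldControl TH u₀ c) := by
  refine ⟨Measurable.ite measurableSet_Iio hu₀.measurable ?_, fun t => ?_⟩
  · exact (measurable_from_nat (f := c)).comp
      (Nat.measurable_floor.comp (measurable_id.div_const TH))
  · unfold heldControl
    split_ifs
    exacts [hu₀.mem t, hc _]

theorem heldControl_of_mem_Ico {u₀ : ℝ → G} {c : ℕ → G} (hTH : 0 < TH) {j : ℕ} {t : ℝ}
    (ht : t ∈ Ico ((j : ℝ) * TH) (((j : ℝ) + 1) * TH)) : heldControl TH u₀ c t = c j := by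
  have h0 : 0 ≤ t := (by positivity : (0 : ℝ) ≤ j * TH).trans ht.1
  have : ⌊t / TH⌋₊ = j := by
    rw [Nat.floor_eq_iff (by positivity)]
    exact ⟨(le_div_iff₀ hTH).2 ht.1, (div_lt_iff₀ hTH).2 ht.2⟩
  rw [heldControl, if_neg (not_lt.2 h0), this]

theorem heldControl_congr {u₀ : ℝ → G} {c c' : ℕ → G} (hTH : 0 < TH) {j : ℕ}
    (hc : ∀ i < j, c i = c' i) {t : ℝ} (ht : t < j * TH) :
    heldControl TH u₀ c t = heldControl TH u₀ c' t := by
  unfold heldControl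
  split_ifs with h0
  · rfl
  · refine hc _ ?_
    rw [Nat.floor_lt (by have := not_lt.1 h0; positivity)]
    exact (div_lt_iff₀ hTH).2 ht

namespace ObserverSetup

variable (H : ObserverSetup f h κ U V W R b)
include H

theorem exists_feedbackSol (hr : 0 ≤ r) (hτ : 0 ≤ τ) (hTs : 0 ≤ Ts) (hTH : 0 < TH)
    (hℓ : IsLastSample Ts ℓ) (hψ : ∀ ξ, ψ ξ ∈ U) (N : ℕ) {u₀ : ℝ → G} (hu₀ : IsControl U u₀)
    {x₀ : ℝ → E} (hx₀ : Continuous x₀) (z₀ : E) :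
    ∃ x z u, IsControl U u ∧ IsFeedbackSol f h κ ψ r τ TH N ℓ x z u ∧ (∀ t ≤ 0, x t = x₀ t) ∧
      z 0 = z₀ ∧ ∀ t < 0, u t = u₀ t := by
  have hctl : ∀ c : ℕ → U, IsControl U (heldControl TH u₀ fun j => (c j : G)) := fun c =>
    isControl_heldControl hu₀ fun j => (c j).2
  choose X Z hsol hX hZ using fun c : ℕ → U => H.exists_openLoopSol (τ := τ) hr hTs hℓ (hctl c) hx₀ z₀
  have : Nonempty U := ⟨⟨0, H.zero_mem⟩⟩
  obtain ⟨c, hc⟩ := exists_eq_of_causal (α := U) (fun j c => ⟨ψ (PhiN f r τ N (Z c (j * TH))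
    fun θ => heldControl TH u₀ (fun j => (c j : G)) (j * TH + θ)), hψ _⟩) (by
      intro j c c' hcc
      have hheld : ∀ t < (j : ℝ) * TH, heldControl TH u₀ (fun j => (c j : G)) t =
          heldControl TH u₀ (fun j => (c' j : G)) t := fun t ht =>
        heldControl_congr hTH (fun i hi => by rw [hcc i hi]) ht
      have hj : (0 : ℝ) ≤ j * TH := by positivity
      have hz := (H.openLoopSol_unique hr hτ hℓ (hctl c) (hctl c') (hsol c) (hsol c')
        (fun t ht => by rw [hX c t ht.2, hX c' t ht.2]) (by rw [hZ, hZ]) hj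
        (fun t ht => hheld t ht.2)).2 _ ⟨hj, le_rfl⟩
      refine Subtype.ext ?_
      simp only
      rw [hz, PhiN_congr (by linarith) fun θ hθ => hheld _ (by linarith [hθ.2])])
  refine ⟨X c, Z c, _, hctl c, ⟨hsol c, fun j t ht => ?_⟩, hX c, hZ c, fun t ht => if_pos ht⟩
  rw [heldControl_of_mem_Ico hTH ht, hc j]

theorem feedbackSol_unique (hr : 0 ≤ r) (hτ : 0 ≤ τ) (hTH : 0 < TH) (hℓ : IsLastSample Ts ℓ)
    (hu : IsControl U u) (hu' : IsControl U u') (hs : IsFeedbackSol f h κ ψ r τ TH N ℓ x z u)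
    (hs' : IsFeedbackSol f h κ ψ r τ TH N ℓ x' z' u') (hx : ∀ t ∈ Icc (-r) 0, x t = x' t)
    (hz : z 0 = z' 0) (huu : ∀ t ∈ Ico (-(r + τ)) 0, u t = u' t) :
    (∀ t, -r ≤ t → x t = x' t) ∧ (∀ t, 0 ≤ t → z t = z' t) ∧ ∀ t, -(r + τ) ≤ t → u t = u' t := by
  have hj : ∀ j : ℕ, ∀ t ∈ Ico (-(r + τ)) (j * TH), u t = u' t := by
    intro j
    induction j with
    | zero => simpa using huu
    | succ j ih =>
      intro t ht
      rcases lt_or_ge t (j * TH) with h1 | h1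
      · exact ih t ⟨ht.1, h1⟩
      push_cast at ht
      have h0 : (0 : ℝ) ≤ j * TH := by positivity
      rw [hs.feedback j t ⟨h1, ht.2⟩, hs'.feedback j t ⟨h1, ht.2⟩,
        (H.openLoopSol_unique hr hτ hℓ hu hu' hs.toIsOpenLoopSol hs'.toIsOpenLoopSol hx hz h0 ih).2 _
          ⟨h0, le_rfl⟩,
        PhiN_congr (by linarith) fun θ hθ => ih _ ⟨by linarith [hθ.1], by linarith [hθ.2]⟩]
  have hU : ∀ t, -(r + τ) ≤ t → u t = u' t := by
    intro t ht
    obtain ⟨j, hjt⟩ := exists_nat_gt (t / TH)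
    exact hj j t ⟨ht, (div_lt_iff₀ hTH).1 hjt⟩
  have key := fun T (hT : 0 ≤ T) => H.openLoopSol_unique hr hτ hℓ hu hu' hs.toIsOpenLoopSol
    hs'.toIsOpenLoopSol hx hz hT fun t ht => hU t ht.1
  exact ⟨fun t ht => (key (max t 0) (le_max_right _ _)).1 t ⟨ht, le_max_left _ _⟩,
    fun t ht => (key t ht).2 t ⟨ht, le_rfl⟩, hU⟩

end ObserverSetup

end ClosedLoop

theorem LocallyLipschitz.exists_norm_le_mul {X Z : Type*} [NormedAddCommGroup X] [ProperSpace X]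
    [NormedAddCommGroup Z] {g : X → Z} (hg : LocallyLipschitz g) (h0 : g 0 = 0) (M : ℝ) :
    ∃ K : ℝ, 0 ≤ K ∧ ∀ x, ‖x‖ ≤ M → ‖g x‖ ≤ K * ‖x‖ := by
  obtain ⟨K, hK0, hK⟩ := hg.exists_norm_sub_le M
  refine ⟨K, hK0, fun x hx => ?_⟩
  simpa [h0] using hK x 0 hx (by simpa using (norm_nonneg x).trans hx)

theorem norm_prodMk_le_add {X Z : Type*} [NormedAddCommGroup X] [NormedAddCommGroup Z] (x : X)
    (z : Z) : ‖(x, z)‖ ≤ ‖x‖ + ‖z‖ :=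
  max_le_add_of_nonneg (norm_nonneg _) (norm_nonneg _)

section ClosedLoop

set_option linter.unusedSectionVars false

variable {E G Y : Type*} [NormedAddCommGroup E] [NormedSpace ℝ E] [FiniteDimensional ℝ E]
  [NormedAddCommGroup G] [NormedSpace ℝ G] [FiniteDimensional ℝ G] [MeasurableSpace G]
  [BorelSpace G] [NormedAddCommGroup Y] [NormedSpace ℝ Y] [FiniteDimensional ℝ Y]
  {f : E → G → E} {h : E → Y} {κ : E → Y → G → E} {U : Set G} {V W : E → ℝ} {R b : ℝ}
  {r τ Ts TH T : ℝ} {N : ℕ} {ℓ : ℝ → ℝ} {x z x' z' : ℝ → E} {u u' : ℝ → G} {ψ : E → G}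

theorem exists_norm_eulerIter_le (hf : LocallyLipschitz fun q : E × G => f q.1 q.2)
    (hf0 : f 0 0 = 0) (hδ : 0 ≤ τ + r) (M : ℝ) {i : ℕ} (hi : i ≤ N) :
    ∃ Γ : ℝ, 1 ≤ Γ ∧ ∀ (ξ : E) (v : ℝ → G) (A : ℝ), ‖ξ‖ ≤ A → A ≤ M →
      (∀ θ ∈ Ico (-(r + τ)) 0, ‖v θ‖ ≤ A) → ‖eulerIter f r τ N ξ v i‖ ≤ Γ * A := by
  induction i with
  | zero => exact ⟨1, le_rfl, fun ξ v A hξ _ _ => by simpa [eulerIter] using hξ⟩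
  | succ i ih =>
    obtain ⟨Γ, hΓ, hb⟩ := ih (by omega)
    obtain ⟨K, hK0, hK⟩ := hf.exists_norm_le_mul hf0 (Γ * M + M)
    have hh : 0 ≤ (τ + r) / N := by positivity
    refine ⟨Γ + K * (Γ + 1) * ((τ + r) / N), by nlinarith [mul_nonneg hK0 (by linarith : 0 ≤ Γ + 1)],
      fun ξ v A hξ hA hv => ?_⟩
    have hA0 : 0 ≤ A := (norm_nonneg _).trans hξ
    have h1 := hb ξ v A hξ hA hv
    rw [eulerIter_succ_eq hδ]
    refine (norm_add_le _ _).trans ?_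
    have h2 : ‖∫ s in Ioo ((i : ℝ) * ((τ + r) / N)) (((i : ℝ) + 1) * ((τ + r) / N)),
        f (eulerIter f r τ N ξ v i) (v (s - r - τ))‖ ≤ K * (Γ * A + A) *
        (volume.real (Ioo ((i : ℝ) * ((τ + r) / N)) (((i : ℝ) + 1) * ((τ + r) / N)))) := by
      refine norm_setIntegral_le_of_norm_le_const (by simp) fun s hs => ?_
      have h3 := hv _ (sub_mem_Ico_of_mem_step hδ (by omega) hs)
      have h4 := (norm_prodMk_le_add (eulerIter f r τ N ξ v i) (v (s - r - τ))).trans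
        (add_le_add h1 h3)
      exact (hK (_, _) (h4.trans (by nlinarith))).trans (mul_le_mul_of_nonneg_left h4 hK0)
    rw [Real.volume_real_Ioo_of_le (by nlinarith)] at h2
    calc _ ≤ Γ * A + K * (Γ * A + A) * ((i + 1) * ((τ + r) / N) - i * ((τ + r) / N)) :=
          add_le_add h1 h2
      _ = _ := by ring

namespace ObserverSetup

variable (H : ObserverSetup f h κ U V W R b)
include H

theorem exists_bound_of_V_le (M c : ℝ) :
    ∃ B : ℝ, 0 ≤ B ∧ ∀ ξ y, ‖ξ‖ ≤ M → V y ≤ max (V ξ) c → ‖y‖ ≤ B := by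
  obtain ⟨v, hv⟩ := (isCompact_closedBall (0 : E) M).exists_bound_of_continuousOn
    H.contDiff_V.continuous.continuousOn
  obtain ⟨B, hB⟩ := (H.V_bounded (max v c)).exists_norm_le
  refine ⟨max B 0, le_max_right _ _, fun ξ y hξ hy => (hB y (hy.trans (max_le_max ?_ le_rfl))).trans
    (le_max_left _ _)⟩
  exact (le_abs_self _).trans (hv ξ (by simpa using hξ))

theorem hdot_zero : fderiv ℝ h 0 (f 0 0) = 0 := by rw [H.f_zero, map_zero]

/-- Open-loop trajectories are bounded on bounded time intervals by a multiple of the size of the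
initial data and of the control. -/
theorem exists_openLoop_bound (hr : 0 ≤ r) (hτ : 0 ≤ τ) (hTs : 0 ≤ Ts) (M : ℝ) (hT : 0 ≤ T) :
    ∃ Γ : ℝ, 1 ≤ Γ ∧ ∀ ℓ x z u A, IsLastSample Ts ℓ → IsControl U u →
      IsOpenLoopSol f h κ r τ ℓ x z u → A ≤ M → (∀ t ∈ Icc (-r) 0, ‖x t‖ ≤ A) → ‖z 0‖ ≤ A →
      (∀ t ∈ Ico (-(r + τ)) T, ‖u t‖ ≤ A) →
      (∀ t ∈ Icc (-r) T, ‖x t‖ ≤ Γ * A) ∧ ∀ t ∈ Icc 0 T, ‖z t‖ ≤ Γ * A := by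
  obtain ⟨B₁, hB₁0, hB₁⟩ := H.exists_bound_of_V_le M R
  obtain ⟨B₂, hB₂0, hB₂⟩ := H.exists_bound_of_V_le M b
  obtain ⟨K₁, hK₁0, hK₁⟩ := H.lipschitz_f.exists_norm_le_mul H.f_zero (B₁ + B₂ + M)
  obtain ⟨K₂, hK₂0, hK₂⟩ := H.lipschitz_hdot.exists_norm_le_mul H.hdot_zero (B₁ + B₂ + M)
  set g := Real.exp (2 * K₁ * T) * 3 with hg
  have hg1 : 1 ≤ g := by
    have := Real.one_le_exp (x := 2 * K₁ * T) (by positivity)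
    linarith
  obtain ⟨K₃, hK₃0, hK₃⟩ := H.lipschitz_h.exists_norm_le_mul H.h_zero (g * M)
  obtain ⟨K₄, hK₄0, hK₄⟩ := H.lipschitz_κ.exists_norm_le_mul H.κ_zero
    (B₂ + (K₃ * (g * M) + K₂ * (B₂ + M) * Ts) + M)
  set K := K₁ + K₄ * (1 + K₃ + K₂ * Ts) with hKdef
  have hK0 : 0 ≤ K := by positivity
  set g' := Real.exp (2 * K * T) * 3 with hg'
  have hg'1 : 1 ≤ g' := by
    have := Real.one_le_exp (x := 2 * K * T) (by positivity)
    linarith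
  refine ⟨g' * g, by nlinarith, fun ℓ x z u A hℓ hu hs hA hx hz hua => ?_⟩
  have hA0 : 0 ≤ A := (norm_nonneg _).trans hz
  have hM0 : 0 ≤ M := hA0.trans hA
  have hgA : A ≤ g * A := le_mul_of_one_le_left hA0 hg1
  have hgM : g * A ≤ g * M := by gcongr
  have hx0 : ‖x 0‖ ≤ A := hx 0 ⟨by linarith, le_rfl⟩
  have hxB : ∀ t, 0 ≤ t → ‖x t‖ ≤ B₁ := fun t ht =>
    hB₁ _ _ (hx0.trans hA) (H.V_x_le hu hs ht)
  have hzB : ∀ t, 0 ≤ t → ‖z t‖ ≤ B₂ := fun t ht =>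
    hB₂ _ _ (hz.trans hA) (H.V_z_le hr hℓ hu hs ht)
  have hxg : ∀ t ∈ Icc (-r) T, ‖x t‖ ≤ g * A := by
    intro t ht
    rcases le_total t 0 with ht0 | ht0
    · exact (hx t ⟨ht.1, ht0⟩).trans hgA
    refine ((H.isPrimitiveOn_x hu hs hT).norm_le_of_causal hK₁0 hA0 (fun s hsT D hD hd => ?_)
      ⟨ht0, ht.2⟩).trans ?_
    · have h1 := hua (s - τ) ⟨by linarith [hsT.1], by linarith [hsT.2]⟩
      have h2 := norm_prodMk_le_add (x s) (u (s - τ))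
      refine (hK₁ (_, _) (h2.trans (by linarith [hxB s hsT.1]))).trans
        (mul_le_mul_of_nonneg_left ?_ hK₁0)
      linarith [hd s ⟨hsT.1, le_rfl⟩]
    · have : Real.exp (2 * K₁ * t) ≤ Real.exp (2 * K₁ * T) :=
        Real.exp_le_exp.2 (mul_le_mul_of_nonneg_left ht.2 (by positivity))
      calc _ ≤ (3 * A) * Real.exp (2 * K₁ * T) :=
            mul_le_mul (by linarith) this (Real.exp_nonneg _) (by positivity)
        _ = g * A := by rw [hg]; ring
  refine ⟨fun t ht => (hxg t ht).trans (mul_le_mul_of_nonneg_right (by nlinarith) hA0),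
    fun t ht => ?_⟩
  refine ((H.isPrimitiveOn_z hr hℓ hu hs hT).norm_le_of_causal (A := g * A) hK0 (by positivity)
    (fun s hsT D hD hd => ?_) ht).trans ?_
  · have hℓs := hℓ.le s hsT.1
    have hℓ0 := hℓ.nonneg s hsT.1
    set D' := min D B₂ with hD'
    have hD'D : D' ≤ D := min_le_left _ _
    have hD'B : D' ≤ B₂ := min_le_right _ _
    have hD'0 : 0 ≤ D' := le_min hD hB₂0
    have hd' : ∀ s' ∈ Icc 0 s, ‖z s'‖ ≤ D' := fun s' hs' => le_min (hd s' hs') (hzB s' hs'.1)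
    have huA : ∀ s' ∈ Icc 0 s, ‖u (s' - r - τ)‖ ≤ A := fun s' hs' =>
      hua _ ⟨by linarith [hs'.1], by linarith [hs'.2, hsT.2]⟩
    have hw : ‖predictedOutput f h r τ ℓ x z u s‖ ≤ K₃ * (g * A) + K₂ * (D' + A) * Ts := by
      have h1 := hxg (ℓ s - r) ⟨by linarith, by linarith [hsT.2]⟩
      refine (norm_add_le _ _).trans (add_le_add ((hK₃ _ (h1.trans hgM)).trans
        (mul_le_mul_of_nonneg_left h1 hK₃0)) ?_)
      refine (intervalIntegral.norm_integral_le_of_norm_le_const (C := K₂ * (D' + A))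
        fun s' hs' => ?_).trans ?_
      · rw [uIoc_of_le hℓs] at hs'
        have h2 : s' ∈ Icc 0 s := ⟨hℓ0.trans hs'.1.le, hs'.2⟩
        have h3 := (norm_prodMk_le_add (z s') (u (s' - r - τ))).trans
          (add_le_add (hd' s' h2) (huA s' h2))
        exact (hK₂ (_, _) (h3.trans (by linarith))).trans (mul_le_mul_of_nonneg_left h3 hK₂0)
      · rw [abs_of_nonneg (by linarith)]
        exact mul_le_mul_of_nonneg_left (hℓ.sub_le s hsT.1) (by positivity)
    have hmem : s ∈ Icc 0 s := ⟨hsT.1, le_rfl⟩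
    have h1 := (norm_prodMk_le_add (z s) (u (s - r - τ))).trans
      (add_le_add (hd' s hmem) (huA s hmem))
    have h2 : ‖(z s, predictedOutput f h r τ ℓ x z u s, u (s - r - τ))‖ ≤
        D' + (K₃ * (g * A) + K₂ * (D' + A) * Ts) + A :=
      (norm_prodMk_le_add _ _).trans (by
        have := norm_prodMk_le_add (predictedOutput f h r τ ℓ x z u s) (u (s - r - τ))
        linarith [hd' s hmem, huA s hmem])
    refine (norm_add_le _ _).trans ((add_le_add ((hK₁ (_, _) (h1.trans (by linarith))).trans
      (mul_le_mul_of_nonneg_left h1 hK₁0)) ((hK₄ (_, _, _) (h2.trans ?_)).trans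
        (mul_le_mul_of_nonneg_left h2 hK₄0))).trans ?_)
    · gcongr
    · calc K₁ * (D' + A) + K₄ * (D' + (K₃ * (g * A) + K₂ * (D' + A) * Ts) + A)
          ≤ K₁ * (D + g * A) + K₄ * ((D + g * A) + K₃ * (D + g * A) + K₂ * (D + g * A) * Ts) := by
            have e1 : D' + A ≤ D + g * A := by linarith
            have e2 : K₃ * (g * A) ≤ K₃ * (D + g * A) := by gcongr; linarith
            have e3 : K₂ * (D' + A) * Ts ≤ K₂ * (D + g * A) * Ts := by gcongr
            have e4 := mul_le_mul_of_nonneg_left e1 hK₁0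
            have e5 : D' + (K₃ * (g * A) + K₂ * (D' + A) * Ts) + A ≤
              (D + g * A) + K₃ * (D + g * A) + K₂ * (D + g * A) * Ts := by linarith
            exact add_le_add e4 (mul_le_mul_of_nonneg_left e5 hK₄0)
        _ = K * (D + g * A) := by rw [hKdef]; ring
  · have : Real.exp (2 * K * t) ≤ Real.exp (2 * K * T) :=
      Real.exp_le_exp.2 (mul_le_mul_of_nonneg_left ht.2 (by positivity))
    calc _ ≤ (3 * (g * A)) * Real.exp (2 * K * T) :=
          mul_le_mul (by linarith) this (Real.exp_nonneg _) (by positivity)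
      _ = g' * g * A := by rw [hg']; ring

/-- Closed-loop trajectories are bounded on bounded time intervals by a multiple of the size of the
initial data. -/
theorem exists_transient_bound (hr : 0 ≤ r) (hτ : 0 ≤ τ) (hTs : 0 ≤ Ts) (hTH : 0 < TH)
    (hψ : LocallyLipschitz ψ) (hψ0 : ψ 0 = 0) (N : ℕ) (M T : ℝ) :
    ∃ Γ : ℝ, 1 ≤ Γ ∧ ∀ ℓ x z u s, IsLastSample Ts ℓ → IsControl U u →
      IsFeedbackSol f h κ ψ r τ TH N ℓ x z u → s ≤ M → (∀ t ∈ Icc (-r) 0, ‖x t‖ ≤ s) → ‖z 0‖ ≤ s →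
      (∀ t ∈ Ico (-(r + τ)) 0, ‖u t‖ ≤ s) →
      (∀ t ∈ Icc (-r) T, ‖x t‖ ≤ Γ * s) ∧ (∀ t ∈ Icc 0 T, ‖z t‖ ≤ Γ * s) ∧
      ∀ t ∈ Ico (-(r + τ)) T, ‖u t‖ ≤ Γ * s := by
  have key : ∀ j : ℕ, ∃ Γ : ℝ, 1 ≤ Γ ∧ ∀ ℓ x z u s, IsLastSample Ts ℓ → IsControl U u →
      IsFeedbackSol f h κ ψ r τ TH N ℓ x z u → s ≤ M → (∀ t ∈ Icc (-r) 0, ‖x t‖ ≤ s) → ‖z 0‖ ≤ s →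
      (∀ t ∈ Ico (-(r + τ)) 0, ‖u t‖ ≤ s) →
      (∀ t ∈ Icc (-r) (j * TH), ‖x t‖ ≤ Γ * s) ∧ (∀ t ∈ Icc 0 (j * TH), ‖z t‖ ≤ Γ * s) ∧
      ∀ t ∈ Ico (-(r + τ)) (j * TH), ‖u t‖ ≤ Γ * s := by
    intro j
    induction j with
    | zero =>
      refine ⟨1, le_rfl, fun ℓ x z u s _ _ _ _ hx hz hu => ?_⟩
      simp only [Nat.cast_zero, zero_mul, one_mul]
      exact ⟨hx, fun t ht => by rwa [le_antisymm ht.2 ht.1], hu⟩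
    | succ j ih =>
      obtain ⟨Γ, hΓ, hb⟩ := ih
      obtain ⟨Γ₁, hΓ₁, hb₁⟩ := exists_norm_eulerIter_le H.lipschitz_f H.f_zero
        (add_nonneg hτ hr) (Γ * M) (le_refl N)
      obtain ⟨K, hK0, hK⟩ := hψ.exists_norm_le_mul hψ0 (Γ₁ * (Γ * M))
      set Γ₂ := max Γ (K * (Γ₁ * Γ)) with hΓ₂
      have hj : (0 : ℝ) ≤ j * TH := by positivity
      obtain ⟨Γ₃, hΓ₃, hb₃⟩ := H.exists_openLoop_bound (T := ((j + 1 : ℕ) : ℝ) * TH) hr hτ hTs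
        (Γ₂ * M) (by positivity)
      have hΓ₂1 : 1 ≤ Γ₂ := hΓ.trans (le_max_left _ _)
      refine ⟨Γ₃ * Γ₂, by nlinarith, fun ℓ x z u s hℓ hu hs hsM hx hz hu0 => ?_⟩
      have hs0 : 0 ≤ s := (norm_nonneg _).trans hz
      obtain ⟨-, hzj, huj⟩ := hb ℓ x z u s hℓ hu hs hsM hx hz hu0
      have hsΓ₂ : s ≤ Γ₂ * s := le_mul_of_one_le_left hs0 hΓ₂1
      have hΓM : Γ * s ≤ Γ * M := by gcongr
      have hun : ∀ t ∈ Ico (-(r + τ)) (((j + 1 : ℕ) : ℝ) * TH), ‖u t‖ ≤ Γ₂ * s := by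
        intro t ht
        rcases lt_or_ge t (j * TH) with h1 | h1
        · exact (huj t ⟨ht.1, h1⟩).trans (mul_le_mul_of_nonneg_right (le_max_left _ _) hs0)
        rw [hs.feedback j t ⟨h1, by simpa using ht.2⟩]
        have h2 := hb₁ (z (j * TH)) (fun θ => u (j * TH + θ)) (Γ * s) (hzj _ ⟨hj, le_rfl⟩) hΓM
          fun θ hθ => huj _ ⟨by linarith [hθ.1], by linarith [hθ.2]⟩
        refine (hK _ (h2.trans (by gcongr))).trans ?_
        calc _ ≤ K * (Γ₁ * (Γ * s)) := mul_le_mul_of_nonneg_left h2 hK0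
          _ = K * (Γ₁ * Γ) * s := by ring
          _ ≤ _ := mul_le_mul_of_nonneg_right (le_max_right _ _) hs0
      obtain ⟨h4, h5⟩ := hb₃ ℓ x z u (Γ₂ * s) hℓ hu hs.toIsOpenLoopSol (by gcongr)
        (fun t ht => (hx t ht).trans hsΓ₂) (hz.trans hsΓ₂) hun
      refine ⟨fun t ht => (h4 t ht).trans_eq (by ring), fun t ht => (h5 t ht).trans_eq (by ring),
        fun t ht => (hun t ht).trans ?_⟩
      rw [mul_assoc]
      exact le_mul_of_one_le_left (by positivity) hΓ₃
  obtain ⟨j, hj⟩ := exists_nat_gt (T / TH)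
  rw [div_lt_iff₀ hTH] at hj
  obtain ⟨Γ, hΓ, hb⟩ := key j
  refine ⟨Γ, hΓ, fun ℓ x z u s hℓ hu hs hsM hx hz hu0 => ?_⟩
  obtain ⟨h1, h2, h3⟩ := hb ℓ x z u s hℓ hu hs hsM hx hz hu0
  exact ⟨fun t ht => h1 t ⟨ht.1, ht.2.trans hj.le⟩, fun t ht => h2 t ⟨ht.1, ht.2.trans hj.le⟩,
    fun t ht => h3 t ⟨ht.1, ht.2.trans hj⟩⟩

/-- Trajectories are absorbed by the sublevel sets of `V` after a time which is uniform over bounded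
sets of initial data. -/
theorem exists_absorption_time (hr : 0 ≤ r) (hR : 0 ≤ R) (M : ℝ) :
    ∃ T₁ : ℝ, 0 ≤ T₁ ∧ ∀ Ts ℓ x z u, IsLastSample Ts ℓ → IsControl U u →
      IsOpenLoopSol f h κ r τ ℓ x z u → ‖x 0‖ ≤ M → ‖z 0‖ ≤ M →
      ∀ t, T₁ ≤ t → V (x t) ≤ R ∧ V (z t) ≤ b := by
  obtain ⟨v, hv⟩ := (isCompact_closedBall (0 : E) M).exists_bound_of_continuousOn
    H.contDiff_V.continuous.continuousOn
  replace hv : ∀ ξ : E, ‖ξ‖ ≤ M → V ξ ≤ max v b := fun ξ hξ =>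
    ((le_abs_self _).trans (hv ξ (by simpa using hξ))).trans (le_max_left _ _)
  have hb0 : 0 ≤ b := hR.trans H.lt.le
  obtain ⟨η, hη, hW⟩ := H.W_pos (max v b)
  have hv0 : 0 ≤ max v b := hb0.trans (le_max_right _ _)
  refine ⟨max v b / η, by positivity, fun Ts ℓ x z u hℓ hu hs hx hz t ht => ?_⟩
  have ht0 : 0 ≤ t := (div_nonneg hv0 hη.le).trans ht
  have hlong : max v b ≤ η * (t - 0) := by
    rw [sub_zero]
    exact (div_le_iff₀' hη).1 ht
  constructor
  · refine ((H.isPrimitiveOn_x hu hs ht0).comp_contDiff H.contDiff_V).le_of_decrease hR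
      (fun s hs' hc => ?_) (fun s hs' hc => ?_) ((hv _ hx).trans hlong)
    · have h1 := hW (x s) hc ((H.V_x_le hu hs hs'.1).trans
        (max_le (hv _ hx) (H.lt.le.trans (le_max_right _ _))))
      linarith [H.decay (x s) _ (hu.mem (s - τ)) hc.le]
    · exact (H.decay (x s) _ (hu.mem (s - τ)) hc).trans (neg_nonpos.2 (H.W_nonneg _))
  · refine ((H.isPrimitiveOn_z hr hℓ hu hs ht0).comp_contDiff H.contDiff_V).le_of_decrease hb0
      (fun s hs' hc => ?_) (fun s hs' hc => ?_) ((hv _ hz).trans hlong)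
    · have h1 := hW (z s) (H.lt.trans hc) ((H.V_z_le hr hℓ hu hs hs'.1).trans
        (max_le (hv _ hz) (le_max_right _ _)))
      linarith [H.κ_decay (z s) (predictedOutput f h r τ ℓ x z u s) _ (hu.mem (s - r - τ)) hc.le]
    · exact (H.κ_decay (z s) _ _ (hu.mem (s - r - τ)) hc).trans (neg_nonpos.2 (H.W_nonneg _))

end ObserverSetup

end ClosedLoop

section Lyapunov

variable {E : Type*} [NormedAddCommGroup E]

/-- A trajectory whose Lyapunov function decays up to a decaying perturbation decays. -/
theorem IsPrimitiveOn.norm_le_of_lyapunov {v g : ℝ → ℝ} {a b : ℝ} (hv : IsPrimitiveOn v g a b)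
    {y : ℝ → E} {q q₂ l σ A B G : ℝ} (hq : 0 < q) (hl : 0 < l) (hσl : 4 * σ ≤ l)
    (hA : 0 ≤ A) (hB : 0 ≤ B) (hG : 0 ≤ G) (hqA : q₂ ≤ q * A ^ 2) (hqB : 2 ≤ l * q * B ^ 2)
    (hlower : ∀ t ∈ Icc a b, q * ‖y t‖ ^ 2 ≤ v t) (hupper : v a ≤ q₂ * ‖y a‖ ^ 2)
    (hg : ∀ t ∈ Icc a b, g t ≤ -l * v t + (G * Real.exp (-σ * (t - a))) ^ 2) {t : ℝ}
    (ht : t ∈ Icc a b) : ‖y t‖ ≤ (A * ‖y a‖ + B * G) * Real.exp (-σ * (t - a)) := by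
  have hexp : ∀ s, Real.exp (-σ * (s - a)) ^ 2 =
      Real.exp (2 * σ * a) * Real.exp (-(2 * σ) * s) := fun s => by
    rw [← Real.exp_nat_mul, ← Real.exp_add]
    congr 1
    push_cast
    ring
  have hdec := hv.le_exp_of_decay (l := l) (κ := 2 * σ) (d := G ^ 2 * Real.exp (2 * σ * a))
    (by linarith) (by positivity)
    (fun s hs => (hg s hs).trans_eq (by rw [mul_pow, hexp]; ring)) ht
  have hva : 0 ≤ v a := (by positivity : (0 : ℝ) ≤ q * ‖y a‖ ^ 2).trans
    (hlower a ⟨le_rfl, ht.1.trans ht.2⟩)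
  have h1 : Real.exp (-l * (t - a)) ≤ Real.exp (-σ * (t - a)) ^ 2 := by
    rw [← Real.exp_nat_mul]
    refine Real.exp_le_exp.2 ?_
    push_cast
    nlinarith [sub_nonneg.2 ht.1]
  have h2 : G ^ 2 * Real.exp (2 * σ * a) / (l - 2 * σ) * Real.exp (-(2 * σ) * t) ≤
      q * (B * G) ^ 2 * Real.exp (-σ * (t - a)) ^ 2 := by
    have h3 : G ^ 2 / (l - 2 * σ) ≤ q * (B * G) ^ 2 := by
      rw [div_le_iff₀ (by linarith)]
      have h4 : 2 * G ^ 2 ≤ l * q * B ^ 2 * G ^ 2 := by gcongr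
      have h5 : 0 ≤ q * (B * G) ^ 2 * (l - 4 * σ) :=
        mul_nonneg (by positivity) (by linarith)
      nlinarith
    calc _ = G ^ 2 / (l - 2 * σ) * Real.exp (-σ * (t - a)) ^ 2 := by rw [hexp]; ring
      _ ≤ _ := by gcongr
  have h3 : v a ≤ q * (A * ‖y a‖) ^ 2 := hupper.trans
    ((mul_le_mul_of_nonneg_right hqA (sq_nonneg _)).trans_eq (by ring))
  have h4 : q * ‖y t‖ ^ 2 ≤ q * ((A * ‖y a‖ + B * G) * Real.exp (-σ * (t - a))) ^ 2 := by
    calc q * ‖y t‖ ^ 2 ≤ _ := (hlower t ht).trans hdec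
      _ ≤ Real.exp (-σ * (t - a)) ^ 2 * (q * (A * ‖y a‖) ^ 2) +
          q * (B * G) ^ 2 * Real.exp (-σ * (t - a)) ^ 2 :=
        add_le_add (mul_le_mul h1 h3 hva (sq_nonneg _)) h2
      _ ≤ Real.exp (-σ * (t - a)) ^ 2 * (q * (A * ‖y a‖) ^ 2) +
          q * (B * G) ^ 2 * Real.exp (-σ * (t - a)) ^ 2 +
          2 * q * (A * ‖y a‖) * (B * G) * Real.exp (-σ * (t - a)) ^ 2 :=
        le_add_of_nonneg_right (by positivity)
      _ = _ := by ring
  exact (sq_le_sq₀ (norm_nonneg _) (by positivity)).1 (le_of_mul_le_mul_left h4 hq)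

end Lyapunov

section QuadraticForm

variable {E : Type*} [NormedAddCommGroup E] [InnerProductSpace ℝ E] [FiniteDimensional ℝ E]

theorem IsPrimitiveOn.inner_self {e g : ℝ → E} {a b : ℝ} (he : IsPrimitiveOn e g a b)
    (Q : E →L[ℝ] E) (hQ : ∀ v w : E, ⟪Q v, w⟫ = ⟪v, Q w⟫) :
    IsPrimitiveOn (fun t => ⟪e t, Q (e t)⟫) (fun t => 2 * ⟪e t, Q (g t)⟫) a b := by
  convert he.comp_contDiff (Φ := fun e : E => ⟪e, Q e⟫) (contDiff_id.inner ℝ Q.contDiff) using 2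
    with t
  have h1 : HasFDerivAt (fun e : E => ⟪e, Q e⟫) _ (e t) :=
    (hasFDerivAt_id (𝕜 := ℝ) (e t)).inner ℝ Q.hasFDerivAt
  rw [h1.fderiv]
  simp only [ContinuousLinearMap.comp_apply, ContinuousLinearMap.prod_apply, id_eq,
    ContinuousLinearMap.id_apply, fderivInnerCLM_apply]
  rw [← hQ (e t), real_inner_comm, two_mul, real_inner_comm]

omit [FiniteDimensional ℝ E] in
theorem two_mul_inner_add_le_of_dissipative {Q : E →L[ℝ] E} {q₂ ν B : ℝ} (hq₂ : 0 < q₂)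
    (hquad : ∀ e : E, ⟪e, Q e⟫ ≤ q₂ * ‖e‖ ^ 2) (hν : 0 < ν) {e g ε : E}
    (hg : ⟪e, Q g⟫ ≤ -ν * ‖e‖ ^ 2) (hε : ‖Q‖ * ‖ε‖ ≤ B) :
    2 * ⟪e, Q (g + ε)⟫ ≤ -(ν / q₂) * ⟪e, Q e⟫ + B ^ 2 / ν := by
  rw [map_add, inner_add_right]
  have h1 : ⟪e, Q ε⟫ ≤ ‖e‖ * B := (real_inner_le_norm _ _).trans
    (mul_le_mul_of_nonneg_left ((Q.le_opNorm _).trans hε) (norm_nonneg _))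
  have h2 : ν / q₂ * ⟪e, Q e⟫ ≤ ν * ‖e‖ ^ 2 :=
    (mul_le_mul_of_nonneg_left (hquad e) (by positivity)).trans_eq (by field_simp)
  have h3 : 2 * (‖e‖ * B) ≤ ν * ‖e‖ ^ 2 + B ^ 2 / ν := by
    have h4 : ν * ‖e‖ ^ 2 + B ^ 2 / ν - 2 * (‖e‖ * B) = (ν * ‖e‖ - B) ^ 2 / ν := by
      field_simp
      ring
    have h5 : 0 ≤ (ν * ‖e‖ - B) ^ 2 / ν := by positivity
    linarith
  linarith

end QuadraticForm

section Observer

set_option linter.unusedSectionVars false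

variable {E G Y : Type*} [NormedAddCommGroup E] [InnerProductSpace ℝ E] [FiniteDimensional ℝ E]
  [NormedAddCommGroup G] [NormedSpace ℝ G] [FiniteDimensional ℝ G] [MeasurableSpace G]
  [BorelSpace G] [NormedAddCommGroup Y] [NormedSpace ℝ Y] [FiniteDimensional ℝ Y]
  {f : E → G → E} {h : E → Y} {κ : E → Y → G → E} {U : Set G} {V W : E → ℝ} {R b : ℝ}
  {r τ Ts TH T : ℝ} {N : ℕ} {ℓ : ℝ → ℝ} {x z x' z' : ℝ → E} {u u' : ℝ → G} {ψ : E → G}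

namespace ObserverSetup

variable (H : ObserverSetup f h κ U V W R b)
include H

theorem isPrimitiveOn_x_delayed (hu : IsControl U u) (hs : IsOpenLoopSol f h κ r τ ℓ x z u)
    (hT : r ≤ T) :
    IsPrimitiveOn (fun t => x (t - r)) (fun t => f (x (t - r)) (u (t - r - τ))) r T := by
  simpa using (H.isPrimitiveOn_x hu hs (sub_nonneg.2 hT)).comp_sub_right r

/-- The error of the inter-sample predictor is small if the sampling period is small. -/
theorem norm_predictedOutput_sub_le (hℓ : IsLastSample Ts ℓ) (hu : IsControl U u)
    (hs : IsOpenLoopSol f h κ r τ ℓ x z u) {ρ K D t : ℝ} (hK0 : 0 ≤ K) (hD : 0 ≤ D)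
    (hK : ∀ x y u v, ‖x‖ ≤ ρ → ‖y‖ ≤ ρ → u ∈ U → v ∈ U →
      ‖fderiv ℝ h x (f x u) - fderiv ℝ h y (f y v)‖ ≤ K * (‖x - y‖ + ‖u - v‖))
    (hrt : r ≤ ℓ t) (ht : 0 ≤ t) (hz : ∀ s ∈ Icc (ℓ t) t, ‖z s‖ ≤ ρ)
    (hx : ∀ s ∈ Icc (ℓ t) t, ‖x (s - r)‖ ≤ ρ) (he : ∀ s ∈ Icc (ℓ t) t, ‖z s - x (s - r)‖ ≤ D) :
    ‖predictedOutput f h r τ ℓ x z u t - h (x (t - r))‖ ≤ K * D * Ts := by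
  have hℓt := hℓ.le t ht
  have hprim := (H.isPrimitiveOn_x_delayed hu hs (hrt.trans hℓt)).comp_contDiff H.contDiff_h
  have h1 := hprim.sub_eq ⟨hrt, hℓt⟩ ⟨hrt.trans hℓt, le_rfl⟩
  have h2 : predictedOutput f h r τ ℓ x z u t - h (x (t - r)) =
      ∫ s in (ℓ t)..t, (fderiv ℝ h (z s) (f (z s) (u (s - r - τ))) -
        fderiv ℝ h (x (s - r)) (f (x (s - r)) (u (s - r - τ)))) := by
    have hxr : Continuous fun s => x (s - r) :=
      hs.continuous_x.comp (continuous_id.sub continuous_const)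
    rw [intervalIntegral.integral_sub (H.hdot_intervalIntegrable hu hs.continuous_z _ _)
      (H.hdot_intervalIntegrable hu hxr _ _), ← h1, predictedOutput]
    abel
  rw [h2]
  refine (intervalIntegral.norm_integral_le_of_norm_le_const (C := K * D) fun s hs' => ?_).trans ?_
  · rw [uIoc_of_le hℓt] at hs'
    have hs'' := Ioc_subset_Icc_self hs'
    refine (hK _ _ _ _ (hz s hs'') (hx s hs'') (hu.mem _) (hu.mem _)).trans
      (mul_le_mul_of_nonneg_left ?_ hK0)
    simpa using he s hs''
  · rw [abs_of_nonneg (by linarith)]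
    exact mul_le_mul_of_nonneg_left (hℓ.sub_le t ht) (by positivity)

/-- The observer error decays exponentially once the trajectories have been absorbed, provided the
sampling period is small. -/
theorem exists_observer_decay (hr : 0 ≤ r) {Q : E →L[ℝ] E} (hQ : ∀ v w : E, ⟪Q v, w⟫ = ⟪v, Q w⟫)
    {q ν Λ : ℝ} (hq : 0 < q) (hQq : ∀ e : E, q * ‖e‖ ^ 2 ≤ ⟪e, Q e⟫) (hν : 0 < ν) (hΛ : 0 ≤ Λ)
    (hκΛ : ∀ z y y' u, u ∈ U → ‖κ z y u - κ z y' u‖ ≤ Λ * ‖y - y'‖)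
    (hκν : ∀ z x u, u ∈ U → V z ≤ b → V x ≤ R →
      ⟪z - x, Q (f z u + κ z (h x) u - f x u)⟫ ≤ -ν * ‖z - x‖ ^ 2) :
    ∃ Ts : ℝ, 0 < Ts ∧ ∃ σ : ℝ, 0 < σ ∧ ∃ A : ℝ, 1 ≤ A ∧ ∀ ℓ x z u T₁ S, IsLastSample Ts ℓ →
      IsControl U u → IsOpenLoopSol f h κ r τ ℓ x z u → 0 ≤ T₁ →
      (∀ t, T₁ ≤ t → V (x t) ≤ R ∧ V (z t) ≤ b) →
      (∀ t ∈ Icc (T₁ + r) (T₁ + r + Ts), ‖z t - x (t - r)‖ ≤ S) →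
      ∀ t, T₁ + r ≤ t → ‖z t - x (t - r)‖ ≤ A * S * Real.exp (-σ * (t - (T₁ + r + Ts))) := by
  obtain ⟨ρ, hρ0, hρ⟩ := (H.V_bounded b).exists_pos_norm_le
  obtain ⟨K, hK0, hK, -⟩ := H.lipschitz_hdot.exists_uniform H.isCompact_U ρ
  obtain ⟨q₂, hq₂0, hquad⟩ : ∃ q₂ : ℝ, 0 < q₂ ∧ ∀ e : E, ⟪e, Q e⟫ ≤ q₂ * ‖e‖ ^ 2 :=
    ⟨‖Q‖ + 1, by positivity, fun e => by
      have h1 := (real_inner_le_norm e (Q e)).trans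
        (mul_le_mul_of_nonneg_left (Q.le_opNorm e) (norm_nonneg _))
      nlinarith [sq_nonneg ‖e‖]⟩
  obtain ⟨l, hl⟩ : ∃ l, l = ν / q₂ := ⟨_, rfl⟩
  have hl0 : 0 < l := by rw [hl]; positivity
  obtain ⟨σ, hσ⟩ : ∃ σ, σ = l / 4 := ⟨_, rfl⟩
  have hσ0 : 0 < σ := by rw [hσ]; positivity
  obtain ⟨A₀, hA₀1, hqA⟩ : ∃ A₀ : ℝ, 1 ≤ A₀ ∧ q₂ ≤ q * A₀ ^ 2 := by
    refine ⟨1 + q₂ / q, by have : 0 ≤ q₂ / q := by positivity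
                           linarith, ?_⟩
    have : q * (1 + q₂ / q) ^ 2 = q + q₂ + q₂ + q₂ ^ 2 / q := by field_simp; ring
    have : 0 ≤ q₂ ^ 2 / q := by positivity
    linarith
  obtain ⟨B, hB0, hqB⟩ : ∃ B : ℝ, 0 ≤ B ∧ 2 ≤ l * q * B ^ 2 := by
    refine ⟨√(2 / (l * q)), Real.sqrt_nonneg _, ?_⟩
    rw [Real.sq_sqrt (by positivity)]
    exact (by field_simp : (2 : ℝ) = l * q * (2 / (l * q))).le
  obtain ⟨c₀, hc₀0, hc₀⟩ : ∃ c₀ : ℝ, 0 ≤ c₀ ∧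
      c₀ = B * (‖Q‖ * Λ * K * Real.exp σ / √ν) := ⟨_, by positivity, rfl⟩
  obtain ⟨Ts, hTs0, hTs1, hcTs⟩ : ∃ Ts : ℝ, 0 < Ts ∧ Ts ≤ 1 ∧ c₀ * Ts ≤ 1 / 2 := by
    refine ⟨1 / (2 * (c₀ + 1)), by positivity, ?_, ?_⟩
    · rw [div_le_one (by positivity)]; linarith
    · rw [mul_one_div, div_le_div_iff₀ (by positivity) (by positivity)]; linarith
  refine ⟨Ts, hTs0, σ, hσ0, 2 * A₀, by linarith, fun ℓ x z u T₁ S hℓ hu hs hT₁ hV hS t ht => ?_⟩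
  have hS0 : 0 ≤ S := (norm_nonneg _).trans (hS (T₁ + r) ⟨le_rfl, by linarith⟩)
  obtain ⟨T₃, hT₃⟩ : ∃ T₃, T₃ = T₁ + r + Ts := ⟨_, rfl⟩
  rw [← hT₃] at hS ⊢
  obtain ⟨e, he⟩ : ∃ e : ℝ → E, ∀ t, e t = z t - x (t - r) := ⟨_, fun _ => rfl⟩
  simp only [← he] at hS ⊢
  have hec : Continuous e := by
    rw [funext he]
    exact hs.continuous_z.sub (hs.continuous_x.comp (continuous_id.sub continuous_const))
  obtain ⟨ω, hω⟩ : ∃ ω : ℝ → ℝ, ∀ t, ω t = Real.exp (-σ * (t - T₃)) := ⟨_, fun _ => rfl⟩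
  have hω0 : ∀ t, 0 < ω t := fun t => by rw [hω]; exact Real.exp_pos _
  have hωanti : ∀ s t, s ≤ t → ω t ≤ ω s := fun s t hst => by
    rw [hω, hω]
    exact Real.exp_le_exp.2 (by nlinarith)
  have hω1 : ∀ s, s ≤ T₃ → 1 ≤ ω s := fun s hs => by
    rw [hω]
    exact Real.one_le_exp (by nlinarith)
  have hzρ : ∀ s, T₁ ≤ s → ‖z s‖ ≤ ρ := fun s hs => hρ _ (hV s hs).2
  have hxρ : ∀ s, T₁ ≤ s → ‖x s‖ ≤ ρ := fun s hs => hρ _ ((hV s hs).1.trans H.lt.le)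
  have key := le_two_mul_of_halving (ι := Icc (T₁ + r) t) (g := fun i => ‖e i‖) (ω := fun i => ω i)
    (A := A₀ * S) (by positivity) (fun i => (hω0 _).le) ?_ ?_ ⟨t, ht, le_rfl⟩
  · simpa only [hω, mul_assoc] using key
  · obtain ⟨B, hB0, hB⟩ := exists_bound_Icc hec (T₁ + r) t
    refine ⟨B / ω t, by have := hω0 t; positivity, fun i => (hB i i.2).trans ?_⟩
    rw [div_mul_eq_mul_div, le_div_iff₀ (hω0 t)]
    exact mul_le_mul_of_nonneg_left (hωanti _ _ i.2.2) hB0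
  rintro D hD hd ⟨s, hs1, hs2⟩
  simp only
  replace hd : ∀ s' ∈ Icc (T₁ + r) t, ‖e s'‖ ≤ D * ω s' := fun s' hs' => hd ⟨s', hs'⟩
  rcases le_total s T₃ with hs3 | hs3
  · calc ‖e s‖ ≤ S := hS s ⟨hs1, hs3⟩
      _ ≤ A₀ * S := le_mul_of_one_le_left hS0 hA₀1
      _ ≤ A₀ * S + D / 2 := by linarith
      _ ≤ _ := le_mul_of_one_le_right (by positivity) (hω1 s hs3)
  have hT₃0 : 0 ≤ T₃ := by linarith
  have hrT₃ : r ≤ T₃ := by linarith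
  have hwerr : ∀ s' ∈ Icc T₃ s, ‖predictedOutput f h r τ ℓ x z u s' - h (x (s' - r))‖ ≤
      K * Ts * Real.exp σ * D * ω s' := by
    intro s' hs'
    have hs'0 : 0 ≤ s' := hT₃0.trans hs'.1
    have hℓs := hℓ.sub_le s' hs'0
    have hmem : ∀ s'' ∈ Icc (ℓ s') s', T₁ + r ≤ s'' := fun s'' h'' => by linarith [h''.1, hs'.1]
    have h1 : ω (ℓ s') ≤ Real.exp σ * ω s' := by
      simp only [hω]
      rw [← Real.exp_add]
      exact Real.exp_le_exp.2 (by nlinarith)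
    refine (H.norm_predictedOutput_sub_le hℓ hu hs (ρ := ρ) hK0 (D := D * (Real.exp σ * ω s'))
      (by have := hω0 s'; positivity) hK (by linarith [hs'.1]) hs'0
      (fun s'' h'' => hzρ _ (by linarith [hmem s'' h'']))
      (fun s'' h'' => hxρ _ (by linarith [hmem s'' h'']))
      fun s'' h'' => (he s'' ▸ hd s'' ⟨hmem s'' h'', by linarith [h''.2, hs'.2]⟩).trans
        (mul_le_mul_of_nonneg_left ((hωanti _ _ h''.1).trans h1) hD)).trans_eq ?_
    ring
  have hprim := ((H.isPrimitiveOn_z hr hℓ hu hs (hT₃0.trans hs3)).mono ⟨hT₃0, hs3⟩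
    ⟨hT₃0.trans hs3, le_rfl⟩ hs3).sub ((H.isPrimitiveOn_x_delayed hu hs (hrT₃.trans hs3)).mono
      ⟨hrT₃, hs3⟩ ⟨hrT₃.trans hs3, le_rfl⟩ hs3)
  have hE := (hprim.congr (fun t _ => (he t).symm) fun _ _ => rfl).inner_self Q hQ
  have hfin := hE.norm_le_of_lyapunov (y := e) (q := q) (q₂ := q₂) (l := l) (σ := σ) (A := A₀)
    (B := B) (G := ‖Q‖ * Λ * K * Real.exp σ / √ν * Ts * D) hq hl0 (by linarith)
    (by linarith) hB0 (by positivity) hqA hqB (fun t _ => hQq _) (hquad _) (fun s' hs' => ?_)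
    ⟨hs3, le_rfl⟩
  · rw [← hω] at hfin
    refine hfin.trans (mul_le_mul_of_nonneg_right (add_le_add (mul_le_mul_of_nonneg_left
      (hS T₃ ⟨by linarith, le_rfl⟩) (by linarith)) ?_) (hω0 s).le)
    calc _ = c₀ * Ts * D := by rw [hc₀]; ring
      _ ≤ 1 / 2 * D := by gcongr
      _ = D / 2 := by ring
  · have hs'T₁ : T₁ + r ≤ s' := by linarith [hs'.1]
    have h1 := hκν (z s') (x (s' - r)) (u (s' - r - τ)) (hu.mem _) (hV s' (by linarith)).2
      (hV (s' - r) (by linarith)).1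
    have h2 := (hκΛ (z s') (predictedOutput f h r τ ℓ x z u s') (h (x (s' - r)))
      (u (s' - r - τ)) (hu.mem _)).trans (mul_le_mul_of_nonneg_left (hwerr s' hs') hΛ)
    rw [← he] at h1
    have h3 := two_mul_inner_add_le_of_dissipative hq₂0 hquad hν h1
      (mul_le_mul_of_nonneg_left h2 (norm_nonneg Q))
    rw [← hω, hl]
    convert h3 using 2
    · congr 3
      abel
    · rw [mul_pow, mul_pow, mul_pow, div_pow, Real.sq_sqrt hν.le]
      ring

end ObserverSetup

end Observer

section EulerError

variable {E G : Type*} [NormedAddCommGroup E] [NormedSpace ℝ E] [FiniteDimensional ℝ E]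
  [NormedAddCommGroup G] [NormedSpace ℝ G] [FiniteDimensional ℝ G] [MeasurableSpace G]
  [BorelSpace G] {f : E → G → E} {U : Set G} {r τ ρ K F : ℝ} {N : ℕ} {ξ : E} {v : ℝ → G}
  {y : ℝ → E}

/-- Accuracy of the Euler iterates along a trajectory bounded by `ρ`. -/
theorem norm_eulerIter_sub_le (hU : IsCompact U) (hf : LocallyLipschitz fun q : E × G => f q.1 q.2)
    (hv : IsControl U v) (hδ : 0 ≤ τ + r)
    (hy : IsPrimitiveOn y (fun s => f (y s) (v (s - r - τ))) 0 (τ + r)) (hK0 : 0 ≤ K)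
    (hK : ∀ x y u, ‖x‖ ≤ ρ + 1 → ‖y‖ ≤ ρ + 1 → u ∈ U → ‖f x u - f y u‖ ≤ K * ‖x - y‖)
    (hyρ : ∀ s ∈ Icc 0 (τ + r), ‖y s‖ ≤ ρ) (hF0 : 0 ≤ F)
    (hF : ∀ s ∈ Icc 0 (τ + r), ‖f (y s) (v (s - r - τ))‖ ≤ F)
    (hsmall : Real.exp (K * (τ + r)) * (‖ξ - y 0‖ + K * (τ + r) * ((τ + r) / N) * F) ≤ 1)
    {i : ℕ} (hi : i ≤ N) :
    ‖eulerIter f r τ N ξ v i - y (i * ((τ + r) / N))‖ ≤ Real.exp (K * (i * ((τ + r) / N))) *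
      (‖ξ - y 0‖ + K * (i * ((τ + r) / N)) * ((τ + r) / N) * F) := by
  induction i with
  | zero => simp [eulerIter]
  | succ i ih =>
    have hN : (0 : ℝ) < N := by exact_mod_cast (Nat.zero_le i).trans_lt hi
    obtain ⟨η, hη⟩ : ∃ η, η = (τ + r) / N := ⟨_, rfl⟩
    have hη0 : 0 ≤ η := by rw [hη]; positivity
    replace ih := ih (by omega)
    have hNη : N * η = τ + r := by rw [hη]; field_simp
    have hi1 : ((i : ℝ) + 1) * η ≤ τ + r := by
      rw [← hNη]
      have : (i : ℝ) + 1 ≤ N := by exact_mod_cast hi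
      gcongr
    have hi0 : (i : ℝ) * η ≤ (i + 1) * η := by gcongr; linarith
    have hiη : 0 ≤ (i : ℝ) * η := by positivity
    push_cast
    simp only [eulerIter]
    rw [← hη] at ih hsmall ⊢
    have hbd : ‖eulerIter f r τ N ξ v i‖ ≤ ρ + 1 := by
      have h1 : ‖eulerIter f r τ N ξ v i - y (i * η)‖ ≤ 1 := by
        refine ih.trans (le_trans ?_ hsmall)
        have := hi0.trans hi1
        gcongr
      have h2 := hyρ (i * η) ⟨hiη, hi0.trans hi1⟩
      have h3 := norm_sub_norm_le (eulerIter f r τ N ξ v i) (y (i * η))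
      linarith
    have hstep := hy.sub_eq ⟨hiη, hi0.trans hi1⟩ ⟨hiη.trans hi0, hi1⟩
    have hint1 : IntervalIntegrable (fun s => f (eulerIter f r τ N ξ v i) (v (s - r - τ))) volume
        (i * η) ((i + 1) * η) := by
      simpa only [sub_sub] using hv.intervalIntegrable hU hf
        (continuous_const (y := eulerIter f r τ N ξ v i)) (r + τ) _ _
    have hint2 : IntervalIntegrable (fun s => f (y s) (v (s - r - τ))) volume
        (i * η) ((i + 1) * η) := by
      exact (hy.mono ⟨hiη, hi0.trans hi1⟩ ⟨hiη.trans hi0, hi1⟩ hi0).integrable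
    have hεi : ∀ s ∈ Icc (i * η) ((i + 1) * η), ‖y (i * η) - y s‖ ≤ F * η := by
      intro s hs
      rw [norm_sub_rev]
      refine ((hy.mono ⟨hiη, hi0.trans hi1⟩ ⟨hiη.trans hi0, hi1⟩ hi0).norm_sub_le (B := F)
        (fun s' hs' => hF s' ⟨hiη.trans hs'.1, hs'.2.trans hi1⟩) ⟨le_rfl, hi0⟩ hs).trans ?_
      rw [abs_of_nonneg (by linarith [hs.1])]
      have := hs.2
      gcongr
      linarith
    obtain ⟨ε, hε⟩ : ∃ ε, ε = ‖eulerIter f r τ N ξ v i - y (i * η)‖ := ⟨_, rfl⟩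
    have hdiff : ‖∫ s in (i * η)..((i + 1) * η), (f (eulerIter f r τ N ξ v i) (v (s - r - τ)) -
        f (y s) (v (s - r - τ)))‖ ≤ K * (ε + F * η) * η := by
      refine (intervalIntegral.norm_integral_le_of_norm_le_const (C := K * (ε + F * η))
        fun s hs => ?_).trans ?_
      · rw [uIoc_of_le hi0] at hs
        have hs' := Ioc_subset_Icc_self hs
        have hys := hyρ s ⟨hiη.trans hs'.1, hs'.2.trans hi1⟩
        refine (hK _ _ _ hbd (by linarith) (hv.mem _)).trans (mul_le_mul_of_nonneg_left ?_ hK0)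
        have := norm_sub_le_norm_sub_add_norm_sub (eulerIter f r τ N ξ v i) (y (i * η)) (y s)
        have := hεi s hs'
        linarith
      · rw [abs_of_nonneg (by linarith)]
        exact (by ring : _ = _).le
    have heq : eulerIter f r τ N ξ v i + (∫ s in (i * η)..((i + 1) * η),
        f (eulerIter f r τ N ξ v i) (v (s - r - τ))) - y ((i + 1) * η) =
        (eulerIter f r τ N ξ v i - y (i * η)) + ∫ s in (i * η)..((i + 1) * η),
          (f (eulerIter f r τ N ξ v i) (v (s - r - τ)) - f (y s) (v (s - r - τ))) := by
      rw [intervalIntegral.integral_sub hint1 hint2, ← hstep]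
      abel
    rw [heq]
    refine (norm_add_le _ _).trans ((add_le_add le_rfl hdiff).trans ?_)
    rw [← hε] at ih ⊢
    have h1 : ε + K * (ε + F * η) * η = (K * η + 1) * ε + K * η * η * F := by ring
    rw [h1]
    have h2 : (K * η + 1) * ε ≤ Real.exp (K * η) * (Real.exp (K * (i * η)) *
        (‖ξ - y 0‖ + K * (i * η) * η * F)) :=
      mul_le_mul (Real.add_one_le_exp _) ih (hε ▸ norm_nonneg _) (Real.exp_pos _).le
    have h3 : Real.exp (K * ((i + 1) * η)) = Real.exp (K * η) * Real.exp (K * (i * η)) := by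
      rw [← Real.exp_add]; ring_nf
    have h4 : K * η * η * F ≤ Real.exp (K * ((i + 1) * η)) * (K * η * η * F) :=
      le_mul_of_one_le_left (by positivity) (Real.one_le_exp (by positivity))
    calc _ ≤ _ := add_le_add h2 h4
      _ = _ := by rw [h3]; ring

theorem norm_PhiN_sub_le (hU : IsCompact U) (hf : LocallyLipschitz fun q : E × G => f q.1 q.2)
    (hv : IsControl U v) (hδ : 0 ≤ τ + r) (hN : 0 < N)
    (hy : IsPrimitiveOn y (fun s => f (y s) (v (s - r - τ))) 0 (τ + r)) (hK0 : 0 ≤ K)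
    (hK : ∀ x y u, ‖x‖ ≤ ρ + 1 → ‖y‖ ≤ ρ + 1 → u ∈ U → ‖f x u - f y u‖ ≤ K * ‖x - y‖)
    (hyρ : ∀ s ∈ Icc 0 (τ + r), ‖y s‖ ≤ ρ) (hF0 : 0 ≤ F)
    (hF : ∀ s ∈ Icc 0 (τ + r), ‖f (y s) (v (s - r - τ))‖ ≤ F)
    (hsmall : Real.exp (K * (τ + r)) * (‖ξ - y 0‖ + K * (τ + r) * ((τ + r) / N) * F) ≤ 1) :
    ‖PhiN f r τ N ξ v - y (τ + r)‖ ≤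
      Real.exp (K * (τ + r)) * (‖ξ - y 0‖ + K * (τ + r) * ((τ + r) / N) * F) := by
  have h := norm_eulerIter_sub_le hU hf hv hδ hy hK0 hK hyρ hF0 hF hsmall (le_refl N)
  rwa [mul_div_cancel₀ _ (by positivity : (N : ℝ) ≠ 0)] at h

end EulerError

section Feedback

set_option linter.unusedSectionVars false

variable {E G Y : Type*} [NormedAddCommGroup E] [NormedSpace ℝ E] [FiniteDimensional ℝ E]
  [NormedAddCommGroup G] [NormedSpace ℝ G] [FiniteDimensional ℝ G] [MeasurableSpace G]
  [BorelSpace G] [NormedAddCommGroup Y] [NormedSpace ℝ Y] [FiniteDimensional ℝ Y]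
  {f : E → G → E} {h : E → Y} {κ : E → Y → G → E} {U : Set G} {V W : E → ℝ} {R b : ℝ}
  {r τ Ts TH T : ℝ} {N : ℕ} {ℓ : ℝ → ℝ} {x z x' z' : ℝ → E} {u u' : ℝ → G} {ψ : E → G}

namespace ObserverSetup

variable (H : ObserverSetup f h κ U V W R b)
include H

/-- The sampled approximate predictor feedback is close to the nominal feedback. -/
theorem norm_feedback_sub_le (hr : 0 ≤ r) (hτ : 0 ≤ τ) (hN : 0 < N) (hu : IsControl U u)
    (hs : IsFeedbackSol f h κ ψ r τ TH N ℓ x z u) {ρ K Kψ F D ε t : ℝ} (hK0 : 0 ≤ K)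
    (hK : ∀ x y u v, ‖x‖ ≤ ρ + 1 → ‖y‖ ≤ ρ + 1 → u ∈ U → v ∈ U →
      ‖f x u - f y v‖ ≤ K * (‖x - y‖ + ‖u - v‖)) (hKψ0 : 0 ≤ Kψ)
    (hKψ : ∀ x y, ‖x‖ ≤ ρ + 1 → ‖y‖ ≤ ρ + 1 → ‖ψ x - ψ y‖ ≤ Kψ * ‖x - y‖)
    (hF0 : 0 ≤ F) (hF : ∀ x u, ‖x‖ ≤ ρ → u ∈ U → ‖f x u‖ ≤ F)
    {j : ℕ} (hj : t ∈ Ico ((j : ℝ) * TH) (((j : ℝ) + 1) * TH)) (ht : 0 ≤ t - (τ + r) - TH)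
    (hxρ : ∀ s ∈ Icc (t - (τ + r) - TH) t, ‖x (s + τ)‖ ≤ ρ)
    (hD : ∀ s ∈ Icc (t - (τ + r) - TH) t, ‖x (s + τ)‖ + ‖u s‖ ≤ D)
    (hε : ‖z (j * TH) - x (j * TH - r)‖ ≤ ε)
    (hsmall : Real.exp (K * (τ + r)) * (ε + K * (τ + r) * ((τ + r) / N) * F) ≤ 1) :
    ‖u t - ψ (x (t + τ))‖ ≤
      Kψ * (Real.exp (K * (τ + r)) * (ε + K * (τ + r) * ((τ + r) / N) * (K * D)) +
        TH * (K * D)) := by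
  obtain ⟨t₀, ht₀⟩ : ∃ t₀ : ℝ, t₀ = j * TH := ⟨_, rfl⟩
  have hfb := hs.feedback j t hj
  rw [add_mul, one_mul] at hj
  rw [← ht₀] at hj hε hfb
  have hj1 := hj.1
  have hj2 := hj.2
  have hδ : 0 ≤ τ + r := by linarith
  have hTH : 0 < TH := by linarith
  have hρ0 : 0 ≤ ρ := (norm_nonneg _).trans (hxρ t ⟨by linarith, le_rfl⟩)
  have hD0 : 0 ≤ D := (by positivity : (0 : ℝ) ≤ ‖x (t + τ)‖ + ‖u t‖).trans
    (hD t ⟨by linarith, le_rfl⟩)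
  have hfD : ∀ s ∈ Icc (t - (τ + r) - TH) t, ‖f (x (s + τ)) (u s)‖ ≤ min F (K * D) := by
    intro s hs'
    refine le_min (hF _ _ (hxρ s hs') (hu.mem _)) ?_
    have h1 := hK (x (s + τ)) 0 (u s) 0 ((hxρ s hs').trans (by linarith)) (by simp; linarith)
      (hu.mem _) H.zero_mem
    rw [H.f_zero, sub_zero, sub_zero, sub_zero] at h1
    exact h1.trans (mul_le_mul_of_nonneg_left (hD s hs') hK0)
  have hprim := H.isPrimitiveOn_x (T := t + τ) hu hs.toIsOpenLoopSol (by linarith)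
  have hv : IsControl U fun θ => u (t₀ + θ) :=
    ⟨hu.measurable.comp (measurable_id.const_add t₀), fun θ => hu.mem _⟩
  have hy : IsPrimitiveOn (fun s => x (s + (t₀ - r)))
      (fun s => f (x (s + (t₀ - r))) (u (t₀ + (s - r - τ)))) 0 (τ + r) := by
    have h1 := (hprim.mono (c := t₀ - r) (d := t₀ + τ) ⟨by linarith, by linarith⟩
      ⟨by linarith, by linarith⟩ (by linarith)).comp_add_right (t₀ - r)
    rw [sub_self, show t₀ + τ - (t₀ - r) = τ + r by ring] at h1
    refine h1.congr (fun _ _ => rfl) fun s _ => ?_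
    congr 2
    ring
  have hmem : ∀ s ∈ Icc 0 (τ + r), s + (t₀ - r - τ) ∈ Icc (t - (τ + r) - TH) t := fun s hs' =>
    ⟨by linarith [hs'.1], by linarith [hs'.2]⟩
  have hst : ∀ s : ℝ, s + (t₀ - r - τ) + τ = s + (t₀ - r) := fun s => by ring
  have hPhi := norm_PhiN_sub_le (ξ := z t₀) (ρ := ρ) (F := min F (K * D)) H.isCompact_U H.lipschitz_f hv hδ hN hy hK0
    (fun x y u hx hy hu' => by simpa using hK x y u u hx hy hu' hu')
    (fun s hs' => by simpa only [hst] using hxρ _ (hmem s hs')) (le_min hF0 (by positivity))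
    (fun s hs' => by
      have := hfD _ (hmem s hs')
      rwa [hst, show s + (t₀ - r - τ) = t₀ + (s - r - τ) by ring] at this) (by
      rw [zero_add]
      refine le_trans ?_ hsmall
      gcongr
      exact min_le_left _ _)
  rw [show τ + r + (t₀ - r) = t₀ + τ by ring, zero_add] at hPhi
  have hPhi1 : ‖PhiN f r τ N (z t₀) (fun θ => u (t₀ + θ)) - x (t₀ + τ)‖ ≤ 1 := by
    refine hPhi.trans (le_trans ?_ hsmall)
    gcongr
    exact min_le_left _ _
  have hPhiD : ‖PhiN f r τ N (z t₀) (fun θ => u (t₀ + θ)) - x (t₀ + τ)‖ ≤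
      Real.exp (K * (τ + r)) * (ε + K * (τ + r) * ((τ + r) / N) * (K * D)) := by
    refine hPhi.trans ?_
    gcongr
    exact min_le_right _ _
  have hxt : ‖x (t + τ) - x (t₀ + τ)‖ ≤ TH * (K * D) := by
    refine ((hprim.mono (c := t₀ + τ) (d := t + τ) ⟨by linarith, by linarith⟩
      ⟨by linarith, le_rfl⟩ (by linarith)).norm_sub_le (B := K * D) (fun s hs' => ?_)
      ⟨le_rfl, by linarith⟩ ⟨by linarith, le_rfl⟩).trans ?_
    · have := (hfD (s - τ) ⟨by linarith [hs'.1], by linarith [hs'.2]⟩).trans (min_le_right _ _)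
      rwa [sub_add_cancel] at this
    · rw [abs_of_nonneg (by linarith), mul_comm]

      gcongr
      linarith
  have hx0 := hxρ t₀ ⟨by linarith, hj.1⟩
  rw [hfb]
  refine (hKψ _ _ ?_ ((hxρ t ⟨by linarith, le_rfl⟩).trans (by linarith))).trans
    (mul_le_mul_of_nonneg_left ?_ hKψ0)
  · linarith [norm_sub_norm_le (PhiN f r τ N (z t₀) fun θ => u (t₀ + θ)) (x (t₀ + τ))]
  · refine (norm_sub_le_norm_sub_add_norm_sub _ (x (t₀ + τ)) _).trans (add_le_add hPhiD ?_)
    rwa [norm_sub_rev]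

end ObserverSetup

end Feedback

section Lyapunov

variable {E : Type*} [NormedAddCommGroup E] [NormedSpace ℝ E] [FiniteDimensional ℝ E]

theorem exists_quadratic_bounds {P : E → ℝ} (hP : ContDiff ℝ 2 P) (hP0 : P 0 = 0)
    (hPnn : ∀ x, 0 ≤ P x) (ρ : ℝ) :
    ∃ C : ℝ, 0 ≤ C ∧ ∀ x, ‖x‖ ≤ ρ → ‖fderiv ℝ P x‖ ≤ C * ‖x‖ ∧ P x ≤ C * ‖x‖ ^ 2 := by
  have hmin : IsLocalMin P 0 := Filter.Eventually.of_forall fun x => by simpa [hP0] using hPnn x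
  have hlip : LocallyLipschitz (fderiv ℝ P) :=
    (hP.fderiv_right (m := 1) (by norm_num)).locallyLipschitz
  obtain ⟨C, hC0, hC⟩ := hlip.exists_norm_le_mul hmin.fderiv_eq_zero ρ
  refine ⟨C, hC0, fun x hx => ⟨hC x hx, ?_⟩⟩
  have h1 := (convex_closedBall (0 : E) ‖x‖).norm_image_sub_le_of_norm_fderiv_le (𝕜 := ℝ)
    (f := P) (C := C * ‖x‖) (x := 0) (y := x)
    (fun y _ => (hP.differentiable (by norm_num)).differentiableAt)
    (fun y hy => by
      have hy' : ‖y‖ ≤ ‖x‖ := by simpa using hy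
      exact (hC y (hy'.trans hx)).trans (by gcongr)) (by simp) (by simp)
  rw [hP0, sub_zero, sub_zero] at h1
  exact (le_abs_self _).trans (h1.trans_eq (by ring))

end Lyapunov

section Feedback

set_option linter.unusedSectionVars false

variable {E G Y : Type*} [NormedAddCommGroup E] [NormedSpace ℝ E] [FiniteDimensional ℝ E]
  [NormedAddCommGroup G] [NormedSpace ℝ G] [FiniteDimensional ℝ G] [MeasurableSpace G]
  [BorelSpace G] [NormedAddCommGroup Y] [NormedSpace ℝ Y] [FiniteDimensional ℝ Y]
  {f : E → G → E} {h : E → Y} {κ : E → Y → G → E} {U : Set G} {V W : E → ℝ} {R b : ℝ}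
  {r τ Ts TH T : ℝ} {N : ℕ} {ℓ : ℝ → ℝ} {x z x' z' : ℝ → E} {u u' : ℝ → G} {ψ : E → G}

theorem exists_nat_mul_small {α β : ℝ} (hα : 0 ≤ α) (hβ : 0 ≤ β) :
    ∃ N : ℕ, 0 < N ∧ α / N ≤ 1 / 4 ∧ β / N ≤ 1 / 2 := by
  obtain ⟨N, hN⟩ := exists_nat_ge (4 * α + 2 * β + 1)
  have hN0 : (0 : ℝ) < N := by linarith
  refine ⟨N, by exact_mod_cast hN0, ?_, ?_⟩ <;>
    rw [div_le_iff₀ hN0] <;> linarith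

namespace ObserverSetup

variable (H : ObserverSetup f h κ U V W R b)
include H

set_option maxHeartbeats 1600000 in
/-- The predicted state and the control decay exponentially once the observer error is small and
decays exponentially, provided the holding period is small and the Euler scheme is fine. -/
theorem exists_feedback_decay (hr : 0 ≤ r) (hτ : 0 ≤ τ) (hψU : ∀ x, ψ x ∈ U)
    (hψ : LocallyLipschitz ψ) (hψ0 : ψ 0 = 0) {P : E → ℝ} {μ K₁ : ℝ} (hP : ContDiff ℝ 2 P)
    (hP0 : P 0 = 0) (hPnn : ∀ x, 0 ≤ P x) (hμ : 0 < μ) (hK₁ : 0 < K₁)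
    (hPlower : ∀ x, V x ≤ R → K₁ * ‖x‖ ^ 2 ≤ P x)
    (hPdecay : ∀ x, V x ≤ R → fderiv ℝ P x (f x (ψ x)) ≤ -2 * μ * ‖x‖ ^ 2)
    {σ₁ : ℝ} (hσ₁ : 0 < σ₁) :
    ∃ TH : ℝ, 0 < TH ∧ ∃ N : ℕ, 0 < N ∧ ∃ ε₀ : ℝ, 0 < ε₀ ∧ ∃ σ : ℝ, 0 < σ ∧ σ ≤ σ₁ ∧
      ∃ A : ℝ, 1 ≤ A ∧ ∀ ℓ x z u T₄ S, IsControl U u → IsFeedbackSol f h κ ψ r τ TH N ℓ x z u →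
      0 ≤ T₄ → (∀ t, T₄ ≤ t → V (x t) ≤ R) → (∀ t, T₄ ≤ t → ‖z t - x (t - r)‖ ≤ ε₀) →
      (∀ t, T₄ ≤ t → ‖z t - x (t - r)‖ ≤ S * Real.exp (-σ * (t - T₄))) →
      (∀ t ∈ Icc T₄ (T₄ + (τ + r) + TH), ‖x (t + τ)‖ + ‖u t‖ ≤ S) →
      ∀ t, T₄ ≤ t → ‖x (t + τ)‖ + ‖u t‖ ≤ A * S * Real.exp (-σ * (t - T₄)) := by
  obtain ⟨ρ, hρ0, hρ⟩ := (H.V_bounded b).exists_pos_norm_le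
  obtain ⟨K, hK0, hK, hKF⟩ := H.lipschitz_f.exists_uniform H.isCompact_U (ρ + 1)
  obtain ⟨Kψ, hKψ0, hKψ⟩ := hψ.exists_norm_sub_le (ρ + 1)
  obtain ⟨C, hC0, hC⟩ := exists_quadratic_bounds hP hP0 hPnn ρ
  obtain ⟨δ, hδ⟩ : ∃ δ, δ = τ + r := ⟨_, rfl⟩
  have hδ0 : 0 ≤ δ := by linarith
  obtain ⟨l, hl⟩ : ∃ l, l = μ / (C + 1) := ⟨_, rfl⟩
  have hl0 : 0 < l := by rw [hl]; positivity
  obtain ⟨σ, hσ0, hσl, hσσ₁, hσ1⟩ : ∃ σ : ℝ, 0 < σ ∧ 4 * σ ≤ l ∧ σ ≤ σ₁ ∧ σ ≤ 1 := by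
    refine ⟨min (l / 4) (min σ₁ 1), lt_min (by linarith) (lt_min hσ₁ one_pos), ?_,
      (min_le_right _ _).trans (min_le_left _ _), (min_le_right _ _).trans (min_le_right _ _)⟩
    linarith [min_le_left (l / 4) (min σ₁ 1)]
  obtain ⟨A₀, hA₀0, hqA⟩ : ∃ A₀ : ℝ, 0 ≤ A₀ ∧ C + 1 ≤ K₁ * A₀ ^ 2 := by
    refine ⟨√((C + 1) / K₁), Real.sqrt_nonneg _, ?_⟩
    rw [Real.sq_sqrt (by positivity)]
    exact (by field_simp : C + 1 = K₁ * ((C + 1) / K₁)).le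
  obtain ⟨B, hB0, hqB⟩ : ∃ B : ℝ, 0 ≤ B ∧ 2 ≤ l * K₁ * B ^ 2 := by
    refine ⟨√(2 / (l * K₁)), Real.sqrt_nonneg _, ?_⟩
    rw [Real.sq_sqrt (by positivity)]
    exact (by field_simp : (2 : ℝ) = l * K₁ * (2 / (l * K₁))).le
  obtain ⟨c₁, hc₁0, hc₁⟩ : ∃ c₁ : ℝ, 0 ≤ c₁ ∧ c₁ ^ 2 = (C * K) ^ 2 / (4 * μ) := by
    refine ⟨√((C * K) ^ 2 / (4 * μ)), Real.sqrt_nonneg _, Real.sq_sqrt (by positivity)⟩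
  obtain ⟨X, hX⟩ : ∃ X, X = Real.exp (K * δ) := ⟨_, rfl⟩
  have hX0 : 0 < X := hX ▸ Real.exp_pos _
  obtain ⟨Z, hZ⟩ : ∃ Z, Z = Real.exp (δ + 1) := ⟨_, rfl⟩
  have hZ0 : 0 < Z := hZ ▸ Real.exp_pos _
  obtain ⟨a, ha0, ha⟩ : ∃ a, 0 ≤ a ∧ a = Kψ * X * Z := ⟨_, by positivity, rfl⟩
  obtain ⟨b₀, hb₀0, hb₀⟩ : ∃ b₀, 0 ≤ b₀ ∧ b₀ = (1 + Kψ) * (B * c₁) + 1 := ⟨_, by positivity, rfl⟩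
  obtain ⟨M, hM0, hM⟩ : ∃ M, 0 ≤ M ∧ M = b₀ * (Kψ * K * Z) := ⟨_, by positivity, rfl⟩
  obtain ⟨TH, hTH0, hTH1, hMTH⟩ : ∃ TH : ℝ, 0 < TH ∧ TH ≤ 1 ∧ M * TH ≤ 1 / 4 := by
    refine ⟨1 / (4 * (M + 1)), by positivity, ?_, ?_⟩
    · rw [div_le_one (by positivity)]; linarith
    · rw [mul_one_div, div_le_div_iff₀ (by positivity) (by positivity)]; linarith
  obtain ⟨N, hN0, hN1, hN2⟩ := exists_nat_mul_small (α := M * (X * K * δ * δ))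
    (β := X * K * δ * δ * K) (by positivity) (by positivity)
  obtain ⟨ε, hε0, hε⟩ : ∃ ε, 0 ≤ ε ∧ ε = Kψ * K * Z * (X * K * δ * (δ / N) + TH) :=
    ⟨_, by positivity, rfl⟩
  have hb₀ε : b₀ * ε ≤ 1 / 2 := by
    calc b₀ * ε = M * (X * K * δ * δ) / N + M * TH := by rw [hε, hM]; ring
      _ ≤ _ := by linarith
  have hZexp : ∀ s : ℝ, s ≤ δ + TH → Real.exp (σ * s) ≤ Z := fun s hs => by
    rw [hZ]
    exact Real.exp_le_exp.2 (by nlinarith)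
  obtain ⟨A, hA1, hA⟩ : ∃ A, 1 ≤ A ∧ A = 1 + (1 + Kψ) * A₀ + b₀ * a :=
    ⟨_, by have : 0 ≤ (1 + Kψ) * A₀ + b₀ * a := by positivity
           linarith, rfl⟩
  have hZ1 : 1 ≤ Z := hZ ▸ Real.one_le_exp (by linarith)
  refine ⟨TH, hTH0, N, hN0, 1 / (2 * X), by positivity, σ, hσ0, hσσ₁, 2 * A * Z, by nlinarith,
    fun ℓ x z u T₄ S hu hs hT₄ hV he hexp hS t ht => ?_⟩
  rw [← hδ] at hS
  obtain ⟨T₅, hT₅⟩ : ∃ T₅, T₅ = T₄ + δ + TH := ⟨_, rfl⟩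
  rw [← hT₅] at hS
  have hT₄₅ : T₄ ≤ T₅ := by linarith
  have hS0 : 0 ≤ S := (by positivity : 0 ≤ ‖x (T₄ + τ)‖ + ‖u T₄‖).trans (hS T₄ ⟨le_rfl, hT₄₅⟩)
  obtain ⟨ω, hω⟩ : ∃ ω : ℝ → ℝ, ∀ t, ω t = Real.exp (-σ * (t - T₅)) := ⟨_, fun _ => rfl⟩
  have hω0 : ∀ t, 0 < ω t := fun t => by rw [hω]; exact Real.exp_pos _
  have hωanti : ∀ s t, s ≤ t → ω t ≤ ω s := fun s t hst => by
    rw [hω, hω]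
    exact Real.exp_le_exp.2 (by nlinarith)
  have hω1 : ∀ s, s ≤ T₅ → 1 ≤ ω s := fun s hs => by
    rw [hω]
    exact Real.one_le_exp (by nlinarith)
  have hωZ : ∀ s t, t - (δ + TH) ≤ s → ω s ≤ Z * ω t := fun s t hst => by
    refine le_trans (le_of_eq ?_) (mul_le_mul_of_nonneg_right (hZexp (t - s) (by linarith))
      (hω0 t).le)
    rw [hω, hω, ← Real.exp_add]
    ring_nf
  have hxρ : ∀ s, T₄ ≤ s → ‖x s‖ ≤ ρ := fun s hs => hρ _ ((hV s hs).trans H.lt.le)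
  have key := le_two_mul_of_halving (ι := Icc T₄ t) (g := fun i => ‖x (i + τ)‖ + ‖u i‖)
    (ω := fun i => ω i) (A := A * S) (by positivity) (fun i => (hω0 _).le) ?_ ?_ ⟨t, ht, le_rfl⟩
  · refine key.trans ?_
    have h1 : ω t ≤ Z * Real.exp (-σ * (t - T₄)) := by
      refine le_trans (le_of_eq ?_) (mul_le_mul_of_nonneg_right (hZexp (δ + TH) le_rfl)
        (Real.exp_pos _).le)
      rw [hω, ← Real.exp_add, hT₅]
      ring_nf
    calc 2 * (A * S) * ω t ≤ 2 * (A * S) * (Z * Real.exp (-σ * (t - T₄))) := by gcongr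
      _ = _ := by ring
  · obtain ⟨B', hB'0, hB'⟩ := H.isCompact_U.exists_norm_le
    refine ⟨(ρ + B') / ω t, by have := hω0 t; positivity, fun i => ?_⟩
    have h1 : ‖x (i + τ)‖ + ‖u i‖ ≤ ρ + B' :=
      add_le_add (hxρ _ (by linarith [i.2.1])) (hB' _ (hu.mem _))
    refine h1.trans ?_
    rw [div_mul_eq_mul_div, le_div_iff₀ (hω0 t)]
    exact mul_le_mul_of_nonneg_left (hωanti _ _ i.2.2) (by positivity)
  rintro D hD hd ⟨s, hs1, hs2⟩
  simp only
  replace hd : ∀ s' ∈ Icc T₄ t, ‖x (s' + τ)‖ + ‖u s'‖ ≤ D * ω s' := fun s' hs' => hd ⟨s', hs'⟩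
  rcases le_total s T₅ with hs3 | hs3
  · calc ‖x (s + τ)‖ + ‖u s‖ ≤ S := hS s ⟨hs1, hs3⟩
      _ ≤ A * S := le_mul_of_one_le_left hS0 hA1
      _ ≤ A * S + D / 2 := by linarith
      _ ≤ _ := le_mul_of_one_le_right (by positivity) (hω1 s hs3)
  have hctl : ∀ s' ∈ Icc T₅ s, ‖u s' - ψ (x (s' + τ))‖ ≤ (a * S + ε * D) * ω s' := by
    intro s' hs'
    have hs'1 := hs'.1
    have hs'2 := hs'.2
    obtain ⟨j, hj⟩ : ∃ j : ℕ, s' ∈ Ico ((j : ℝ) * TH) (((j : ℝ) + 1) * TH) :=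
      ⟨⌊s' / TH⌋₊, (le_div_iff₀ hTH0).1 (Nat.floor_le (div_nonneg (by linarith) hTH0.le)),
        (div_lt_iff₀ hTH0).1 (Nat.lt_floor_add_one _)⟩
    have hj2 : s' < j * TH + TH := by linarith [hj.2]
    have hωs' := hω0 s'
    have hεj : ‖z (j * TH) - x (j * TH - r)‖ ≤ min (1 / (2 * X)) (S * (Z * ω s')) := by
      refine le_min (he _ (by linarith)) ((hexp _ (by linarith)).trans
        (mul_le_mul_of_nonneg_left (le_trans ?_ (hωZ (j * TH) s' (by linarith))) hS0))
      rw [hω]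
      exact Real.exp_le_exp.2 (by nlinarith)
    have h1 := H.norm_feedback_sub_le hr hτ hN0 hu hs (ρ := ρ) (D := D * (Z * ω s')) hK0 hK hKψ0
      hKψ hK0 (fun x u hx hu => hKF x u (by linarith) hu) hj (by linarith)
      (fun s'' h'' => hxρ _ (by linarith [h''.1]))
      (fun s'' h'' => (hd s'' ⟨by linarith [h''.1], by linarith [h''.2]⟩).trans
        (mul_le_mul_of_nonneg_left (hωZ _ _ (by linarith [h''.1])) hD)) hεj (by
        rw [← hδ, ← hX]
        calc X * (min (1 / (2 * X)) (S * (Z * ω s')) + K * δ * (δ / N) * K)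
            ≤ X * (1 / (2 * X) + K * δ * (δ / N) * K) := by gcongr; exact min_le_left _ _
          _ = 1 / 2 + X * K * δ * δ * K / N := by field_simp
          _ ≤ 1 := by linarith)
    rw [← hδ, ← hX] at h1
    refine h1.trans ?_
    calc _ ≤ Kψ * (X * (S * (Z * ω s') + K * δ * (δ / N) * (K * (D * (Z * ω s')))) +
          TH * (K * (D * (Z * ω s')))) := by gcongr; exact min_le_right _ _
      _ = _ := by rw [ha, hε]; ring
  have hprim : IsPrimitiveOn (fun t => x (t + τ)) (fun t => f (x (t + τ)) (u t)) T₅ s := by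
    have h1 := ((H.isPrimitiveOn_x (T := s + τ) hu hs.toIsOpenLoopSol (by linarith)).comp_add_right
      τ).mono (c := T₅) (d := s) ⟨by linarith, by linarith⟩ ⟨by linarith, by linarith⟩ hs3
    simpa using h1
  have hfin := (hprim.comp_contDiff (hP.of_le (by norm_num))).norm_le_of_lyapunov
    (y := fun t => x (t + τ)) (q := K₁) (q₂ := C + 1) (l := l) (σ := σ) (A := A₀)
    (B := B) (G := c₁ * (a * S + ε * D)) hK₁ hl0 hσl hA₀0 hB0 (by positivity) hqA hqB
    (fun s' hs' => hPlower _ (hV _ (by linarith [hs'.1])))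
    ((hC _ (hxρ _ (by linarith))).2.trans (by gcongr; linarith)) (fun s' hs' => ?_)
    (t := s) ⟨hs3, le_rfl⟩
  · rw [← hω] at hfin
    have h1 : ‖x (s + τ)‖ ≤ (A₀ * S + B * (c₁ * (a * S + ε * D))) * ω s := by
      refine hfin.trans (mul_le_mul_of_nonneg_right (add_le_add (mul_le_mul_of_nonneg_left
        (le_trans ?_ (hS T₅ ⟨hT₄₅, le_rfl⟩)) hA₀0) le_rfl) (hω0 s).le)
      exact le_add_of_nonneg_right (norm_nonneg _)
    have h2 := hctl s ⟨hs3, le_rfl⟩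
    have h3 : ‖ψ (x (s + τ))‖ ≤ Kψ * ‖x (s + τ)‖ := by
      simpa [hψ0] using hKψ (x (s + τ)) 0 ((hxρ _ (by linarith)).trans (by linarith))
        (by simp; linarith)
    have h4 : ‖u s‖ ≤ ‖u s - ψ (x (s + τ))‖ + ‖ψ (x (s + τ))‖ := by
      simpa using norm_add_le (u s - ψ (x (s + τ))) (ψ (x (s + τ)))
    calc ‖x (s + τ)‖ + ‖u s‖ ≤ (1 + Kψ) * ‖x (s + τ)‖ + (a * S + ε * D) * ω s := by linarith
      _ ≤ (1 + Kψ) * ((A₀ * S + B * (c₁ * (a * S + ε * D))) * ω s) + (a * S + ε * D) * ω s := by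
        gcongr
      _ = ((A - 1) * S + b₀ * ε * D) * ω s := by rw [hA, hb₀]; ring
      _ ≤ (A * S + 1 / 2 * D) * ω s := by
        have := (hω0 s).le
        gcongr
        linarith
      _ = _ := by ring
  · have hVs := hV (s' + τ) (by linarith [hs'.1])
    have hxs := hxρ (s' + τ) (by linarith [hs'.1])
    have h2 := hctl s' hs'
    have hCx := hC _ hxs
    have h3 := hPdecay _ hVs
    have h4 := hK (x (s' + τ)) (x (s' + τ)) (u s') (ψ (x (s' + τ))) (by linarith) (by linarith)
      (hu.mem _) (hψU _)
    rw [sub_self, norm_zero, zero_add] at h4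
    have h5 : fderiv ℝ P (x (s' + τ)) (f (x (s' + τ)) (u s') - f (x (s' + τ)) (ψ (x (s' + τ)))) ≤
        C * ‖x (s' + τ)‖ * (K * ((a * S + ε * D) * ω s')) := by
      refine (le_abs_self _).trans (((fderiv ℝ P (x (s' + τ))).le_opNorm _).trans ?_)
      exact mul_le_mul hCx.1 (h4.trans (by gcongr)) (norm_nonneg _) (by positivity)
    rw [map_sub] at h5
    rw [← hω, hl]
    obtain ⟨η, hη⟩ : ∃ η, η = (a * S + ε * D) * ω s' := ⟨_, rfl⟩
    rw [← hη] at h5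
    rw [show c₁ * (a * S + ε * D) * ω s' = c₁ * η by rw [hη]; ring, mul_pow, hc₁]
    have h6 : C * ‖x (s' + τ)‖ * (K * η) ≤
        μ * ‖x (s' + τ)‖ ^ 2 + (C * K) ^ 2 / (4 * μ) * η ^ 2 := by
      have h7 : μ * ‖x (s' + τ)‖ ^ 2 + (C * K) ^ 2 / (4 * μ) * η ^ 2 -
          C * ‖x (s' + τ)‖ * (K * η) = (2 * μ * ‖x (s' + τ)‖ - C * K * η) ^ 2 / (4 * μ) := by
        field_simp
        ring
      have h8 : 0 ≤ (2 * μ * ‖x (s' + τ)‖ - C * K * η) ^ 2 / (4 * μ) := by positivity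
      linarith
    have h9 : μ / (C + 1) * P (x (s' + τ)) ≤ μ * ‖x (s' + τ)‖ ^ 2 := by
      rw [div_mul_eq_mul_div, div_le_iff₀ (by positivity)]
      have h10 : P (x (s' + τ)) ≤ (C + 1) * ‖x (s' + τ)‖ ^ 2 := hCx.2.trans (by gcongr; linarith)
      nlinarith
    linarith

end ObserverSetup

end Feedback

theorem exists_mul_exp_neg_le {K ε σ : ℝ} (hK : 0 ≤ K) (hε : 0 < ε) (hσ : 0 < σ) :
    ∃ X : ℝ, 0 ≤ X ∧ ∀ t, X ≤ t → K * Real.exp (-σ * t) ≤ ε := by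
  refine ⟨K / (ε * σ), by positivity, fun t ht => ?_⟩
  rw [div_le_iff₀ (by positivity)] at ht
  rw [neg_mul, Real.exp_neg, ← div_eq_mul_inv, div_le_iff₀ (Real.exp_pos _)]
  have h1 := Real.add_one_le_exp (σ * t)
  nlinarith

section ClosedLoop

set_option linter.unusedSectionVars false

variable {E G Y : Type*} [NormedAddCommGroup E] [InnerProductSpace ℝ E] [FiniteDimensional ℝ E]
  [NormedAddCommGroup G] [NormedSpace ℝ G] [FiniteDimensional ℝ G] [MeasurableSpace G]
  [BorelSpace G] [NormedAddCommGroup Y] [NormedSpace ℝ Y] [FiniteDimensional ℝ Y]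
  {f : E → G → E} {h : E → Y} {κ : E → Y → G → E} {U : Set G} {V W : E → ℝ} {R b : ℝ}
  {r τ Ts TH T : ℝ} {N : ℕ} {ℓ : ℝ → ℝ} {x z x' z' : ℝ → E} {u u' : ℝ → G} {ψ : E → G}

namespace ObserverSetup

variable (H : ObserverSetup f h κ U V W R b)
include H

set_option maxHeartbeats 1000000 in
/-- Exponential decay of the closed loop, uniformly on bounded sets of initial data. -/
theorem exists_closedLoop_decay (hr : 0 ≤ r) (hτ : 0 ≤ τ) (hR : 0 ≤ R)
    {Q : E →L[ℝ] E} (hQ : ∀ v w : E, ⟪Q v, w⟫ = ⟪v, Q w⟫)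
    {q ν Λ : ℝ} (hq : 0 < q) (hQq : ∀ e : E, q * ‖e‖ ^ 2 ≤ ⟪e, Q e⟫) (hν : 0 < ν) (hΛ : 0 ≤ Λ)
    (hκΛ : ∀ z y y' u, u ∈ U → ‖κ z y u - κ z y' u‖ ≤ Λ * ‖y - y'‖)
    (hκν : ∀ z x u, u ∈ U → V z ≤ b → V x ≤ R →
      ⟪z - x, Q (f z u + κ z (h x) u - f x u)⟫ ≤ -ν * ‖z - x‖ ^ 2)
    (hψU : ∀ x, ψ x ∈ U)
    (hψ : LocallyLipschitz ψ) (hψ0 : ψ 0 = 0) {P : E → ℝ} {μ K₁ : ℝ} (hP : ContDiff ℝ 2 P)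
    (hP0 : P 0 = 0) (hPnn : ∀ x, 0 ≤ P x) (hμ : 0 < μ) (hK₁ : 0 < K₁)
    (hPlower : ∀ x, V x ≤ R → K₁ * ‖x‖ ^ 2 ≤ P x)
    (hPdecay : ∀ x, V x ≤ R → fderiv ℝ P x (f x (ψ x)) ≤ -2 * μ * ‖x‖ ^ 2) :
    ∃ Ts : ℝ, 0 < Ts ∧ ∃ TH : ℝ, 0 < TH ∧ ∃ N : ℕ, 0 < N ∧ ∃ σ : ℝ, 0 < σ ∧ ∀ M : ℝ,
      ∃ Γ : ℝ, 1 ≤ Γ ∧ ∀ ℓ x z u s, IsLastSample Ts ℓ → IsControl U u →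
      IsFeedbackSol f h κ ψ r τ TH N ℓ x z u → s ≤ M → (∀ t ∈ Icc (-r) 0, ‖x t‖ ≤ s) →
      ‖z 0‖ ≤ s → (∀ t ∈ Ico (-(r + τ)) 0, ‖u t‖ ≤ s) →
      (∀ t, -r ≤ t → ‖x t‖ ≤ Γ * s * Real.exp (-σ * t)) ∧
      (∀ t, 0 ≤ t → ‖z t‖ ≤ Γ * s * Real.exp (-σ * t)) ∧
      ∀ t, -(r + τ) ≤ t → ‖u t‖ ≤ Γ * s * Real.exp (-σ * t) := by
  obtain ⟨ρ, hρ0, hρ⟩ := (H.V_bounded b).exists_pos_norm_le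
  obtain ⟨Ts, hTs0, σ₁, hσ₁, A₁, hA₁, hobs⟩ :=
    H.exists_observer_decay (r := r) (τ := τ) hr hQ hq hQq hν hΛ hκΛ hκν
  obtain ⟨TH, hTH0, N, hN0, ε₀, hε₀, σ, hσ0, hσσ₁, A₂, hA₂, hfb⟩ :=
    H.exists_feedback_decay (r := r) (τ := τ) hr hτ hψU hψ hψ0 hP hP0 hPnn hμ hK₁ hPlower hPdecay
      hσ₁
  refine ⟨Ts, hTs0, TH, hTH0, N, hN0, σ, hσ0, fun M => ?_⟩
  obtain ⟨T₁, hT₁, habs⟩ := H.exists_absorption_time (r := r) (τ := τ) hr hR M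
  obtain ⟨X, hX0, hX⟩ := exists_mul_exp_neg_le (K := A₁ * (2 * ρ)) (by positivity) hε₀ hσ₁
  obtain ⟨T₃, hT₃⟩ : ∃ T₃, T₃ = T₁ + r + Ts := ⟨_, rfl⟩
  obtain ⟨T₄, hT₄⟩ : ∃ T₄, T₄ = T₃ + X := ⟨_, rfl⟩
  obtain ⟨T, hT⟩ : ∃ T, T = T₄ + (τ + r) + TH + τ + 1 := ⟨_, rfl⟩
  obtain ⟨Γ₀, hΓ₀, htr⟩ := H.exists_transient_bound hr hτ hTs0.le hTH0 hψ hψ0 N M T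
  have hT0 : 0 ≤ T := by linarith
  have hexpT : 1 ≤ Real.exp (σ * T) := Real.one_le_exp (by positivity)
  obtain ⟨Θ, hΘ⟩ : ∃ Θ, Θ = (1 + A₂) * (2 * A₁ * Γ₀) := ⟨_, rfl⟩
  have h2A : 2 ≤ 2 * A₁ := by linarith
  have hAΓ : 2 * Γ₀ ≤ 2 * A₁ * Γ₀ := by gcongr
  have hΘΓ : Γ₀ ≤ Θ := by rw [hΘ]; nlinarith
  refine ⟨Θ * Real.exp (σ * T), by nlinarith, fun ℓ x z u s hℓ hu hs hsM hx hz hu0 => ?_⟩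
  have hs0 : 0 ≤ s := (norm_nonneg _).trans hz
  obtain ⟨htx, htz, htu⟩ := htr ℓ x z u s hℓ hu hs hsM hx hz hu0
  have hab := habs Ts ℓ x z u hℓ hu hs.toIsOpenLoopSol ((hx 0 ⟨by linarith, le_rfl⟩).trans hsM)
    (hz.trans hsM)
  obtain ⟨S, hS⟩ : ∃ S, S = 2 * A₁ * Γ₀ * s := ⟨_, rfl⟩
  have hS0 : 0 ≤ S := by rw [hS]; positivity
  have hSΓ : 2 * (Γ₀ * s) ≤ S := by rw [hS, ← mul_assoc]; gcongr
  have hΘs : Θ * s = (1 + A₂) * S := by rw [hΘ, hS]; ring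
  have hzρ : ∀ t, T₁ ≤ t → ‖z t‖ ≤ ρ := fun t ht => hρ _ (hab t ht).2
  have hxρ : ∀ t, T₁ ≤ t → ‖x t‖ ≤ ρ := fun t ht => hρ _ ((hab t ht).1.trans H.lt.le)
  have he1 : ∀ t, T₄ ≤ t → ‖z t - x (t - r)‖ ≤ ε₀ := fun t ht => by
    have h1 := hobs ℓ x z u T₁ (2 * ρ) hℓ hu hs.toIsOpenLoopSol hT₁ hab (fun t ht => by
      linarith [norm_sub_le (z t) (x (t - r)), hzρ t (by linarith [ht.1]),
        hxρ (t - r) (by linarith [ht.1])]) t (by linarith)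
    exact h1.trans (hX _ (by linarith))
  have he2 : ∀ t, T₄ ≤ t → ‖z t - x (t - r)‖ ≤ S * Real.exp (-σ * (t - T₄)) := fun t ht => by
    have h1 := hobs ℓ x z u T₁ (2 * (Γ₀ * s)) hℓ hu hs.toIsOpenLoopSol hT₁ hab (fun t ht => by
      have := norm_sub_le (z t) (x (t - r))
      have := htz t ⟨by linarith [ht.1], by linarith [ht.2]⟩
      have := htx (t - r) ⟨by linarith [ht.1], by linarith [ht.2]⟩
      linarith) t (by linarith)
    refine h1.trans ?_
    rw [hS, show A₁ * (2 * (Γ₀ * s)) = 2 * A₁ * Γ₀ * s by ring]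
    refine mul_le_mul_of_nonneg_left (Real.exp_le_exp.2 ?_) (by positivity)
    have h2 : σ * (t - T₄) ≤ σ₁ * (t - T₄) := mul_le_mul_of_nonneg_right hσσ₁ (by linarith)
    nlinarith
  have hdec := hfb ℓ x z u T₄ S hu hs (by linarith) (fun t ht => (hab t (by linarith)).1) he1 he2
    (fun t ht => by
      have := htx (t + τ) ⟨by linarith [ht.1], by linarith [ht.2]⟩
      have := htu t ⟨by linarith [ht.1], by linarith [ht.2]⟩
      linarith)
  have hearly : ∀ t c, t ≤ T → c ≤ Γ₀ * s → c ≤ Θ * Real.exp (σ * T) * s * Real.exp (-σ * t) := by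
    intro t c ht hc
    have h1 : 1 ≤ Real.exp (σ * T) * Real.exp (-σ * t) := by
      rw [← Real.exp_add]
      exact Real.one_le_exp (by nlinarith)
    calc c ≤ Γ₀ * s := hc
      _ ≤ Θ * s * 1 := by rw [mul_one]; gcongr
      _ ≤ Θ * s * (Real.exp (σ * T) * Real.exp (-σ * t)) := by gcongr; rw [hΘs]; positivity
      _ = _ := by ring
  have hlate : ∀ t t' c, t ≤ t' + T → c ≤ (1 + A₂) * S * Real.exp (-σ * t') →
      c ≤ Θ * Real.exp (σ * T) * s * Real.exp (-σ * t) := by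
    intro t t' c ht hc
    refine hc.trans ?_
    rw [mul_right_comm Θ, mul_assoc (Θ * s), hΘs, ← Real.exp_add]
    refine mul_le_mul_of_nonneg_left (Real.exp_le_exp.2 ?_) (by positivity)
    nlinarith
  refine ⟨fun t ht => ?_, fun t ht => ?_, fun t ht => ?_⟩
  · rcases le_total t T with htT | htT
    · exact hearly t _ htT (htx t ⟨ht, htT⟩)
    · refine hlate t (t - τ - T₄) _ (by linarith) ?_
      have h1 := hdec (t - τ) (by linarith)
      rw [sub_add_cancel] at h1
      refine (le_trans (le_add_of_nonneg_right (norm_nonneg _)) h1).trans ?_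
      gcongr
      linarith
  · rcases le_total t T with htT | htT
    · exact hearly t _ htT (htz t ⟨ht, htT⟩)
    · refine hlate t (t - r - τ - T₄) _ (by linarith) ?_
      have h1 := hdec (t - r - τ) (by linarith)
      rw [sub_add_cancel] at h1
      have h2 := he2 t (by linarith)
      have h3 : ‖z t‖ ≤ ‖z t - x (t - r)‖ + ‖x (t - r)‖ := by
        simpa using norm_add_le (z t - x (t - r)) (x (t - r))
      have h4 : S * Real.exp (-σ * (t - T₄)) ≤ S * Real.exp (-σ * (t - r - τ - T₄)) :=
        mul_le_mul_of_nonneg_left (Real.exp_le_exp.2 (by nlinarith)) hS0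
      have h5 := norm_nonneg (u (t - r - τ))
      linarith
  · rcases lt_or_ge t T with htT | htT
    · exact hearly t _ htT.le (htu t ⟨ht, htT⟩)
    · refine hlate t (t - T₄) _ (by linarith) ?_
      have h1 := hdec t (by linarith)
      refine (le_trans (le_add_of_nonneg_left (norm_nonneg _)) h1).trans ?_
      gcongr
      linarith

end ObserverSetup

end ClosedLoop

theorem LocallyLipschitz.add_real {α : Type*} [PseudoEMetricSpace α] {F G : α → ℝ}
    (hF : LocallyLipschitz F) (hG : LocallyLipschitz G) : LocallyLipschitz fun s => F s + G s :=
  ((contDiff_fst.add contDiff_snd).locallyLipschitz (𝕂 := ℝ) :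
    LocallyLipschitz fun q : ℝ × ℝ => q.1 + q.2).comp (hF.prodMk hG)

theorem LocallyLipschitz.mul_real {α : Type*} [PseudoEMetricSpace α] {F G : α → ℝ}
    (hF : LocallyLipschitz F) (hG : LocallyLipschitz G) : LocallyLipschitz fun s => F s * G s :=
  ((contDiff_fst.mul contDiff_snd).locallyLipschitz (𝕂 := ℝ) :
    LocallyLipschitz fun q : ℝ × ℝ => q.1 * q.2).comp (hF.prodMk hG)

/-- A family of linear bounds on bounded intervals is dominated by a single locally Lipschitz
function of class `K∞`. -/
theorem exists_classK_ge (Γ : ℕ → ℝ) (hΓ : ∀ n, 0 ≤ Γ n) :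
    ∃ C : ℝ → ℝ, (C 0 = 0 ∧ StrictMonoOn C (Ici 0) ∧ ContinuousOn C (Ici 0) ∧
      Tendsto C atTop atTop ∧ LocallyLipschitz C) ∧ ∀ s, 0 ≤ s → Γ ⌈s⌉₊ * s ≤ C s := by
  obtain ⟨A, hA⟩ : ∃ A : ℕ → ℝ → ℝ, ∀ M s,
      A M s = 1 + ∑ n ∈ Finset.range (M + 3), Γ n * max 0 (s - n + 2) := ⟨_, fun _ _ => rfl⟩
  have hterm : ∀ (n : ℕ) (s : ℝ), 0 ≤ Γ n * max 0 (s - n + 2) := fun n s =>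
    mul_nonneg (hΓ n) (le_max_left _ _)
  have hA1 : ∀ M s, 1 ≤ A M s := fun M s => by
    rw [hA]; linarith [Finset.sum_nonneg fun n (_ : n ∈ Finset.range (M + 3)) => hterm n s]
  have hAmono : ∀ M s t, s ≤ t → A M s ≤ A M t := fun M s t hst => by
    rw [hA, hA]
    gcongr with n
    exact hΓ n
  have hAlip : ∀ M, LocallyLipschitz (A M) := fun M => by
    have key : ∀ K : ℕ, LocallyLipschitz fun s : ℝ =>
        ∑ n ∈ Finset.range K, Γ n * max 0 (s - n + 2) := by
      intro K
      induction K with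
      | zero => simpa using LocallyLipschitz.const (0 : ℝ)
      | succ K ih =>
        simp only [Finset.sum_range_succ]
        refine ih.add_real ((LocallyLipschitz.const (Γ K)).mul_real ?_)
        exact (((contDiff_id.sub contDiff_const).add contDiff_const).locallyLipschitz
          (𝕂 := ℝ)).const_max 0
    rw [funext (hA M)]
    exact (LocallyLipschitz.const 1).add_real (key _)
  have hAeq : ∀ (M : ℕ) (s : ℝ), s ≤ M → A ⌈s⌉₊ s = A M s := fun M s hs => by
    rw [hA, hA]
    congr 1
    refine Finset.sum_subset (Finset.range_mono (by have := Nat.ceil_le.2 hs; omega))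
      fun n _ hn => ?_
    have h1 : (⌈s⌉₊ : ℝ) + 3 ≤ n := by
      rw [Finset.mem_range, not_lt] at hn
      exact_mod_cast hn
    rw [max_eq_left (by linarith [Nat.le_ceil s]), mul_zero]
  have hC : ∀ (M : ℕ) (s : ℝ), s ≤ M → s * A ⌈s⌉₊ s = s * A M s := fun M s hs => by rw [hAeq M s hs]
  have hlip : LocallyLipschitz fun s => s * A ⌈s⌉₊ s := fun s => by
    obtain ⟨M, hM⟩ := exists_nat_gt s
    obtain ⟨K, t, ht, hK⟩ := (LocallyLipschitz.id.mul_real (hAlip M)) s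
    refine ⟨K, t ∩ Iio M, inter_mem ht (Iio_mem_nhds hM), fun a ha b hb => ?_⟩
    simp only [hC M a (le_of_lt ha.2), hC M b (le_of_lt hb.2)]
    exact hK ha.1 hb.1
  refine ⟨fun s => s * A ⌈s⌉₊ s, ⟨by simp, fun s hs t ht hst => ?_, hlip.continuous.continuousOn,
    ?_, hlip⟩, fun s hs => ?_⟩
  · obtain ⟨M, hM⟩ := exists_nat_gt t
    simp only [hC M s (hst.trans hM).le, hC M t hM.le]
    exact mul_lt_mul hst (hAmono _ _ _ hst.le) (by linarith [hA1 M s]) ht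
  · refine tendsto_atTop_mono' _ ?_ tendsto_id
    filter_upwards [eventually_ge_atTop 0] with s hs
    exact le_mul_of_one_le_right hs (hA1 _ _)
  · rw [mul_comm]
    refine mul_le_mul_of_nonneg_left ?_ hs
    have h1 := Finset.single_le_sum (f := fun n : ℕ => Γ n * max 0 (s - n + 2))
      (fun n (_ : n ∈ Finset.range (⌈s⌉₊ + 3)) => hterm n s)
      (Finset.mem_range.2 (by omega : ⌈s⌉₊ < ⌈s⌉₊ + 3))
    have h2 : Γ ⌈s⌉₊ * 1 ≤ Γ ⌈s⌉₊ * max 0 (s - ⌈s⌉₊ + 2) :=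
      mul_le_mul_of_nonneg_left (le_max_of_le_right (by linarith [Nat.ceil_lt_add_one hs])) (hΓ _)
    rw [hA]
    linarith

/-- The largest `π i` not exceeding `t`, for an unbounded increasing sequence `π`. -/
theorem exists_lastSample {π : ℕ → ℝ} {Ts : ℝ} (h0 : π 0 = 0) (hmono : StrictMono π)
    (htop : Tendsto π atTop atTop) (hTs : ∀ i, π (i + 1) - π i ≤ Ts) :
    ∃ ℓ : ℝ → ℝ, IsLastSample Ts ℓ ∧ (∀ i, ∀ t ∈ Ico (π i) (π (i + 1)), ℓ t = π i) ∧
      ∀ t, 0 ≤ t → ∃ i, t ∈ Ico (π i) (π (i + 1)) := by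
  classical
  have hex : ∀ t, ∃ i, t < π (i + 1) := fun t =>
    (((tendsto_add_atTop_iff_nat 1).2 htop).eventually_gt_atTop t).exists
  have hfind : ∀ t, 0 ≤ t → t ∈ Ico (π (Nat.find (hex t))) (π (Nat.find (hex t) + 1)) := by
    refine fun t ht => ⟨?_, Nat.find_spec (hex t)⟩
    rcases hn : Nat.find (hex t) with _ | i
    · rwa [h0]
    · exact not_lt.1 (Nat.find_min (hex t) (m := i) (by omega))
  refine ⟨fun t => π (Nat.find (hex t)), ⟨?_, fun t ht => ?_, fun t ht => (hfind t ht).1,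
    fun t ht => ?_⟩, fun i t ht => ?_, fun t ht => ⟨_, hfind t ht⟩⟩
  · exact (measurable_from_nat (f := π)).comp
      (measurable_find hex fun i => measurableSet_Iio)
  · rw [← h0]
    exact hmono.monotone (Nat.zero_le _)
  · linarith [hTs (Nat.find (hex t)), (hfind t ht).2]
  · have : Nat.find (hex t) = i := by
      rw [Nat.find_eq_iff]
      exact ⟨ht.2, fun j hj => not_lt.2 ((hmono.monotone hj).trans ht.1)⟩
    simp only [this]

section Solutions

variable {n m k : ℕ}
  {f : EuclideanSpace ℝ (Fin n) → EuclideanSpace ℝ (Fin m) → EuclideanSpace ℝ (Fin n)}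
  {h : EuclideanSpace ℝ (Fin n) → EuclideanSpace ℝ (Fin k)}
  {khat κ : EuclideanSpace ℝ (Fin n) → EuclideanSpace ℝ (Fin k) → EuclideanSpace ℝ (Fin m) →
    EuclideanSpace ℝ (Fin n)}
  {kctrl : EuclideanSpace ℝ (Fin n) → EuclideanSpace ℝ (Fin m)}
  {U : Set (EuclideanSpace ℝ (Fin m))} {r τ TH : ℝ} {N : ℕ} {π : ℕ → ℝ} {ℓ : ℝ → ℝ}
  {z₀ : EuclideanSpace ℝ (Fin n)} {x₀ : ℝ → EuclideanSpace ℝ (Fin n)}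
  {u₀ : ℝ → EuclideanSpace ℝ (Fin m)}
  {x z : ℝ → EuclideanSpace ℝ (Fin n)} {w : ℝ → EuclideanSpace ℝ (Fin k)}
  {u : ℝ → EuclideanSpace ℝ (Fin m)}

theorem IsFeedbackSol.isClosedLoopSol (hu : IsControl U u)
    (hκ : ∀ z y u, u ∈ U → khat z y u = κ z y u)
    (hℓ : ∀ i, ∀ t ∈ Ico (π i) (π (i + 1)), ℓ t = π i)
    (hs : IsFeedbackSol f h κ kctrl r τ TH N ℓ x z u) (hx : ∀ t ∈ Icc (-r) 0, x t = x₀ t)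
    (hz : z 0 = z₀) (huu : ∀ t ∈ Ico (-(r + τ)) 0, u t = u₀ t) :
    IsClosedLoopSol f h khat kctrl r τ TH N π z₀ x₀ u₀ x z
      (predictedOutput f h r τ ℓ x z u) u := by
  refine ⟨hs.continuous_x.continuousOn, hx, hs.x_eq, hs.continuous_z.continuousOn, hz,
    fun t ht => ?_, fun i t ht => ?_, huu, hs.feedback⟩
  · simp only [hκ _ _ _ (hu.mem _)]
    rw [← hz]
    exact hs.z_eq t ht
  · rw [predictedOutput, hℓ i t ht]

theorem IsClosedLoopSol.isFeedbackSol (hr : 0 ≤ r) (hτ : 0 ≤ τ) (hTH : 0 < TH) (hU0 : 0 ∈ U)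
    (hk : ∀ x, kctrl x ∈ U) (hκ : ∀ z y u, u ∈ U → khat z y u = κ z y u) (h0 : π 0 = 0)
    (hmono : StrictMono π) (hℓ : ∀ i, ∀ t ∈ Ico (π i) (π (i + 1)), ℓ t = π i)
    (hex : ∀ t, 0 ≤ t → ∃ i, t ∈ Ico (π i) (π (i + 1))) (hu₀ : Measurable u₀)
    (hu₀U : ∀ θ ∈ Ico (-(r + τ)) 0, u₀ θ ∈ U)
    (hs : IsClosedLoopSol f h khat kctrl r τ TH N π z₀ x₀ u₀ x z w u) :
    IsControl U ((Ici (-(r + τ))).indicator u) ∧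
      IsFeedbackSol f h κ kctrl r τ TH N ℓ (fun t => x (max t (-r))) (fun t => z (max t 0))
        ((Ici (-(r + τ))).indicator u) ∧
      ∀ t, 0 ≤ t → w t = predictedOutput f h r τ ℓ (fun t => x (max t (-r)))
        (fun t => z (max t 0)) ((Ici (-(r + τ))).indicator u) t := by
  obtain ⟨hxc, hx0, hxe, hzc, hz0, hze, hw, hu0, hfb⟩ := hs
  set v := (Ici (-(r + τ))).indicator u with hv
  have hvu : ∀ t, -(r + τ) ≤ t → v t = u t := fun t ht => indicator_of_mem ht _
  have hzm : ∀ t, 0 ≤ t → z (max t 0) = z t := fun t ht => by rw [max_eq_left ht]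
  have hxm : ∀ t, -r ≤ t → x (max t (-r)) = x t := fun t ht => by rw [max_eq_left ht]
  have hfb' : ∀ j : ℕ, ∀ t ∈ Ico ((j : ℝ) * TH) (((j : ℝ) + 1) * TH), v t = kctrl
      (PhiN f r τ N (z (max ((j : ℝ) * TH) 0)) fun θ => v ((j : ℝ) * TH + θ)) := fun j t ht => by
    have hj : (0 : ℝ) ≤ j * TH := by positivity
    rw [hvu t (by linarith [ht.1]), hfb j t ht, hzm _ hj]
    congr 1
    exact PhiN_congr (by linarith) fun θ hθ => (hvu _ (by linarith [hθ.1])).symm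
  have hctl : IsControl U v := by
    have h1 : IsControl U (heldControl TH ((Ico (-(r + τ)) 0).indicator u₀) fun j => kctrl
        (PhiN f r τ N (z (max ((j : ℝ) * TH) 0)) fun θ => v ((j : ℝ) * TH + θ))) := by
      refine isControl_heldControl ⟨hu₀.indicator measurableSet_Ico, fun t => ?_⟩ fun j => hk _
      by_cases ht : t ∈ Ico (-(r + τ)) 0
      · rw [indicator_of_mem ht]; exact hu₀U t ht
      · rwa [indicator_of_notMem ht]
    convert h1 using 1
    funext t
    rcases lt_or_ge t 0 with ht | ht
    · rw [heldControl, if_pos ht]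
      by_cases ht' : -(r + τ) ≤ t
      · rw [hvu t ht', indicator_of_mem (by exact ⟨ht', ht⟩), hu0 t ⟨ht', ht⟩]
      · rw [hv, indicator_of_notMem (by simpa using ht'),
          indicator_of_notMem fun h' => ht' h'.1]
    · have hmem : t ∈ Ico ((⌊t / TH⌋₊ : ℝ) * TH) (((⌊t / TH⌋₊ : ℝ) + 1) * TH) :=
        ⟨(le_div_iff₀ hTH).1 (Nat.floor_le (by positivity)),
          (div_lt_iff₀ hTH).1 (Nat.lt_floor_add_one _)⟩
      rw [heldControl_of_mem_Ico hTH hmem, hfb' _ t hmem]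
  have hwp : ∀ t, 0 ≤ t → w t = predictedOutput f h r τ ℓ (fun t => x (max t (-r)))
      (fun t => z (max t 0)) v t := by
    intro t ht
    obtain ⟨i, hi⟩ := hex t ht
    have hπi : 0 ≤ π i := by rw [← h0]; exact hmono.monotone (Nat.zero_le i)
    rw [hw i t hi, predictedOutput, hℓ i t hi, hxm _ (by linarith)]
    congr 1
    refine intervalIntegral.integral_congr fun s hs => ?_
    rw [uIcc_of_le hi.1] at hs
    have hs0 : 0 ≤ s := hπi.trans hs.1
    simp only [hzm s hs0, hvu (s - r - τ) (by linarith)]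
  refine ⟨hctl, ⟨⟨?_, ?_, fun t ht => ?_, fun t ht => ?_⟩, hfb'⟩, hwp⟩
  · exact hxc.comp_continuous (continuous_id.max continuous_const) fun t => mem_Ici.2 (le_max_right _ _)
  · exact hzc.comp_continuous (continuous_id.max continuous_const) fun t => mem_Ici.2 (le_max_right _ _)
  · rw [hxm t (by linarith), hxm 0 (by linarith), hxe t ht]
    congr 1
    refine intervalIntegral.integral_congr fun s hs => ?_
    rw [uIcc_of_le ht] at hs
    simp only [hxm s (by linarith [hs.1]), hvu (s - τ) (by linarith [hs.1])]
  · rw [hzm t ht, hzm 0 le_rfl, hze t ht, hz0]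
    congr 1
    refine intervalIntegral.integral_congr fun s hs => ?_
    rw [uIcc_of_le ht] at hs
    simp only [hzm s hs.1, ← hvu (s - r - τ) (by linarith [hs.1]), ← hwp s hs.1,
      hκ _ _ _ (hctl.mem _)]

end Solutions

section Setup

set_option linter.unusedSectionVars false

variable {E G Y : Type*} [NormedAddCommGroup E] [InnerProductSpace ℝ E] [FiniteDimensional ℝ E]
  [NormedAddCommGroup G] [NormedSpace ℝ G] [FiniteDimensional ℝ G]
  [NormedAddCommGroup Y] [NormedSpace ℝ Y] [FiniteDimensional ℝ Y]

theorem exists_pos_mul_sq_le_inner {Q : E →L[ℝ] E} (hQ : ∀ v : E, v ≠ 0 → 0 < ⟪v, Q v⟫) :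
    ∃ q : ℝ, 0 < q ∧ ∀ e : E, q * ‖e‖ ^ 2 ≤ ⟪e, Q e⟫ := by
  obtain ⟨q, hq, hle⟩ := (isCompact_sphere (0 : E) 1).exists_forall_le' (a := 0)
    (f := fun v => ⟪v, Q v⟫) (by fun_prop) fun v hv => hQ v (by rintro rfl; simp at hv)
  refine ⟨q, hq, fun e => ?_⟩
  rcases eq_or_ne e 0 with rfl | he
  · simp
  have hn : 0 < ‖e‖ := norm_pos_iff.2 he
  have h1 := hle (‖e‖⁻¹ • e) (by simp [norm_smul, hn.ne'])
  simp only [map_smul, inner_smul_left, inner_smul_right, conj_trivial] at h1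
  calc q * ‖e‖ ^ 2 ≤ ‖e‖⁻¹ * (‖e‖⁻¹ * ⟪e, Q e⟫) * ‖e‖ ^ 2 := by gcongr
    _ = _ := by field_simp

theorem observerSetup_observerCorrection {f : E → G → E} {h : E → Y} {U : Set G} {V W : E → ℝ}
    {R a b : ℝ} {L : Y →L[ℝ] E} {p : ℝ → ℝ} (hf : ContDiff ℝ 1 fun q : E × G => f q.1 q.2)
    (hf0 : f 0 0 = 0) (hUcomp : IsCompact U) (hU0 : 0 ∈ U) (hh : ContDiff ℝ 2 h) (hh0 : h 0 = 0)
    (hV : ContDiff ℝ 2 V) (hVnonneg : ∀ x, 0 ≤ V x)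
    (hVradial : ∀ M : ℝ, Bornology.IsBounded {x | V x ≤ M}) (hW : ContDiff ℝ 1 W) (hW0 : W 0 = 0)
    (hWpos : ∀ x ≠ 0, 0 < W x)
    (hH1 : ∀ x u, u ∈ U → R ≤ V x → ⟪gradient V x, f x u⟫ ≤ -W x)
    (hS1nhds : {x | V x ≤ R} ∈ 𝓝 (0 : E)) (hgradV : ∀ z, R < V z → gradient V z ≠ 0) (hbR : R < b)
    (haR : R ≤ a) (hp : LocallyLipschitz p)
    (hpb : ∀ s, b ≤ s → p s = 1) (hpa : ∀ s, s ≤ a → p s = 0) :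
    ObserverSetup f h (observerCorrection V W p f h L) U V W R b := by
  have hdeg : ∀ z, gradient V z = 0 → ∀ᶠ z' in 𝓝 z, p (V z') = 0 := by
    intro z hz
    have hzR : V z ≤ R := not_lt.1 fun hlt => hgradV z hlt hz
    suffices hev : ∀ᶠ z' in 𝓝 z, V z' ≤ R from hev.mono fun z' hz' => hpa _ (hz'.trans haR)
    rcases hzR.lt_or_eq with hlt | heq
    · exact (hV.continuous.continuousAt.eventually_lt_const hlt).mono fun _ h' => h'.le
    · have h1 := hH1 z 0 hU0 heq.ge
      rw [hz, inner_zero_left] at h1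
      obtain rfl : z = 0 := by
        by_contra hne
        linarith [hWpos z hne]
      exact hS1nhds
  have hfd : ∀ x y, fderiv ℝ V x y = ⟪gradient V x, y⟫ := fun x y => inner_gradient_left.symm
  have hWnn : ∀ x, 0 ≤ W x := fun x => by
    rcases eq_or_ne x 0 with rfl | hx
    exacts [hW0.ge, (hWpos x hx).le]
  refine ⟨hf.locallyLipschitz, hf0, (hh.of_le (by norm_num)).locallyLipschitz, hh0,
    hh.of_le (by norm_num), ?_,
    locallyLipschitz_observerCorrection hV hW hp hf (hh.of_le (by norm_num)) hdeg, ?_, hUcomp, hU0,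
    hV.of_le (by norm_num), hVnonneg, hVradial, hWnn, fun M => ?_, hbR, fun x u hu hx => ?_,
    fun z y u hu hz => ?_⟩
  · exact (((hh.fderiv_right (m := 1) (by norm_num)).comp contDiff_fst).clm_apply
      hf).locallyLipschitz
  · have h0 : V 0 ≤ R := by simpa using mem_of_mem_nhds hS1nhds
    rw [observerCorrection_of_eq_zero (hpa _ (h0.trans haR)), hh0, sub_zero, map_zero]
  · have hK : IsCompact ({x | V x ≤ M} \ interior {x | V x ≤ R}) :=
      (Metric.isCompact_of_isClosed_isBounded (isClosed_le hV.continuous continuous_const)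
        (hVradial M)).diff isOpen_interior
    obtain ⟨η, hη, hle⟩ := hK.exists_forall_le' (a := 0) hW.continuous.continuousOn
      fun x hx => hWpos x (by rintro rfl; exact hx.2 (mem_interior_iff_mem_nhds.2 hS1nhds))
    exact ⟨η, hη, fun z hz hzM => hle z ⟨hzM, fun hz' => by
      have : z ∈ {x | V x ≤ R} := interior_subset hz'
      exact hz.not_ge this⟩⟩
  · rw [hfd]; exact hH1 x u hu hx
  · rw [hfd]
    have hz' : R < V z := hbR.trans_le hz
    exact inner_gradient_observerCorrection_le (hgradV z hz') (hH1 z u hu hz'.le) (hpb _ hz)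

end Setup

/-- Theorem 2.2: under (H1)–(H4), for sufficiently small `T_s, T_H > 0`
and a sufficiently large integer `N > 0` there exist a locally Lipschitz `K∞` function
`C` and `σ > 0` such that for every partition with steps `≤ T_s` and all initial data
`(z₀, x₀, u₀)`, the ISP-O-P-DFC closed loop has a unique solution defined for all
`t ≥ 0`, and this solution satisfies
`‖x_t‖ + |z(t)| + ‖ũ_t‖ ≤ e^{−σt} C(‖x₀‖ + |z₀| + ‖ũ₀‖)` for all `t ≥ 0`. -/
theorem stmt_0
    (n m k : ℕ)
    (f : EuclideanSpace ℝ (Fin n) → EuclideanSpace ℝ (Fin m) → EuclideanSpace ℝ (Fin n))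
    (hf : ContDiff ℝ (⊤ : ℕ∞) (fun p : EuclideanSpace ℝ (Fin n) × EuclideanSpace ℝ (Fin m) => f p.1 p.2))
    (hf0 : f 0 0 = 0)
    (U : Set (EuclideanSpace ℝ (Fin m))) (hUcomp : IsCompact U) (hUne : U.Nonempty)
    (hU0 : (0 : EuclideanSpace ℝ (Fin m)) ∈ U)
    (h : EuclideanSpace ℝ (Fin n) → EuclideanSpace ℝ (Fin k)) (hh : ContDiff ℝ (⊤ : ℕ∞) h) (hh0 : h 0 = 0)
    (τ r : ℝ) (hτ : 0 ≤ τ) (hr : 0 ≤ r)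
    -- (H1)
    (V : EuclideanSpace ℝ (Fin n) → ℝ) (hV : ContDiff ℝ 2 V) (hVnonneg : ∀ x, 0 ≤ V x)
    (hVradial : ∀ M : ℝ, Bornology.IsBounded {x | V x ≤ M})
    (W : EuclideanSpace ℝ (Fin n) → ℝ) (hW : ContDiff ℝ 1 W)
    (hWpos : W 0 = 0 ∧ ∀ x ≠ 0, 0 < W x)
    (R : ℝ) (hR : 0 < R)
    (hH1 : ∀ x u, u ∈ U → R ≤ V x → ⟪gradient V x, f x u⟫ ≤ -W x)
    (hS1nhds : {x | V x ≤ R} ∈ 𝓝 (0 : EuclideanSpace ℝ (Fin n)))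
    (hgradV : ∀ z, R < V z → gradient V z ≠ 0)
    -- (H2)
    (P : EuclideanSpace ℝ (Fin n) → ℝ) (hP : ContDiff ℝ 2 P)
    (hPpos : P 0 = 0 ∧ ∀ x ≠ 0, 0 < P x)
    (μ K₁ : ℝ) (hμ : 0 < μ) (hK₁ : 0 < K₁)
    (hPlower : ∀ x, V x ≤ R → K₁ * ‖x‖ ^ 2 ≤ P x)
    (kctrl : EuclideanSpace ℝ (Fin n) → EuclideanSpace ℝ (Fin m))
    (hkU : ∀ x, kctrl x ∈ U) (hk0 : kctrl 0 = 0) (hklip : LocallyLipschitz kctrl)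
    (hH2 : ∀ x, V x ≤ R → ⟪gradient P x, f x (kctrl x)⟫ ≤ -2 * μ * ‖x‖ ^ 2)
    -- (H3)
    (Q : EuclideanSpace ℝ (Fin n) →L[ℝ] EuclideanSpace ℝ (Fin n))
    (hQsym : ∀ v w : EuclideanSpace ℝ (Fin n), ⟪Q v, w⟫ = ⟪v, Q w⟫)
    (hQpos : ∀ v : EuclideanSpace ℝ (Fin n), v ≠ 0 → 0 < ⟪v, Q v⟫)
    (ω : ℝ) (hω : 0 < ω) (b : ℝ) (hbR : R < b)
    (L : EuclideanSpace ℝ (Fin k) →L[ℝ] EuclideanSpace ℝ (Fin n))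
    (hH3 : ∀ u z x, u ∈ U → V z ≤ b → V x ≤ R →
      ⟪z - x, Q (f z u + L (h z - h x) - f x u)⟫ ≤ -ω * ‖z - x‖ ^ 2)
    -- (H4)
    (c : ℝ) (hc : c ∈ Ioo (0:ℝ) 1) (a : ℝ) (haR : R ≤ a) (hab : a < b)
    (hH4 : ∀ u z x, u ∈ U → a < V z → V z ≤ b → ⟪gradient V z, Q (z - x)⟫ < 0 → V x ≤ R →
      ⟪gradient V z, f z u + L (h z - h x)⟫ ≤ -W z +
        (1 - c) * ‖gradient V z‖ ^ 2 *
          ⟪z - x, Q (f z u + L (h z - h x) - f x u)⟫ / ⟪gradient V z, Q (z - x)⟫)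
    -- the function `p`
    (p : ℝ → ℝ) (hp : LocallyLipschitz p) (hp01 : ∀ s, p s ∈ Icc (0:ℝ) 1)
    (hpb : ∀ s, b ≤ s → p s = 1) (hpa : ∀ s, s ≤ a → p s = 0)
    -- the functions `φ` and `k̂`
    (φ : EuclideanSpace ℝ (Fin n) → EuclideanSpace ℝ (Fin k) → EuclideanSpace ℝ (Fin m) → ℝ)
    (hφ : ∀ z y u, φ z y u =
      max 0 (⟪gradient V z, f z u⟫ + W z + p (V z) * ⟪gradient V z, L (h z - y)⟫))
    (khat : EuclideanSpace ℝ (Fin n) → EuclideanSpace ℝ (Fin k) → EuclideanSpace ℝ (Fin m) →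
      EuclideanSpace ℝ (Fin n))
    (hkhat1 : ∀ z y u, V z ≤ R → khat z y u = L (h z - y))
    (hkhat2 : ∀ z y u, R < V z →
      khat z y u = L (h z - y) - (φ z y u / ‖gradient V z‖ ^ 2) • gradient V z) :
    ∃ Ts : ℝ, 0 < Ts ∧ ∃ TH : ℝ, 0 < TH ∧ ∃ N : ℕ, 0 < N ∧
      ∃ C : ℝ → ℝ, (C 0 = 0 ∧ StrictMonoOn C (Ici 0) ∧ ContinuousOn C (Ici 0) ∧
          Tendsto C atTop atTop ∧ LocallyLipschitz C) ∧
      ∃ σ : ℝ, 0 < σ ∧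
      ∀ π : ℕ → ℝ, π 0 = 0 → StrictMono π → Tendsto π atTop atTop →
        (∀ i, π (i + 1) - π i ≤ Ts) →
      ∀ z₀ : EuclideanSpace ℝ (Fin n),
      ∀ x₀ : ℝ → EuclideanSpace ℝ (Fin n), ContinuousOn x₀ (Icc (-r) 0) →
      ∀ u₀ : ℝ → EuclideanSpace ℝ (Fin m), Measurable u₀ →
        (∀ θ ∈ Ico (-(r + τ)) (0:ℝ), u₀ θ ∈ U) →
      ∃ (x z : ℝ → EuclideanSpace ℝ (Fin n)) (w : ℝ → EuclideanSpace ℝ (Fin k))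
        (u : ℝ → EuclideanSpace ℝ (Fin m)),
        IsClosedLoopSol f h khat kctrl r τ TH N π z₀ x₀ u₀ x z w u ∧
        (∀ (x' z' : ℝ → EuclideanSpace ℝ (Fin n)) (w' : ℝ → EuclideanSpace ℝ (Fin k))
            (u' : ℝ → EuclideanSpace ℝ (Fin m)),
          IsClosedLoopSol f h khat kctrl r τ TH N π z₀ x₀ u₀ x' z' w' u' →
            (∀ t, -r ≤ t → x' t = x t) ∧ (∀ t, 0 ≤ t → z' t = z t ∧ w' t = w t) ∧
            (∀ t, -(r + τ) ≤ t → u' t = u t)) ∧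
        ∀ t, 0 ≤ t →
          (⨆ θ : Icc (-r) (0:ℝ), ‖x (t + θ)‖) + ‖z t‖ +
              (⨆ θ : Ico (-(r + τ)) (0:ℝ), ‖u (t + θ)‖) ≤
            Real.exp (-σ * t) *
              C ((⨆ θ : Icc (-r) (0:ℝ), ‖x₀ θ‖) + ‖z₀‖ +
                  (⨆ θ : Ico (-(r + τ)) (0:ℝ), ‖u₀ θ‖)) := by
  have hf1 : ContDiff ℝ 1 fun q : EuclideanSpace ℝ (Fin n) × EuclideanSpace ℝ (Fin m) => f q.1 q.2 :=
    hf.of_le (by exact_mod_cast le_top)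
  have H := observerSetup_observerCorrection (L := L) hf1 hf0 hUcomp hU0
    (by exact_mod_cast contDiff_infty.1 hh 2) hh0 hV hVnonneg hVradial hW hWpos.1 hWpos.2 hH1 hS1nhds
    hgradV hbR haR hp hpb hpa
  set κ := observerCorrection V W p f h L with hκdef
  have hκ : ∀ z y u, u ∈ U → khat z y u = κ z y u := by
    intro z y u hu
    rcases le_or_gt (V z) R with hz | hz
    · rw [hkhat1 z y u hz, hκdef, observerCorrection_of_eq_zero (hpa _ (hz.trans haR))]
    · rw [hkhat2 z y u hz, hφ, hκdef, observerCorrection_eq (hH1 z u hu hz.le)]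
  obtain ⟨q, hq, hQq⟩ := exists_pos_mul_sq_le_inner hQpos
  obtain ⟨Ts, hTs, TH, hTH, N, hN, σ, hσ, hdec⟩ := H.exists_closedLoop_decay hr hτ hR.le hQsym hq
    hQq (mul_pos hc.1 hω) (by positivity : 0 ≤ 2 * ‖L‖)
    (fun z y y' u _ => norm_observerCorrection_sub_le (hp01 _) y y' u)
    (fun z x u hu hz hx => inner_observerCorrection_le hQsym hc hp01 hpa
      (fun hza => hH1 z u hu (haR.trans hza.le)) (fun hza => hgradV z (haR.trans_lt hza)) hω.le
      (hH3 u z x hu hz hx) fun hza hneg => hH4 u z x hu hza hz hneg hx)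
    hkU hklip hk0 hP hPpos.1 (fun x => by
      rcases eq_or_ne x 0 with rfl | hx
      exacts [hPpos.1.ge, (hPpos.2 x hx).le]) hμ hK₁ hPlower
    (fun x hx => inner_gradient_left.symm.trans_le (hH2 x hx))
  choose Γ hΓ1 hΓ using hdec
  set A := Real.exp (σ * (r + τ)) with hA
  have hA0 : 0 < A := Real.exp_pos _
  obtain ⟨C, hC, hCge⟩ := exists_classK_ge (fun M => 3 * (A * Γ M)) fun M => by
    have := zero_le_one.trans (hΓ1 M)
    positivity
  refine ⟨Ts, hTs, TH, hTH, N, hN, C, hC, σ, hσ, fun π hπ0 hπmono hπtop hπTs z₀ x₀ hx₀ u₀ hu₀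
    hu₀U => ?_⟩
  obtain ⟨ℓ, hℓ, hℓπ, hex⟩ := exists_lastSample hπ0 hπmono hπtop hπTs
  have hu₀' : IsControl U ((Ico (-(r + τ)) 0).indicator u₀) := by
    refine ⟨hu₀.indicator measurableSet_Ico, fun t => ?_⟩
    by_cases ht : t ∈ Ico (-(r + τ)) 0
    · rw [indicator_of_mem ht]; exact hu₀U t ht
    · rwa [indicator_of_notMem ht]
  have hx₀' : Continuous fun t => x₀ (max (-r) (min t 0)) :=
    hx₀.comp_continuous (by fun_prop) fun t => ⟨le_max_left _ _, max_le (by linarith) (min_le_right _ _)⟩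
  obtain ⟨x, z, u, hu, hs, hxx, hzz, huu⟩ := H.exists_feedbackSol (τ := τ) hr hτ hTs.le hTH hℓ hkU N
    hu₀' hx₀' z₀
  replace hxx : ∀ t ∈ Icc (-r) 0, x t = x₀ t := fun t ht => by
    rw [hxx t ht.2, min_eq_left ht.2, max_eq_right ht.1]
  replace huu : ∀ t ∈ Ico (-(r + τ)) 0, u t = u₀ t := fun t ht => by
    rw [huu t ht.2, indicator_of_mem ht]
  refine ⟨x, z, predictedOutput f h r τ ℓ x z u, u, hs.isClosedLoopSol hu hκ hℓπ hxx hzz huu,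
    fun x' z' w' u' hs' => ?_, fun t ht => ?_⟩
  · obtain ⟨hu', hfs, hw'⟩ := hs'.isFeedbackSol hr hτ hTH hU0 hkU hκ hπ0 hπmono hℓπ hex hu₀ hu₀U
    obtain ⟨hx', hz', hu''⟩ := H.feedbackSol_unique hr hτ hTH hℓ hu' hu hfs hs
      (fun t ht => by rw [max_eq_left ht.1, hs'.2.1 t ht, hxx t ht])
      (by rw [max_self, hs'.2.2.2.2.1, hzz])
      (fun t ht => by
        rw [indicator_of_mem (by exact ht.1), hs'.2.2.2.2.2.2.2.1 t ht, huu t ht])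
    refine ⟨fun t ht => by simpa [max_eq_left ht] using hx' t ht,
      fun t ht => ⟨by simpa [max_eq_left ht] using hz' t ht, ?_⟩, fun t ht => by
        rw [← hu'' t ht, indicator_of_mem (by exact ht)]⟩
    rw [hw' t ht, predictedOutput, predictedOutput, hx' _ (by linarith [hℓ.nonneg t ht])]
    congr 1
    refine intervalIntegral.integral_congr fun s hs => ?_
    rw [uIcc_of_le (hℓ.le t ht)] at hs
    have hs0 := (hℓ.nonneg t ht).trans hs.1
    rw [hz' s hs0, hu'' (s - r - τ) (by linarith)]
  · obtain ⟨s, hsdef⟩ : ∃ s, s = (⨆ θ : Icc (-r) (0:ℝ), ‖x₀ θ‖) + ‖z₀‖ +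
        (⨆ θ : Ico (-(r + τ)) (0:ℝ), ‖u₀ θ‖) := ⟨_, rfl⟩
    have hsx : 0 ≤ ⨆ θ : Icc (-r) (0:ℝ), ‖x₀ θ‖ := Real.iSup_nonneg fun _ => norm_nonneg _
    have hsu : 0 ≤ ⨆ θ : Ico (-(r + τ)) (0:ℝ), ‖u₀ θ‖ := Real.iSup_nonneg fun _ => norm_nonneg _
    have hz0 := norm_nonneg z₀
    have hs0 : 0 ≤ s := by linarith
    have hxs : ∀ t ∈ Icc (-r) 0, ‖x t‖ ≤ s := fun t ht => by
      obtain ⟨B, hB⟩ := isCompact_Icc.exists_bound_of_continuousOn hx₀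
      have := le_ciSup (f := fun θ : Icc (-r) (0:ℝ) => ‖x₀ θ‖)
        ⟨B, by rintro _ ⟨θ, rfl⟩; exact hB θ θ.2⟩ ⟨t, ht⟩
      rw [hxx t ht]
      linarith
    have hus : ∀ t ∈ Ico (-(r + τ)) 0, ‖u t‖ ≤ s := fun t ht => by
      obtain ⟨B, -, hB⟩ := hUcomp.exists_norm_le
      have := le_ciSup (f := fun θ : Ico (-(r + τ)) (0:ℝ) => ‖u₀ θ‖)
        ⟨B, by rintro _ ⟨θ, rfl⟩; exact hB _ (hu₀U θ θ.2)⟩ ⟨t, ht⟩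
      rw [huu t ht]
      linarith
    obtain ⟨hbx, hbz, hbu⟩ := hΓ ⌈s⌉₊ ℓ x z u s hℓ hu hs (Nat.le_ceil s) hxs
      (by rw [hzz]; linarith) hus
    obtain ⟨D, hD⟩ : ∃ D, D = Γ ⌈s⌉₊ * s := ⟨_, rfl⟩
    have hD0 : 0 ≤ D := by
      rw [hD]; exact mul_nonneg (zero_le_one.trans (hΓ1 _)) hs0
    rw [← hD] at hbx hbz hbu
    have hshift : ∀ θ, -(r + τ) ≤ θ →
        D * Real.exp (-σ * (t + θ)) ≤ A * D * Real.exp (-σ * t) := by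
      intro θ hθ
      rw [mul_comm A D, mul_assoc, hA, ← Real.exp_add]
      refine mul_le_mul_of_nonneg_left (Real.exp_le_exp.2 ?_) hD0
      nlinarith
    have hpos : 0 ≤ A * D * Real.exp (-σ * t) := by positivity
    have h1 : (⨆ θ : Icc (-r) (0:ℝ), ‖x (t + θ)‖) ≤ A * D * Real.exp (-σ * t) :=
      Real.iSup_le (fun θ => (hbx _ (by linarith [θ.2.1])).trans
        (hshift _ (by linarith [θ.2.1]))) hpos
    have h2 : (⨆ θ : Ico (-(r + τ)) (0:ℝ), ‖u (t + θ)‖) ≤ A * D * Real.exp (-σ * t) :=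
      Real.iSup_le (fun θ => (hbu _ (by linarith [θ.2.1])).trans (hshift _ θ.2.1)) hpos
    have h3 : ‖z t‖ ≤ A * D * Real.exp (-σ * t) := by
      simpa using (hbz t ht).trans (by simpa using hshift 0 (by linarith))
    have h4 : 3 * (A * D) ≤ C s := by
      rw [hD]
      calc _ = 3 * (A * Γ ⌈s⌉₊) * s := by ring
        _ ≤ C s := hCge s hs0
    rw [← hsdef]
    calc _ ≤ Real.exp (-σ * t) * (3 * (A * D)) := by linarith
      _ ≤ _ := by gcongr
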